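/- Under the blow-up decomposition hypotheses, assume additionally that either ε_n > 0 for all n or ε_n < 0 for all n. Then ∂_τΦ(p) = 0; moreover, if all ε_n > 0 then ∂_νΦ(p) ≥ 0, while if all ε_n < 0 then ∂_νΦ(p) ≤ 0. -/

import Mathlib

open MeasureTheory Real Filter

noncomputable section

/-- The open unit disk in ℝ² ≅ ℂ. -/
def unitDisk : Set ℂ := Metric.ball 0 1

/-- The unit circle ∂𝔻. -/
def unitCircle : Set ℂ := Metric.sphere 0 1

/-- The closed unit disk. -/
def closedUnitDisk : Set ℂ := Metric.closedBall 0 1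

/-- Directional derivative of `u` at `x` in direction `v`. -/
def pd (u : ℂ → ℝ) (v x : ℂ) : ℝ := fderiv ℝ u x v

/-- Laplacian of `u` at `x`. -/
def lap (u : ℂ → ℝ) (x : ℂ) : ℝ :=
  fderiv ℝ (fun y => pd u 1 y) x 1 + fderiv ℝ (fun y => pd u Complex.I y) x Complex.I

/-- Squared norm of the gradient, |∇u|². -/
def gradSq (u : ℂ → ℝ) (x : ℂ) : ℝ := pd u 1 x ^ 2 + pd u Complex.I x ^ 2

/-- Outward normal derivative ∂_ν u(x) = ∇u(x)·x at a boundary point. -/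
def nderiv (u : ℂ → ℝ) (x : ℂ) : ℝ := x.re * pd u 1 x + x.im * pd u Complex.I x

/-- Tangential derivative ∂_τ u(x) = ∇u(x)·(−x₂,x₁) at a boundary point. -/
def tderiv (u : ℂ → ℝ) (x : ℂ) : ℝ := -x.im * pd u 1 x + x.re * pd u Complex.I x

/-- Unit-speed parametrization of the unit circle. -/
def bpt (θ : ℝ) : ℂ := Complex.exp ((θ : ℂ) * Complex.I)

/-- Integral over ∂𝔻 with respect to arclength. -/
def bint (f : ℂ → ℝ) : ℝ := ∫ θ in (0:ℝ)..(2 * π), f (bpt θ)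

/-- A solution of the prescribed curvature problem for `(K, h)`. -/
def IsSolution (K h u : ℂ → ℝ) : Prop :=
  ContDiff ℝ 2 u ∧
  (∀ x ∈ unitDisk, -lap u x = 2 * K x * Real.exp (u x)) ∧
  (∀ x ∈ unitCircle, nderiv u x + 2 = 2 * h x * Real.exp (u x / 2))

/-- The auxiliary function Φ = H + √(H² + K). -/
def Phi (K H : ℂ → ℝ) (x : ℂ) : ℝ := H x + Real.sqrt (H x ^ 2 + K x)

/-- `H` is the harmonic extension of `h`, C¹ up to the boundary. -/
def IsHarmExt (h H : ℂ → ℝ) : Prop :=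
  ContDiff ℝ 1 H ∧ ContDiffOn ℝ 2 H unitDisk ∧
  (∀ x ∈ unitDisk, lap H x = 0) ∧ ∀ x ∈ unitCircle, H x = h x

/-- K_ε. -/
def Keps (K : ℂ → ℝ) (ε : ℝ) (x : ℂ) : ℝ := (K x - ε / 2) / (1 + ε)

/-- h_ε. -/
def heps (h : ℂ → ℝ) (ε : ℝ) (x : ℂ) : ℝ := h x / (1 + ε)

/-- K̃_ε. -/
def Ktil (ε : ℝ) : ℝ := -ε / (2 * (1 + ε))

/-- h̃_ε. -/
def htil (ε : ℝ) : ℝ := 1 / (1 + ε)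

/-- A solution of the perturbed problem (P_ε). -/
def IsPerturbedSolution (K h : ℂ → ℝ) (ε : ℝ) (u : ℂ → ℝ) : Prop :=
  ContDiff ℝ 2 u ∧
  (∀ x ∈ unitDisk, -lap u x + 2 * Ktil ε = 2 * Keps K ε x * Real.exp (u x)) ∧
  (∀ x ∈ unitCircle, nderiv u x + 2 * htil ε = 2 * heps h ε x * Real.exp (u x / 2))

/-- The energy functional I. -/
def Ifun (K h u : ℂ → ℝ) : ℝ :=
  (∫ x in unitDisk, ((1/2) * gradSq u x - 2 * K x * Real.exp (u x))) +
  bint (fun x => 2 * u x - 4 * h x * Real.exp (u x / 2))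

/-- The perturbation term T. -/
def Tfun (u : ℂ → ℝ) : ℝ :=
  ∫ x in unitDisk, ((1/2) * gradSq u x + Real.exp (u x) - u x)

/-- The perturbed functional I_ε. -/
def Ieps (K h : ℂ → ℝ) (ε : ℝ) (u : ℂ → ℝ) : ℝ := (Ifun K h u + ε * Tfun u) / (1 + ε)

/-- The Möbius map f_a(x) = (a+x)/(1+āx) of the disk. -/
def moeb (a x : ℂ) : ℂ := (a + x) / (1 + (starRingEnd ℂ) a * x)

/-- φ̂ = h_ε(a/|a|) + √(h_ε(a/|a|)² + K_ε(a/|a|)). -/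
def phiHat (K h : ℂ → ℝ) (ε : ℝ) (a : ℂ) : ℝ :=
  heps h ε (a / (‖a‖ : ℂ)) +
    Real.sqrt (heps h ε (a / (‖a‖ : ℂ)) ^ 2 + Keps K ε (a / (‖a‖ : ℂ)))

/-- k̂ = K_ε(a/|a|). -/
def kHat (K : ℂ → ℝ) (ε : ℝ) (a : ℂ) : ℝ := Keps K ε (a / (‖a‖ : ℂ))

/-- Denominator of the bubble: φ̂²|1 − āx|² + k̂|x − a|². -/
def bubDen (K h : ℂ → ℝ) (ε : ℝ) (a x : ℂ) : ℝ :=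
  phiHat K h ε a ^ 2 * ‖1 - (starRingEnd ℂ) a * x‖ ^ 2 + kHat K ε a * ‖x - a‖ ^ 2

/-- The bubble u_a(x) = 2 log( 2φ̂(1−|a|²) / (φ̂²|1−āx|² + k̂|x−a|²) ). -/
def bub (K h : ℂ → ℝ) (ε : ℝ) (a x : ℂ) : ℝ :=
  2 * Real.log (2 * phiHat K h ε a * (1 - ‖a‖ ^ 2) / bubDen K h ε a x)

/-- The recentred function v(x) = u(f_a(x)) + 2 log|f'_a(x)|,
where |f'_a(x)| = (1−|a|²)/|1+āx|². -/
def recen (a : ℂ) (u : ℂ → ℝ) (x : ℂ) : ℝ :=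
  u (moeb a x) + 2 * Real.log ((1 - ‖a‖ ^ 2) / ‖1 + (starRingEnd ℂ) a * x‖ ^ 2)

open Complex (I reCLM imCLM continuous_re continuous_im norm_real normSq_apply normSq_eq_norm_sq mul_re mul_im abs_re_le_norm abs_im_le_norm one_re sub_re)
variable {x y : ℂ} {f g w u J : ℂ → ℝ}
lemma bpt_eq (θ : ℝ) : bpt θ = (cos θ : ℂ) + (sin θ : ℂ) * I := by
  simp [bpt, Complex.exp_mul_I]
lemma bpt_re (θ : ℝ) : (bpt θ).re = cos θ := by
  rw [bpt_eq]; simp [-Complex.ofReal_cos, -Complex.ofReal_sin]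
lemma bpt_im (θ : ℝ) : (bpt θ).im = sin θ := by
  rw [bpt_eq]; simp [-Complex.ofReal_cos, -Complex.ofReal_sin]
lemma norm_bpt (θ : ℝ) : ‖bpt θ‖ = 1 := by
  simp [bpt, Complex.norm_exp_ofReal_mul_I]
lemma bpt_mem (θ : ℝ) : bpt θ ∈ Metric.closedBall (0:ℂ) 1 := by simp [norm_bpt]
lemma bpt_hasDeriv (θ : ℝ) : HasDerivAt bpt (I * bpt θ) θ := by
  have h1 : HasDerivAt (fun t : ℝ => (t:ℂ) * I) I θ := by
    simpa using (Complex.ofRealCLM.hasDerivAt (x := θ)).mul_const I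
  exact (h1.cexp).congr_deriv (mul_comm _ _)
lemma bpt_cont : Continuous bpt := by unfold bpt; fun_prop
lemma bpt_add_two_pi (θ : ℝ) : bpt (θ + 2 * π) = bpt θ := by
  rw [bpt_eq, bpt_eq, cos_add_two_pi, sin_add_two_pi]
lemma bpt_zero : bpt 0 = 1 := by simp [bpt]
lemma bpt_two_pi : bpt (2 * π) = 1 := by
  have := bpt_add_two_pi 0; simpa [bpt_zero] using this
lemma disk_polar {E : Type*} [NormedAddCommGroup E] [NormedSpace ℝ E] (G : ℂ → E) :
    ∫ x in Metric.ball (0:ℂ) 1, G x =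
      ∫ q in (Set.Ioo (0:ℝ) 1 ×ˢ Set.Ioo (-π) π), q.1 • G (q.1 * bpt q.2) := by
  rw [← integral_indicator Metric.isOpen_ball.measurableSet,
    ← Complex.integral_comp_polarCoord_symm]
  have hb : ∀ q, Complex.polarCoord.symm q = q.1 * bpt q.2 := fun q => by
    rw [Complex.polarCoord_symm_apply, bpt_eq]
  simp only [hb]
  have hm : MeasurableSet (Set.Ioo (0:ℝ) 1 ×ˢ Set.Ioo (-π) π) :=
    (measurableSet_Ioo).prod measurableSet_Ioo
  have hm2 : MeasurableSet polarCoord.target := polarCoord.open_target.measurableSet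
  rw [← integral_indicator hm, ← integral_indicator hm2]
  congr 1
  ext q
  by_cases h1 : q ∈ polarCoord.target
  · have h1' := h1
    simp only [polarCoord_target, Set.mem_prod, Set.mem_Ioi] at h1'
    by_cases h2 : q.1 < 1
    · have h3 : q ∈ Set.Ioo (0:ℝ) 1 ×ˢ Set.Ioo (-π) π := ⟨⟨h1'.1, h2⟩, h1'.2⟩
      rw [Set.indicator_of_mem h1, Set.indicator_of_mem h3, Set.indicator_of_mem]
      simp [norm_bpt, abs_of_pos h1'.1, h2]
    · have h3 : q ∉ Set.Ioo (0:ℝ) 1 ×ˢ Set.Ioo (-π) π := fun h => h2 h.1.2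
      rw [Set.indicator_of_mem h1, Set.indicator_of_notMem h3, Set.indicator_of_notMem]
      · simp
      · simp [norm_bpt, abs_of_pos h1'.1]; linarith
  · have h3 : q ∉ Set.Ioo (0:ℝ) 1 ×ˢ Set.Ioo (-π) π := fun h => h1 (by
      simp only [polarCoord_target, Set.mem_prod, Set.mem_Ioi]; exact ⟨h.1.1, h.2⟩)
    rw [Set.indicator_of_notMem h1, Set.indicator_of_notMem h3]
lemma Icc_prod_ae : (Set.Ioo (0:ℝ) 1 ×ˢ Set.Ioo (-π) π : Set (ℝ × ℝ)) =ᵐ[volume]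
    Set.Icc ((0:ℝ), -π) (1, π) := by
  rw [← Set.Icc_prod_Icc]
  exact Measure.set_prod_ae_eq Ioo_ae_eq_Icc Ioo_ae_eq_Icc
lemma bint_shift (F : ℂ → ℝ) : ∫ θ in (-π)..π, F (bpt θ) = bint F := by
  have hper : Function.Periodic (fun θ => F (bpt θ)) (2 * π) := fun θ => by
    simp [bpt_add_two_pi]
  have := hper.intervalIntegral_add_eq (-π) 0
  rw [bint]
  convert this using 2 <;> ring
theorem div_thm (P Q : ℂ → ℝ)
    (hP : ∀ x ∈ Metric.closedBall (0:ℂ) 1, ContDiffAt ℝ 1 P x)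
    (hQ : ∀ x ∈ Metric.closedBall (0:ℂ) 1, ContDiffAt ℝ 1 Q x) :
    ∫ x in Metric.ball (0:ℂ) 1, (pd P 1 x + pd Q I x) =
      bint (fun x => x.re * P x + x.im * Q x) := by
  rw [disk_polar, setIntegral_congr_set Icc_prod_ae]
  set m : ℝ × ℝ → ℂ := fun q => q.1 * bpt q.2 with hm
  have hmem : ∀ q ∈ Set.Icc ((0:ℝ), -π) (1, π), m q ∈ Metric.closedBall (0:ℂ) 1 := by
    intro q hq
    simp only [hm, Metric.mem_closedBall, dist_zero_right, norm_mul, norm_bpt, mul_one,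
      norm_real, norm_eq_abs]
    rw [abs_of_nonneg hq.1.1]; exact hq.2.1
  let m' : ℝ × ℝ → ℝ × ℝ →L[ℝ] ℂ := fun q =>
    (ContinuousLinearMap.fst ℝ ℝ ℝ).smulRight (bpt q.2) +
      (ContinuousLinearMap.snd ℝ ℝ ℝ).smulRight (q.1 * (I * bpt q.2))
  have hmd : ∀ q, HasFDerivAt m (m' q) q := by
    intro q
    have h1 : HasFDerivAt (fun q : ℝ × ℝ => (q.1 : ℂ))
        (Complex.ofRealCLM.comp (ContinuousLinearMap.fst ℝ ℝ ℝ)) q :=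
      Complex.ofRealCLM.hasFDerivAt.comp q hasFDerivAt_fst
    have h2 : HasFDerivAt (fun q : ℝ × ℝ => bpt q.2)
        ((ContinuousLinearMap.toSpanSingleton ℝ (I * bpt q.2)).comp
          (ContinuousLinearMap.snd ℝ ℝ ℝ)) q :=
      (bpt_hasDeriv q.2).hasFDerivAt.comp q hasFDerivAt_snd
    have h3 := h1.mul h2
    refine h3.congr_fderiv ?_
    ext <;> simp [m'] <;> ring_nf
  have hmc : Continuous m := by
    simp only [hm]; exact (Complex.continuous_ofReal.comp continuous_fst).mul
      (bpt_cont.comp continuous_snd)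
  have hPd : ∀ x ∈ Metric.closedBall (0:ℂ) 1, HasFDerivAt P (fderiv ℝ P x) x := fun x hx =>
    ((hP x hx).differentiableAt (by norm_num)).hasFDerivAt
  have hQd : ∀ x ∈ Metric.closedBall (0:ℂ) 1, HasFDerivAt Q (fderiv ℝ Q x) x := fun x hx =>
    ((hQ x hx).differentiableAt (by norm_num)).hasFDerivAt
  have hcos : ∀ q : ℝ × ℝ, HasFDerivAt (fun q : ℝ × ℝ => cos q.2)
      ((-sin q.2) • (ContinuousLinearMap.snd ℝ ℝ ℝ)) q := fun q =>
    (hasFDerivAt_snd (𝕜 := ℝ) (p := q)).cos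
  have hsin : ∀ q : ℝ × ℝ, HasFDerivAt (fun q : ℝ × ℝ => sin q.2)
      ((cos q.2) • (ContinuousLinearMap.snd ℝ ℝ ℝ)) q := fun q =>
    (hasFDerivAt_snd (𝕜 := ℝ) (p := q)).sin
  have hPm : ∀ q, m q ∈ Metric.closedBall (0:ℂ) 1 → HasFDerivAt (fun q => P (m q))
      ((fderiv ℝ P (m q)).comp (m' q)) q := fun q hq => (hPd _ hq).comp q (hmd q)
  have hQm : ∀ q, m q ∈ Metric.closedBall (0:ℂ) 1 → HasFDerivAt (fun q => Q (m q))
      ((fderiv ℝ Q (m q)).comp (m' q)) q := fun q hq => (hQd _ hq).comp q (hmd q)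
  let f : ℝ × ℝ → ℝ := fun q => q.1 * (cos q.2 * P (m q) + sin q.2 * Q (m q))
  let g : ℝ × ℝ → ℝ := fun q => -sin q.2 * P (m q) + cos q.2 * Q (m q)
  let f' : ℝ × ℝ → ℝ × ℝ →L[ℝ] ℝ := fun q =>
    (q.1 • ((cos q.2) • ((fderiv ℝ P (m q)).comp (m' q)) + P (m q) • ((-sin q.2) •
        (ContinuousLinearMap.snd ℝ ℝ ℝ)) + ((sin q.2) • ((fderiv ℝ Q (m q)).comp (m' q)) + Q (m q) •
        ((cos q.2) • (ContinuousLinearMap.snd ℝ ℝ ℝ)))) +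
        (cos q.2 * P (m q) + sin q.2 * Q (m q)) • ContinuousLinearMap.fst ℝ ℝ ℝ)
  let g' : ℝ × ℝ → ℝ × ℝ →L[ℝ] ℝ := fun q =>
    ((-sin q.2) • ((fderiv ℝ P (m q)).comp (m' q)) + P (m q) • (-((cos q.2) •
        (ContinuousLinearMap.snd ℝ ℝ ℝ))) + ((cos q.2) • ((fderiv ℝ Q (m q)).comp (m' q)) + Q (m q) •
        ((-sin q.2) • (ContinuousLinearMap.snd ℝ ℝ ℝ))))
  have hfd : ∀ q, m q ∈ Metric.closedBall (0:ℂ) 1 → HasFDerivAt f (f' q) q := fun q hq =>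
    (hasFDerivAt_fst (𝕜 := ℝ) (p := q)).mul
      (((hcos q).mul (hPm q hq)).add ((hsin q).mul (hQm q hq)))
  have hgd : ∀ q, m q ∈ Metric.closedBall (0:ℂ) 1 → HasFDerivAt g (g' q) q := fun q hq =>
      (((hsin q).neg.mul (hPm q hq)).add ((hcos q).mul (hQm q hq)))
  have hle : ((0:ℝ), -π) ≤ ((1:ℝ), π) := ⟨by norm_num, by simp; linarith [pi_pos]⟩
  have hIoo : ∀ q ∈ Set.Ioo (0:ℝ) 1 ×ˢ Set.Ioo (-π) π, m q ∈ Metric.closedBall (0:ℂ) 1 :=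
    fun q hq => hmem q ⟨⟨hq.1.1.le, hq.2.1.le⟩, ⟨hq.1.2.le, hq.2.2.le⟩⟩
  have hlin : ∀ (T : ℂ →L[ℝ] ℝ) (z : ℂ), T z = z.re * T 1 + z.im * T I := by
    intro T z
    conv_lhs => rw [← Complex.re_add_im z]
    have : (z.re : ℂ) + z.im * I = z.re • (1:ℂ) + z.im • I := by simp
    rw [this, map_add, map_smul, map_smul]; simp
  have hE : ∀ (q : ℝ × ℝ), f' q (1, 0) + g' q (0, 1) =
      q.1 • ((fderiv ℝ P (m q)) 1 + (fderiv ℝ Q (m q)) I) := by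
    intro q
    generalize hS : fderiv ℝ P (m q) = S
    generalize hT : fderiv ℝ Q (m q) = T
    simp only [f', g', hS, hT]
    have e1 : m' q (1, 0) = bpt q.2 := by simp [m']
    have e2 : m' q (0, 1) = q.1 * (I * bpt q.2) := by simp [m']
    simp only [add_apply, smul_apply,
      ContinuousLinearMap.comp_apply, e1, e2, ContinuousLinearMap.coe_snd',
      ContinuousLinearMap.coe_fst', smul_eq_mul, neg_apply]
    rw [hlin S (bpt q.2), hlin T (bpt q.2), hlin S (q.1 * _), hlin T (q.1 * _)]
    simp only [bpt_re, bpt_im, mul_re, mul_im, Complex.I_re, Complex.I_im,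
      Complex.ofReal_re, Complex.ofReal_im]
    have := sin_sq_add_cos_sq q.2
    linear_combination (q.1 * (S 1 + T I)) * this
  have key := integral_divergence_prod_Icc_of_hasFDerivAt_of_le f g f' g' (0, -π) (1, π) hle
    (fun q hq => (hfd q (hmem q hq)).continuousAt.continuousWithinAt)
    (fun q hq => (hgd q (hmem q hq)).continuousAt.continuousWithinAt)
    (fun q hq => hfd q (hIoo q hq)) (fun q hq => hgd q (hIoo q hq)) (by
      simp only [hE]
      apply ContinuousOn.integrableOn_compact isCompact_Icc
      intro q hq
      apply ContinuousAt.continuousWithinAt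
      have hPc : ContinuousAt (fun x => fderiv ℝ P x) (m q) :=
        ((hP _ (hmem q hq)).fderiv_right (m := 0) (by norm_num)).continuousAt
      have hQc : ContinuousAt (fun x => fderiv ℝ Q x) (m q) :=
        ((hQ _ (hmem q hq)).fderiv_right (m := 0) (by norm_num)).continuousAt
      have hPc' : ContinuousAt (fun q => fderiv ℝ P (m q)) q :=
        ContinuousAt.comp (f := m) hPc hmc.continuousAt
      have hQc' : ContinuousAt (fun q => fderiv ℝ Q (m q)) q :=
        ContinuousAt.comp (f := m) hQc hmc.continuousAt
      exact continuousAt_fst.smul ((hPc'.clm_apply continuousAt_const).add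
        (hQc'.clm_apply continuousAt_const)))
  simp only [hE] at key
  have hl : ∫ q in Set.Icc ((0:ℝ), -π) (1, π), q.1 • (pd P 1 (q.1 * bpt q.2) +
      pd Q I (q.1 * bpt q.2)) = ∫ q in Set.Icc ((0:ℝ), -π) (1, π),
      q.1 • ((fderiv ℝ P (m q)) 1 + (fderiv ℝ Q (m q)) I) := rfl
  rw [hl, key]
  have hpp : bpt π = bpt (-π) := by rw [← bpt_add_two_pi (-π)]; congr 1; ring
  have e3 : ∀ x : ℝ, g (x, π) = g (x, -π) := by
    intro x; simp [g, m, hpp]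
  simp only [e3, sub_self, zero_add]
  have e4 : ∀ y : ℝ, f (0, y) = 0 := by intro y; simp [f]
  simp only [e4, intervalIntegral.integral_zero, sub_zero]
  rw [← bint_shift]
  congr 1
  ext y
  simp [f, m, bpt_re, bpt_im]
abbrev cD : Set ℂ := Metric.closedBall (0:ℂ) 1
abbrev oD : Set ℂ := Metric.ball (0:ℂ) 1
def S1 (w : ℂ → ℝ) : Prop := ∀ x ∈ cD, ContDiffAt ℝ 1 w x
def S2 (w : ℂ → ℝ) : Prop := ∀ x ∈ cD, ContDiffAt ℝ 2 w x
lemma oD_sub : oD ⊆ cD := Metric.ball_subset_closedBall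
lemma S2.s1 (h : S2 w) : S1 w := fun x hx => (h x hx).of_le (by norm_num)
lemma S2.pd (h : S2 w) (v : ℂ) : S1 (fun x => pd w v x) := fun x hx => by
  have := (h x hx).fderiv_right (m := 1) (by norm_num)
  exact this.clm_apply contDiffAt_const
lemma S1.cont (h : S1 w) : ContinuousOn w cD := fun x hx =>
  (h x hx).continuousAt.continuousWithinAt
lemma S1.diff (h : S1 w) (hx : x ∈ cD) : DifferentiableAt ℝ w x :=
  (h x hx).differentiableAt (by norm_num)
lemma S1.pd_cont (h : S1 w) (v : ℂ) : ContinuousOn (fun x => pd w v x) cD :=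
  fun x hx => by
  have := (h x hx).fderiv_right (m := 0) (by norm_num)
  exact (this.clm_apply (contDiffAt_const (c := v))).continuousAt.continuousWithinAt
lemma S1.mul (hf : S1 f) (hg : S1 g) : S1 (fun x => f x * g x) :=
  fun x hx => (hf x hx).mul (hg x hx)
lemma S1.add (hf : S1 f) (hg : S1 g) : S1 (fun x => f x + g x) :=
  fun x hx => (hf x hx).add (hg x hx)
lemma S1.sub (hf : S1 f) (hg : S1 g) : S1 (fun x => f x - g x) :=
  fun x hx => (hf x hx).sub (hg x hx)
lemma S2.sub (hf : S2 f) (hg : S2 g) : S2 (fun x => f x - g x) :=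
  fun x hx => (hf x hx).sub (hg x hx)
lemma pd_eq (w : ℂ → ℝ) (z x : ℂ) :
    pd w z x = z.re * pd w 1 x + z.im * pd w I x := by
  unfold pd
  conv_lhs => rw [← Complex.re_add_im z]
  have : (z.re : ℂ) + z.im * I = z.re • (1:ℂ) + z.im • I := by simp
  rw [this, map_add, map_smul, map_smul]; simp
lemma nderiv_eq (w : ℂ → ℝ) (x : ℂ) : nderiv w x = pd w x x := by rw [pd_eq]; rfl
lemma tderiv_eq (w : ℂ → ℝ) (x : ℂ) : tderiv w x = pd w (I * x) x := by
  rw [pd_eq]; simp [tderiv]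
lemma pd_mul (hf : DifferentiableAt ℝ f x) (hg : DifferentiableAt ℝ g x)
    (v : ℂ) : pd (fun y => f y * g y) v x = f x * pd g v x + g x * pd f v x := by
  unfold pd
  have e : fderiv ℝ (fun y => f y * g y) x = _ := (hf.hasFDerivAt.mul hg.hasFDerivAt).fderiv
  rw [e]; simp
lemma pd_add (hf : DifferentiableAt ℝ f x) (hg : DifferentiableAt ℝ g x)
    (v : ℂ) : pd (fun y => f y + g y) v x = pd f v x + pd g v x := by
  unfold pd
  have e : fderiv ℝ (fun y => f y + g y) x = _ := (hf.hasFDerivAt.add hg.hasFDerivAt).fderiv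
  rw [e]; simp
lemma pd_sub (hf : DifferentiableAt ℝ f x) (hg : DifferentiableAt ℝ g x)
    (v : ℂ) : pd (fun y => f y - g y) v x = pd f v x - pd g v x := by
  unfold pd
  have e : fderiv ℝ (fun y => f y - g y) x = _ := (hf.hasFDerivAt.sub hg.hasFDerivAt).fderiv
  rw [e]; simp
lemma pd_cmul (c : ℝ) (hf : DifferentiableAt ℝ f x)
    (v : ℂ) : pd (fun y => c * f y) v x = c * pd f v x := by
  unfold pd
  rw [(hf.hasFDerivAt.const_mul c).fderiv]; simp
lemma pd_comp {g : ℝ → ℝ} {g' : ℝ} (hg : HasDerivAt g g' (f x))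
    (hf : DifferentiableAt ℝ f x) (v : ℂ) : pd (fun y => g (f y)) v x = g' * pd f v x := by
  unfold pd
  have := hg.comp_hasFDerivAt x hf.hasFDerivAt
  have h2 : fderiv ℝ (fun y => g (f y)) x = g' • fderiv ℝ f x := this.fderiv
  rw [h2]; simp
lemma pd_congr (h : f =ᶠ[nhds x] g) (v : ℂ) : pd f v x = pd g v x := by
  unfold pd; rw [h.fderiv_eq]
lemma S2.lap_cont (h : S2 w) : ContinuousOn (lap w) cD :=
  ((h.pd 1).pd_cont 1).add ((h.pd I).pd_cont I)
lemma S1.gradSq_cont (h : S1 w) : ContinuousOn (gradSq w) cD :=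
  ((h.pd_cont 1).pow 2).add ((h.pd_cont I).pow 2)
lemma S1.pdF_cont (h : S1 w) {F : ℂ → ℂ} (hF : ContinuousOn F cD) :
    ContinuousOn (fun x => _root_.pd w (F x) x) cD := by
  have : (fun x => _root_.pd w (F x) x) =
      fun x => (F x).re * _root_.pd w 1 x + (F x).im * _root_.pd w I x := by
    ext x; exact pd_eq _ _ _
  rw [this]
  exact ((continuous_re.comp_continuousOn hF).mul (h.pd_cont 1)).add
    ((continuous_im.comp_continuousOn hF).mul (h.pd_cont _))
lemma S1.nderiv_cont (h : S1 w) : ContinuousOn (nderiv w) cD := by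
  have := h.pdF_cont (F := fun x => x) continuousOn_id
  exact this.congr fun x _ => nderiv_eq w x
lemma S1.tderiv_cont (h : S1 w) : ContinuousOn (tderiv w) cD := by
  have := h.pdF_cont (F := fun x => I * x) (by fun_prop)
  exact this.congr fun x _ => tderiv_eq w x
lemma intD (h : ContinuousOn f cD) : IntegrableOn f oD :=
  (h.integrableOn_compact (isCompact_closedBall _ _)).mono_set oD_sub
lemma cont_b (h : ContinuousOn f cD) : Continuous (fun θ => f (bpt θ)) :=
  h.comp_continuous bpt_cont bpt_mem
lemma intB (h : ContinuousOn f cD) (a b : ℝ) :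
    IntervalIntegrable (fun θ => f (bpt θ)) volume a b := (cont_b h).intervalIntegrable _ _
lemma pd_symm (h : S2 w) (hx : x ∈ cD) :
    pd (fun y => pd w 1 y) I x = pd (fun y => pd w I y) 1 x := by
  have hs : IsSymmSndFDerivAt ℝ w x := (h x hx).isSymmSndFDerivAt (by simp)
  have hd : DifferentiableAt ℝ (fderiv ℝ w) x :=
    ((h x hx).fderiv_right (m := 1) (by norm_num)).differentiableAt (by norm_num)
  have e : ∀ u v : ℂ, pd (fun y => pd w u y) v x = fderiv ℝ (fderiv ℝ w) x v u := by
    intro u v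
    unfold pd
    have := hd.hasFDerivAt.clm_apply (hasFDerivAt_const u x)
    rw [this.fderiv]; simp
  rw [e, e]; exact hs.eq _ _
lemma greenA {φ w : ℂ → ℝ} (hφ : S1 φ) (hw : S2 w) :
    ∫ x in oD, (φ x * lap w x + (pd φ 1 x * pd w 1 x + pd φ I x * pd w I x)) =
      bint (fun x => φ x * nderiv w x) := by
  have h := div_thm (fun x => φ x * pd w 1 x) (fun x => φ x * pd w I x)
    (hφ.mul (hw.pd 1)) (hφ.mul (hw.pd _))
  have e2 : (fun x : ℂ => x.re * (φ x * pd w 1 x) + x.im * (φ x * pd w I x)) =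
      fun x => φ x * nderiv w x := by
    ext x; unfold nderiv; ring
  rw [e2] at h
  rw [← h]
  refine setIntegral_congr_fun Metric.isOpen_ball.measurableSet fun x hx => ?_
  have hx := oD_sub hx
  rw [pd_mul (hφ.diff hx) ((hw.pd 1).diff hx), pd_mul (hφ.diff hx) ((hw.pd _).diff hx)]
  unfold lap pd; ring
structure VF (F F' : ℂ → ℂ) : Prop where
  der : ∀ x, HasDerivAt F (F' x) x
  sm : ContDiff ℝ 1 F
lemma VF.cont {F F' : ℂ → ℂ} (h : VF F F') : Continuous F := h.sm.continuous
lemma VF.re_pd {F F' : ℂ → ℂ} (h : VF F F') (x v : ℂ) :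
    pd (fun y => (F y).re) v x = (F' x * v).re := by
  have h1 : HasFDerivAt F _ x := (h.der x).complexToReal_fderiv
  have h2 := (reCLM.hasFDerivAt (x := F x)).comp x h1
  have h3 : fderiv ℝ (fun y => (F y).re) x = _ := h2.fderiv
  unfold pd; rw [h3]; simp
lemma VF.im_pd {F F' : ℂ → ℂ} (h : VF F F') (x v : ℂ) :
    pd (fun y => (F y).im) v x = (F' x * v).im := by
  have h1 : HasFDerivAt F _ x := (h.der x).complexToReal_fderiv
  have h2 := (imCLM.hasFDerivAt (x := F x)).comp x h1
  have h3 : fderiv ℝ (fun y => (F y).im) x = _ := h2.fderiv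
  unfold pd; rw [h3]; simp
lemma VF.re_S {F F' : ℂ → ℂ} (h : VF F F') : S1 (fun y => (F y).re) := fun _ _ =>
  (reCLM.contDiff.comp h.sm).contDiffAt
lemma VF.im_S {F F' : ℂ → ℂ} (h : VF F F') : S1 (fun y => (F y).im) := fun _ _ =>
  (imCLM.contDiff.comp h.sm).contDiffAt
def al (F : ℂ → ℂ) (x : ℂ) : ℝ := (F x).re * x.re + (F x).im * x.im
def be (F : ℂ → ℂ) (x : ℂ) : ℝ := (F x).im * x.re - (F x).re * x.im
lemma greenC {φ : ℂ → ℝ} (hφ : S1 φ) {F F' : ℂ → ℂ} (hF : VF F F') :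
    ∫ x in oD, (pd φ (F x) x + φ x * (2 * (F' x).re)) = bint (fun x => φ x * al F x) := by
  have h := div_thm (fun x => φ x * (F x).re) (fun x => φ x * (F x).im)
    (hφ.mul hF.re_S) (hφ.mul hF.im_S)
  have e2 : (fun x : ℂ => x.re * (φ x * (F x).re) + x.im * (φ x * (F x).im)) =
      fun x => φ x * al F x := by
    ext x; unfold al; ring
  rw [e2] at h
  rw [← h]
  refine setIntegral_congr_fun Metric.isOpen_ball.measurableSet fun x hx => ?_
  have hx := oD_sub hx
  rw [pd_mul (hφ.diff hx) (hF.re_S.diff hx), pd_mul (hφ.diff hx) (hF.im_S.diff hx),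
    hF.re_pd, hF.im_pd, pd_eq φ]
  simp; ring
lemma greenB (hw : S2 w) {F F' : ℂ → ℂ} (hF : VF F F') :
    ∫ x in oD, lap w x * pd w (F x) x = bint (fun x =>
      1/2 * al F x * (nderiv w x ^ 2 - tderiv w x ^ 2) + be F x * nderiv w x * tderiv w x) := by
  have w1 := hw.pd 1
  have w2 := hw.pd I
  have hE : S1 (fun x => (F x).re * pd w 1 x + (F x).im * pd w I x) :=
    (hF.re_S.mul w1).add (hF.im_S.mul w2)
  have hc : S1 (fun _ : ℂ => (1/2 : ℝ)) := fun x _ => contDiffAt_const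
  have hG : S1 (fun x => (1/2:ℝ) * (pd w 1 x * pd w 1 x + pd w I x * pd w I x)) :=
    hc.mul ((w1.mul w1).add (w2.mul w2))
  have h := div_thm
    (fun x => ((F x).re * pd w 1 x + (F x).im * pd w I x) * pd w 1 x -
      ((1/2:ℝ) * (pd w 1 x * pd w 1 x + pd w I x * pd w I x)) * (F x).re)
    (fun x => ((F x).re * pd w 1 x + (F x).im * pd w I x) * pd w I x -
      ((1/2:ℝ) * (pd w 1 x * pd w 1 x + pd w I x * pd w I x)) * (F x).im)
    ((hE.mul w1).sub (hG.mul hF.re_S)) ((hE.mul w2).sub (hG.mul hF.im_S))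
  trans; trans; swap; exact h
  · refine setIntegral_congr_fun Metric.isOpen_ball.measurableSet fun x hx => ?_
    have hx := oD_sub hx
    have d1 := w1.diff hx
    have d2 := w2.diff hx
    have dr := hF.re_S.diff hx
    have di := hF.im_S.diff hx
    have dE := hE.diff hx
    have dG := hG.diff hx
    have dG0 := ((w1.mul w1).add (w2.mul w2)).diff hx
    have dG1 := (w1.mul w1).diff hx
    have dG2 := (w2.mul w2).diff hx
    have m1 := (hF.re_S.mul w1).diff hx
    have m2 := (hF.im_S.mul w2).diff hx
    rw [pd_sub ((hE.mul w1).diff hx) ((hG.mul hF.re_S).diff hx),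
      pd_sub ((hE.mul w2).diff hx) ((hG.mul hF.im_S).diff hx),
      pd_mul dE d1, pd_mul dG dr, pd_mul dE d2, pd_mul dG di,
      pd_add m1 m2, pd_add m1 m2, pd_mul dr d1, pd_mul di d2, pd_mul dr d1, pd_mul di d2,
      pd_cmul _ dG0, pd_cmul _ dG0, pd_add dG1 dG2, pd_add dG1 dG2, pd_mul d1 d1, pd_mul d2 d2,
      pd_mul d1 d1, pd_mul d2 d2, hF.re_pd, hF.im_pd, hF.re_pd, hF.im_pd, pd_eq w (F x),
      pd_symm hw hx]
    have hl : lap w x = pd (fun y => pd w 1 y) 1 x + pd (fun y => pd w I y) I x :=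
      rfl
    rw [hl]
    simp
    ring
  · unfold bint
    congr 1
    ext θ
    have h1 : (bpt θ).re ^ 2 + (bpt θ).im ^ 2 = 1 := by
      rw [bpt_re, bpt_im]; exact cos_sq_add_sin_sq θ
    generalize bpt θ = x at h1
    unfold nderiv tderiv al be
    generalize pd w 1 x = a
    generalize pd w I x = b
    generalize (F x).re = c
    generalize (F x).im = d
    obtain ⟨x, y⟩ := x
    simp only at h1 ⊢
    have hy : y ^ 2 = 1 - x ^ 2 := by linarith
    grind
lemma greenD {φ w : ℂ → ℝ} (hφ : S2 φ) (hw : S2 w) :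
    ∫ x in oD, (φ x * lap w x - w x * lap φ x) =
      bint (fun x => φ x * nderiv w x - w x * nderiv φ x) := by
  have h1 := greenA hφ.s1 hw
  have h2 := greenA hw.s1 hφ
  have hc1 : ContinuousOn (fun x => φ x * lap w x +
      (pd φ 1 x * pd w 1 x + pd φ I x * pd w I x)) cD :=
    (hφ.s1.cont.mul hw.lap_cont).add (((hφ.s1.pd_cont 1).mul (hw.s1.pd_cont 1)).add
      ((hφ.s1.pd_cont _).mul (hw.s1.pd_cont _)))
  have hc2 : ContinuousOn (fun x => w x * lap φ x +
      (pd w 1 x * pd φ 1 x + pd w I x * pd φ I x)) cD :=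
    (hw.s1.cont.mul hφ.lap_cont).add (((hw.s1.pd_cont 1).mul (hφ.s1.pd_cont 1)).add
      ((hw.s1.pd_cont _).mul (hφ.s1.pd_cont _)))
  have h3 : ∫ x in oD, (φ x * lap w x - w x * lap φ x) = (∫ x in oD, (φ x * lap w x +
      (pd φ 1 x * pd w 1 x + pd φ I x * pd w I x))) - ∫ x in oD, (w x * lap φ x +
      (pd w 1 x * pd φ 1 x + pd w I x * pd φ I x)) := by
    rw [← integral_sub (intD hc1) (intD hc2)]
    congr 1; ext x; ring
  rw [h3, h1, h2]
  unfold bint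
  rw [← intervalIntegral.integral_sub]
  · exact intB (f := fun x => φ x * nderiv w x) (hφ.s1.cont.mul hw.s1.nderiv_cont) _ _
  · exact intB (f := fun x => w x * nderiv φ x) (hw.s1.cont.mul hφ.s1.nderiv_cont) _ _
lemma dmono (hf : ContinuousOn f cD) (hg : ContinuousOn g cD)
    (h : ∀ x ∈ oD, f x ≤ g x) : ∫ x in oD, f x ≤ ∫ x in oD, g x :=
  setIntegral_mono_on (intD hf) (intD hg) Metric.isOpen_ball.measurableSet h
lemma dabs (hf : ContinuousOn f cD) (hg : ContinuousOn g cD)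
    (h : ∀ x ∈ oD, |f x| ≤ g x) : |∫ x in oD, f x| ≤ ∫ x in oD, g x :=
  (norm_integral_le_integral_norm f).trans (dmono hf.norm hg h)
lemma two_pi_nonneg : (0:ℝ) ≤ 2 * π := by positivity
lemma bmono (hf : ContinuousOn f cD) (hg : ContinuousOn g cD)
    (h : ∀ θ, f (bpt θ) ≤ g (bpt θ)) : bint f ≤ bint g :=
  intervalIntegral.integral_mono_on two_pi_nonneg (intB hf _ _) (intB hg _ _) fun θ _ => h θ
lemma babs (hf : ContinuousOn f cD) (hg : ContinuousOn g cD)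
    (h : ∀ θ, |f (bpt θ)| ≤ g (bpt θ)) : |bint f| ≤ bint g :=
  (intervalIntegral.abs_integral_le_integral_abs two_pi_nonneg).trans (bmono hf.abs hg h)
lemma dadd (hf : ContinuousOn f cD) (hg : ContinuousOn g cD) :
    ∫ x in oD, (f x + g x) = (∫ x in oD, f x) + ∫ x in oD, g x :=
  integral_add (intD hf) (intD hg)
lemma dsub (hf : ContinuousOn f cD) (hg : ContinuousOn g cD) :
    ∫ x in oD, (f x - g x) = (∫ x in oD, f x) - ∫ x in oD, g x :=
  integral_sub (intD hf) (intD hg)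
lemma dmul (c : ℝ) (f : ℂ → ℝ) : ∫ x in oD, c * f x = c * ∫ x in oD, f x :=
  integral_const_mul _ _
lemma badd (hf : ContinuousOn f cD) (hg : ContinuousOn g cD) :
    bint (fun x => f x + g x) = bint f + bint g :=
  intervalIntegral.integral_add (intB hf _ _) (intB hg _ _)
lemma bsub (hf : ContinuousOn f cD) (hg : ContinuousOn g cD) :
    bint (fun x => f x - g x) = bint f - bint g :=
  intervalIntegral.integral_sub (intB hf _ _) (intB hg _ _)
lemma bmul (c : ℝ) (f : ℂ → ℝ) : bint (fun x => c * f x) = c * bint f :=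
  intervalIntegral.integral_const_mul _ _
lemma bcongr (h : ∀ θ, f (bpt θ) = g (bpt θ)) : bint f = bint g := by
  unfold bint; congr 1; ext θ; exact h θ
lemma dcongr (h : ∀ x ∈ oD, f x = g x) : ∫ x in oD, f x = ∫ x in oD, g x :=
  setIntegral_congr_fun Metric.isOpen_ball.measurableSet h
lemma bconst (c : ℝ) : bint (fun _ => c) = 2 * π * c := by simp [bint]
lemma vf_id : VF (fun x => x) (fun _ => 1) := ⟨fun x => hasDerivAt_id x, contDiff_id⟩
lemma bpt_sq (θ : ℝ) : (bpt θ).re ^ 2 + (bpt θ).im ^ 2 = 1 := by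
  rw [bpt_re, bpt_im]; exact cos_sq_add_sin_sq θ
lemma rellich (hw : S2 w) :
    bint (fun x => tderiv w x ^ 2) = bint (fun x => nderiv w x ^ 2) -
      2 * ∫ x in oD, lap w x * pd w x x := by
  rw [greenB hw vf_id, ← bmul, ← bsub]
  · refine bcongr fun θ => ?_
    have h := bpt_sq θ
    have h1 : al (fun x => x) (bpt θ) = 1 := by unfold al; linarith
    have h2 : be (fun x => x) (bpt θ) = 0 := by unfold be; ring
    rw [h1, h2]; ring
  · exact hw.s1.nderiv_cont.pow 2
  · have h1 := hw.s1.nderiv_cont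
    have h2 := hw.s1.tderiv_cont
    have h3 : ContinuousOn (al fun x => x) cD := by unfold al; fun_prop
    have h4 : ContinuousOn (be fun x => x) cD := by unfold be; fun_prop
    fun_prop
lemma disk_sq (hx : x ∈ cD) : x.re ^ 2 + x.im ^ 2 ≤ 1 := by
  have h : ‖x‖ ≤ 1 := by simpa using hx
  have h2 : ‖x‖ ^ 2 = x.re ^ 2 + x.im ^ 2 := by
    rw [← normSq_eq_norm_sq, normSq_apply]; ring
  nlinarith [norm_nonneg x]
lemma pd_sq_le (w : ℂ → ℝ) (z x : ℂ) : pd w z x ^ 2 ≤ ‖z‖ ^ 2 * gradSq w x := by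
  have h2 : ‖z‖ ^ 2 = z.re ^ 2 + z.im ^ 2 := by
    rw [← normSq_eq_norm_sq, normSq_apply]; ring
  rw [pd_eq, h2]; unfold gradSq
  nlinarith [sq_nonneg (z.re * pd w I x - z.im * pd w 1 x)]
lemma gradSq_nonneg (w : ℂ → ℝ) (x : ℂ) : 0 ≤ gradSq w x := by unfold gradSq; positivity
lemma abs_le_amgm (p η : ℝ) (hη : 0 < η) : |p| ≤ η + p ^ 2 / (4 * η) := by
  have h : 0 ≤ (|p| - 2 * η) ^ 2 / (4 * η) := by positivity
  have e : (|p| - 2 * η) ^ 2 / (4 * η) = η + p ^ 2 / (4 * η) - |p| := by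
    rw [sub_sq, sq_abs]; field_simp; ring
  linarith
lemma pd_amgm (w : ℂ → ℝ) (z x : ℂ) (M η : ℝ) (hz : ‖z‖ ≤ M) (hη : 0 < η) :
    |pd w z x| ≤ η + M ^ 2 / (4 * η) * gradSq w x := by
  refine (abs_le_amgm _ η hη).trans ?_
  have h1 := pd_sq_le w z x
  have h2 : ‖z‖ ^ 2 * gradSq w x ≤ M ^ 2 * gradSq w x :=
    mul_le_mul_of_nonneg_right (by gcongr) (gradSq_nonneg _ _)
  have h3 : pd w z x ^ 2 / (4 * η) ≤ M ^ 2 * gradSq w x / (4 * η) := by gcongr; linarith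
  have e : M ^ 2 * gradSq w x / (4 * η) = M ^ 2 / (4 * η) * gradSq w x := by ring
  linarith
lemma bpt_deriv_comp (hw : S1 w) (θ : ℝ) :
    HasDerivAt (fun t => w (bpt t)) (tderiv w (bpt θ)) θ := by
  rw [tderiv_eq]
  exact (hw.diff (bpt_mem θ)).hasFDerivAt.comp_hasDerivAt θ (bpt_hasDeriv θ)
abbrev vD : ℝ := ∫ _ in oD, (1:ℝ)
lemma vD_nonneg : 0 ≤ vD := integral_nonneg fun _ => zero_le_one
lemma energy (hw : S2 w) {C : ℝ} (h1 : ∀ x ∈ oD, |lap w x| ≤ C)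
    (h2 : ∀ θ, |nderiv w (bpt θ)| ≤ C) (h3 : ∫ x in oD, |w x| ≤ C)
    (h4 : bint (fun x => |w x|) ≤ C) : ∫ x in oD, gradSq w x ≤ 2 * C ^ 2 := by
  have hC : 0 ≤ C := (abs_nonneg _).trans (h2 0)
  have c1 := hw.s1.cont
  have c2 := hw.lap_cont
  have c3 := hw.s1.gradSq_cont
  have c4 := hw.s1.nderiv_cont
  have hA := greenA hw.s1 hw
  have e1 : ∫ x in oD, (w x * lap w x + (pd w 1 x * pd w 1 x + pd w I x *
      pd w I x)) = (∫ x in oD, w x * lap w x) + ∫ x in oD, gradSq w x := by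
    rw [← dadd (by fun_prop) c3]
    refine dcongr fun x _ => ?_
    unfold gradSq; ring
  rw [e1] at hA
  have i1 : |∫ x in oD, w x * lap w x| ≤ ∫ x in oD, C * |w x| := by
    refine dabs (by fun_prop) (by fun_prop) fun x hx => ?_
    rw [abs_mul, mul_comm]; exact mul_le_mul_of_nonneg_right (h1 x hx) (abs_nonneg _)
  have i2 : |bint fun x => w x * nderiv w x| ≤ bint fun x => C * |w x| := by
    refine babs (by fun_prop) (by fun_prop) fun x => ?_
    rw [abs_mul, mul_comm]; exact mul_le_mul_of_nonneg_right (h2 x) (abs_nonneg _)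
  rw [dmul] at i1; rw [bmul] at i2
  have := abs_le.1 i1
  have := abs_le.1 i2
  nlinarith
lemma trace_energy (hw : S2 w) {C E : ℝ} (h1 : ∀ x ∈ oD, |lap w x| ≤ C)
    (h2 : ∀ θ, |nderiv w (bpt θ)| ≤ C) (hE : ∫ x in oD, gradSq w x ≤ E) :
    bint (fun x => tderiv w x ^ 2) ≤ 2 * π * C ^ 2 + 2 * C * (vD + E) := by
  have hC : 0 ≤ C := (abs_nonneg _).trans (h2 0)
  have c2 := hw.lap_cont
  have c3 := hw.s1.gradSq_cont
  have c4 := hw.s1.nderiv_cont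
  have c5 := hw.s1.pdF_cont (F := fun x => x) continuousOn_id
  have hE0 : 0 ≤ ∫ x in oD, gradSq w x := integral_nonneg fun x => gradSq_nonneg _ _
  rw [rellich hw]
  have i1 : |∫ x in oD, lap w x * pd w x x| ≤ ∫ x in oD, C * (1 + gradSq w x) := by
    refine dabs (by fun_prop) (by fun_prop) fun x hx => ?_
    rw [abs_mul]
    refine mul_le_mul (h1 x hx) ?_ (abs_nonneg _) hC
    have := pd_amgm w x x 1 1 (by simpa using oD_sub hx) one_pos
    have := gradSq_nonneg w x
    linarith
  rw [dmul, dadd continuousOn_const c3] at i1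
  have i2 : bint (fun x => nderiv w x ^ 2) ≤ bint (fun _ => C ^ 2) := by
    refine bmono (by fun_prop) (by fun_prop) fun θ => ?_
    have := h2 θ
    rw [← sq_abs]; gcongr
  rw [bconst] at i2
  have := abs_le.1 i1
  have : C * ((∫ _ in oD, (1:ℝ)) + ∫ x in oD, gradSq w x) ≤ C * (vD + E) := by gcongr
  linarith
lemma holder_trace (hw : S2 w) {B : ℝ}
    (hB : bint (fun x => tderiv w x ^ 2) ≤ B) {a b : ℝ} (hab : a ≤ b) (hb : b ≤ a + 2 * π) :
    |w (bpt b) - w (bpt a)| ≤ (1 + B) / 2 * √(b - a) := by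
  rcases hab.eq_or_lt with rfl | hab'
  · simp
  set l := b - a with hl
  have hl0 : 0 < l := by linarith
  have c := cont_b hw.s1.tderiv_cont
  have e1 : ∫ t in a..b, tderiv w (bpt t) = w (bpt b) - w (bpt a) :=
    intervalIntegral.integral_eq_sub_of_hasDerivAt (fun t _ => bpt_deriv_comp hw.s1 t)
      (c.intervalIntegrable _ _)
  have i1 : ∫ t in a..b, tderiv w (bpt t) ^ 2 ≤ B := by
    have hper : Function.Periodic (fun θ => tderiv w (bpt θ) ^ 2) (2 * π) := fun θ => by
      simp [bpt_add_two_pi]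
    have h2 := hper.intervalIntegral_add_eq a 0
    rw [zero_add] at h2
    refine le_trans ?_ (h2.le.trans hB)
    exact intervalIntegral.integral_mono_interval le_rfl hab hb
      (Eventually.of_forall fun t => sq_nonneg _) ((c.pow 2).intervalIntegrable _ _)
  have hs : 0 < √l := sqrt_pos.2 hl0
  have hss : √l * √l = l := Real.mul_self_sqrt hl0.le
  rw [← e1]
  calc |∫ t in a..b, tderiv w (bpt t)| ≤ ∫ t in a..b, |tderiv w (bpt t)| :=
        intervalIntegral.abs_integral_le_integral_abs hab
    _ ≤ ∫ t in a..b, (1 / (2 * √l) + (√l / 2) * tderiv w (bpt t) ^ 2) := by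
        refine intervalIntegral.integral_mono_on hab (c.abs.intervalIntegrable _ _)
          (Continuous.intervalIntegrable (by fun_prop) _ _) fun t _ => ?_
        refine (abs_le_amgm _ (1 / (2 * √l)) (by positivity)).trans (le_of_eq ?_)
        field_simp; ring
    _ = 1 / (2 * √l) * l + √l / 2 * ∫ t in a..b, tderiv w (bpt t) ^ 2 := by
        rw [intervalIntegral.integral_add (Continuous.intervalIntegrable (by fun_prop) _ _)
          (Continuous.intervalIntegrable (by fun_prop) _ _),
          intervalIntegral.integral_const_mul, intervalIntegral.integral_const]
        simp [hl, mul_comm]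
    _ ≤ 1 / (2 * √l) * l + √l / 2 * B := by gcongr
    _ = (1 + B) / 2 * √l := by
        have : 1 / (2 * √l) * l = √l / 2 := by
          rw [div_mul_eq_mul_div, div_eq_div_iff (by positivity) two_ne_zero]
          linear_combination (-2) * hss
        rw [this]; ring
lemma sup_trace (hw : S2 w) {B C : ℝ}
    (hB : bint (fun x => tderiv w x ^ 2) ≤ B) (h4 : bint (fun x => |w x|) ≤ C) (θ : ℝ) :
    |w (bpt θ)| ≤ C + (1 + B) / 2 * √(2 * π) := by
  have hB0 : 0 ≤ B := le_trans (intervalIntegral.integral_nonneg two_pi_nonneg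
    fun t _ => sq_nonneg _) hB
  have c := cont_b hw.s1.cont
  have hper : Function.Periodic (fun θ => |w (bpt θ)|) (2 * π) := fun θ => by
      simp [bpt_add_two_pi]
  have h2 := hper.intervalIntegral_add_eq θ 0
  rw [zero_add] at h2
  have h3 : ∫ t in θ..(θ + 2 * π), (|w (bpt θ)| - (1 + B) / 2 * √(2 * π)) ≤
      ∫ t in θ..(θ + 2 * π), |w (bpt t)| := by
    refine intervalIntegral.integral_mono_on (by linarith [two_pi_nonneg])
      (Continuous.intervalIntegrable (by fun_prop) _ _) (c.abs.intervalIntegrable _ _)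
      fun t ht => ?_
    have h5 := holder_trace hw hB ht.1 ht.2
    have h6 : √(t - θ) ≤ √(2 * π) := sqrt_le_sqrt (by linarith [ht.2])
    have h7 : (1 + B) / 2 * √(t - θ) ≤ (1 + B) / 2 * √(2 * π) := by gcongr
    have h8 := abs_sub_abs_le_abs_sub (w (bpt θ)) (w (bpt t))
    rw [abs_sub_comm] at h8
    linarith
  rw [h2, intervalIntegral.integral_const] at h3
  have h4' : ∫ x in 0..2 * π, |w (bpt x)| ≤ C := h4
  simp only [add_sub_cancel_left, smul_eq_mul] at h3
  have hC : 0 ≤ C := le_trans (intervalIntegral.integral_nonneg two_pi_nonneg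
    fun t _ => abs_nonneg _) h4
  have hp : 1 ≤ 2 * π := by linarith [pi_gt_three]
  by_contra hcon
  push Not at hcon
  nlinarith
lemma lap_sub (hf : S2 f) (hg : S2 g) (hx : x ∈ oD) :
    lap (fun y => f y - g y) x = lap f x - lap g x := by
  have e : ∀ v : ℂ, (fun y => pd (fun y => f y - g y) v y) =ᶠ[nhds x]
      fun y => pd f v y - pd g v y := fun v => by
    filter_upwards [Metric.isOpen_ball.mem_nhds hx] with y hy
    exact pd_sub (hf.s1.diff (oD_sub hy)) (hg.s1.diff (oD_sub hy)) v
  have e1 := pd_congr (e 1) 1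
  have e2 := pd_congr (e I) I
  have hx' := oD_sub hx
  rw [pd_sub ((hf.pd 1).diff hx') ((hg.pd 1).diff hx')] at e1
  rw [pd_sub ((hf.pd _).diff hx') ((hg.pd _).diff hx')] at e2
  unfold lap
  unfold pd at *
  rw [e1, e2]; ring
lemma nderiv_sub (hf : S1 f) (hg : S1 g) (hx : x ∈ cD) :
    nderiv (fun y => f y - g y) x = nderiv f x - nderiv g x := by
  simp only [nderiv_eq]; exact pd_sub (hf.diff hx) (hg.diff hx) _
lemma tderiv_sub (hf : S1 f) (hg : S1 g) (hx : x ∈ cD) :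
    tderiv (fun y => f y - g y) x = tderiv f x - tderiv g x := by
  simp only [tderiv_eq]; exact pd_sub (hf.diff hx) (hg.diff hx) _
lemma exp_lip {a b C : ℝ} (ha : a ≤ C) (hb : b ≤ C) :
    |exp a - exp b| ≤ exp C * |a - b| := by
  wlog h : b ≤ a generalizing a b
  · rw [abs_sub_comm, abs_sub_comm a]; exact this hb ha (by linarith)
  rw [abs_of_nonneg (by linarith [exp_le_exp.2 h]), abs_of_nonneg (by linarith)]
  have h1 := add_one_le_exp (b - a)
  have h2 : exp b = exp a * exp (b - a) := by rw [← exp_add]; ring_nf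
  have h3 := exp_le_exp.2 ha
  have h4 := exp_pos a
  rw [h2]
  have : exp a * (a - b) ≤ exp C * (a - b) :=
    mul_le_mul_of_nonneg_right h3 (by linarith)
  nlinarith
lemma exp_mono2 {a b C : ℝ} (ha : -C ≤ a) (hb : -C ≤ b) :
    exp (-C) * (a - b) ^ 2 ≤ (a - b) * (exp a - exp b) := by
  wlog h : b ≤ a generalizing a b
  · have := this hb ha (by linarith); nlinarith
  have h1 := add_one_le_exp (a - b)
  have h2 : exp a = exp b * exp (a - b) := by rw [← exp_add]; ring_nf
  have h3 := exp_le_exp.2 hb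
  have h4 : exp (-C) * (a - b) ≤ exp a - exp b := by
    have : exp (-C) * (a - b) ≤ exp b * (a - b) :=
      mul_le_mul_of_nonneg_right h3 (by linarith)
    have := exp_pos b
    nlinarith
  nlinarith
def dE (k : ℝ) (w : ℂ → ℝ) (x : ℂ) : ℝ := lap w x + 2 * k * exp (w x)
def dN (h : ℝ) (w : ℂ → ℝ) (x : ℂ) : ℝ := nderiv w x - 2 * h * exp (w x / 2) + 2
lemma S2.dE_cont (hw : S2 w) (k : ℝ) : ContinuousOn (dE k w) cD := by
  have := hw.s1.cont
  have := hw.lap_cont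
  unfold dE; fun_prop
lemma S2.dN_cont (hw : S2 w) (h : ℝ) : ContinuousOn (dN h w) cD := by
  have := hw.s1.cont
  have := hw.s1.nderiv_cont
  unfold dN; fun_prop
structure BF (C : ℝ) (w : ℂ → ℝ) : Prop where
  sm : S2 w
  bd : ∀ x ∈ cD, |w x| ≤ C
  lp : ∀ x ∈ oD, |lap w x| ≤ C
  nd : ∀ θ, |nderiv w (bpt θ)| ≤ C
lemma BF.nonneg {C : ℝ} (h : BF C w) : 0 ≤ C := (abs_nonneg _).trans (h.nd 0)
lemma comp1 {C k : ℝ} (hk : k ≤ 0) {w z : ℂ → ℝ} (hw : BF C w) (hz : BF C z) :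
    (∫ x in oD, gradSq (fun y => w y - z y) x) +
      2 * (-k) * exp (-C) * ∫ x in oD, (w x - z x) ^ 2 ≤
    2 * C * ((∫ x in oD, |dE k w x|) + ∫ x in oD, |dE k z x|) +
      2 * C * bint (fun x => |w x - z x|) := by
  have hd := hw.sm.sub hz.sm
  have c1 := hd.s1.cont
  have c2 := hd.lap_cont
  have c3 := hd.s1.gradSq_cont
  have c4 := hd.s1.nderiv_cont
  have c5 := hw.sm.dE_cont k
  have c6 := hz.sm.dE_cont k
  have hA := greenA hd.s1 hd
  set d : ℂ → ℝ := fun y => w y - z y with hdd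
  have e1 : ∫ x in oD, (d x * lap d x + (pd d 1 x * pd d 1 x + pd d I x *
      pd d I x)) = ∫ x in oD, (d x * lap d x + gradSq d x) := by
    refine dcongr fun x _ => ?_
    unfold gradSq; ring
  rw [e1] at hA
  have i2 : (bint fun x => d x * nderiv d x) ≤ bint fun x => 2 * C * |d x| := by
    refine bmono (by fun_prop) (by fun_prop) fun x => ?_
    refine (le_abs_self _).trans ?_
    rw [abs_mul, mul_comm]; refine mul_le_mul_of_nonneg_right ?_ (abs_nonneg _)
    rw [hdd, nderiv_sub hw.sm.s1 hz.sm.s1 (bpt_mem x)]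
    have := hw.nd x
    have := hz.nd x
    have := abs_sub (nderiv w (bpt x)) (nderiv z (bpt x))
    linarith
  rw [bmul] at i2
  have i1 : ∫ x in oD, (gradSq d x + 2 * (-k) * exp (-C) * d x ^ 2
      - 2 * C * (|dE k w x| + |dE k z x|)) ≤ ∫ x in oD, (d x * lap d x + gradSq d x) := by
    refine dmono (by fun_prop) (by fun_prop) fun x hx => ?_
    have hx' := oD_sub hx
    have b1 := hw.bd x hx'
    have b2 := hz.bd x hx'
    have m := exp_mono2 (abs_le.1 b1).1 (abs_le.1 b2).1
    have e : lap d x = dE k w x - dE k z x + 2 * (-k) * (exp (w x) - exp (z x)) := by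
      rw [hdd, lap_sub hw.sm hz.sm hx]; unfold dE; ring
    have hdx : d x = w x - z x := rfl
    rw [← hdx] at m
    have b3 : |d x| ≤ 2 * C := by
      rw [hdx]; have := abs_sub (w x) (z x); linarith
    have b4 : -(2 * C * (|dE k w x| + |dE k z x|)) ≤ d x * (dE k w x - dE k z x) := by
      have : |d x * (dE k w x - dE k z x)| ≤ 2 * C * (|dE k w x| + |dE k z x|) := by
        rw [abs_mul]
        exact mul_le_mul b3 (abs_sub _ _) (abs_nonneg _) ((abs_nonneg _).trans b3)
      exact (abs_le.1 this).1
    rw [e]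
    have : 0 ≤ 2 * (-k) := by linarith
    nlinarith [mul_le_mul_of_nonneg_left m this]
  rw [dsub (by fun_prop) (by fun_prop), dadd (by fun_prop) (by fun_prop), dmul, dmul,
    dadd (by fun_prop) (by fun_prop)] at i1
  linarith
lemma comp2 {C h : ℝ} {w z : ℂ → ℝ} (hw : BF C w) (hz : BF C z) {η : ℝ} (hη : 0 < η) :
    bint (fun x => tderiv (fun y => w y - z y) x ^ 2) ≤
      2 * C * (|h| * exp (C / 2) * bint (fun x => |w x - z x|) +
        (bint (fun x => |dN h w x|) + bint (fun x => |dN h z x|))) +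
      4 * C * (η * vD + 1 / (4 * η) * ∫ x in oD, gradSq (fun y => w y - z y) x) := by
  have hC := hw.nonneg
  have hd := hw.sm.sub hz.sm
  have c0 := hw.sm.s1.cont
  have c0' := hz.sm.s1.cont
  have c2 := hd.lap_cont
  have c3 := hd.s1.gradSq_cont
  have c4 := hd.s1.nderiv_cont
  have c5 := hw.sm.dN_cont h
  have c6 := hz.sm.dN_cont h
  have c7 := hd.s1.pdF_cont (F := fun x => x) continuousOn_id
  rw [rellich hd]
  set d : ℂ → ℝ := fun y => w y - z y with hdd
  have c1 : ContinuousOn d cD := hd.s1.cont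
  have i1 : |∫ x in oD, lap d x * pd d x x| ≤ ∫ x in oD, 2 * C *
      (η * 1 + 1 / (4 * η) * gradSq d x) := by
    refine dabs (by fun_prop) (by fun_prop) fun x hx => ?_
    rw [abs_mul]
    refine mul_le_mul ?_ ?_ (abs_nonneg _) (by positivity)
    · rw [hdd, lap_sub hw.sm hz.sm hx]
      have := hw.lp x hx
      have := hz.lp x hx
      have := abs_sub (lap w x) (lap z x)
      linarith
    · have := pd_amgm d x x 1 η (by simpa using oD_sub hx) hη
      simpa using this
  rw [dmul, dadd (by fun_prop) (by fun_prop), dmul, dmul] at i1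
  have i2 : bint (fun x => nderiv d x ^ 2) ≤ bint (fun x => 2 * C * (|h| * exp (C / 2) *
      |d x| + (|dN h w x| + |dN h z x|))) := by
    refine bmono (by fun_prop) (by fun_prop) fun θ => ?_
    have e : nderiv d (bpt θ) = nderiv w (bpt θ) - nderiv z (bpt θ) :=
      nderiv_sub hw.sm.s1 hz.sm.s1 (bpt_mem θ)
    have b1 : |nderiv d (bpt θ)| ≤ 2 * C := by
      have := hw.nd θ
      have := hz.nd θ
      have := abs_sub (nderiv w (bpt θ)) (nderiv z (bpt θ))
      rw [e]; linarith
    have b2 : nderiv d (bpt θ) = 2 * h * (exp (w (bpt θ) / 2) - exp (z (bpt θ) / 2)) +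
        (dN h w (bpt θ) - dN h z (bpt θ)) := by
      rw [e]; unfold dN; ring
    have b3 : |exp (w (bpt θ) / 2) - exp (z (bpt θ) / 2)| ≤
        exp (C / 2) * (|d (bpt θ)| / 2) := by
      have h1 := (abs_le.1 (hw.bd _ (bpt_mem θ))).2
      have h2 := (abs_le.1 (hz.bd _ (bpt_mem θ))).2
      have := exp_lip (a := w (bpt θ) / 2) (b := z (bpt θ) / 2) (C := C / 2)
        (by linarith) (by linarith)
      rw [← sub_div, abs_div, abs_two] at this
      exact this
    have b4 : |nderiv d (bpt θ)| ≤ |h| * exp (C / 2) *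
      |d (bpt θ)| + (|dN h w (bpt θ)| + |dN h z (bpt θ)|) := by
      rw [b2]
      refine (abs_add_le _ _).trans (add_le_add ?_ (abs_sub _ _))
      rw [abs_mul, abs_mul, abs_two]
      calc 2 * |h| * |exp (w (bpt θ) / 2) - exp (z (bpt θ) / 2)|
          ≤ 2 * |h| * (exp (C / 2) * (|d (bpt θ)| / 2)) := by gcongr
        _ = _ := by ring
    rw [← sq_abs, sq]
    exact mul_le_mul b1 b4 (abs_nonneg _) (by positivity)
  rw [bmul, badd (by fun_prop) (by fun_prop), bmul, badd (by fun_prop) (by fun_prop)] at i2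
  have := abs_le.1 i1
  have e9 : (∫ x in oD, (1:ℝ)) = vD := rfl
  rw [e9] at this
  linarith
lemma vf_pow (c : ℂ) (m : ℕ) : VF (fun x => c * x ^ m) (fun x => c * (m * x ^ (m - 1))) :=
  ⟨fun x => (hasDerivAt_pow m x).const_mul c, by fun_prop⟩
lemma harm_S2 (c : ℂ) (m : ℕ) : S2 (fun x => (c * x ^ m).re) := fun _ _ => by
  have : ContDiff ℝ 2 (fun x : ℂ => c * x ^ m) := by fun_prop
  exact (reCLM.contDiff.comp this).contDiffAt
lemma harm_lap (c : ℂ) (m : ℕ) (x : ℂ) : lap (fun x => (c * x ^ m).re) x = 0 := by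
  have e : ∀ v : ℂ, (fun y => pd (fun x => (c * x ^ m).re) v y) =
      fun y => ((c * m * v) * y ^ (m - 1)).re := fun v => by
    ext y; rw [(vf_pow c m).re_pd]; congr 1; ring
  have h1 := (vf_pow (c * m * 1) (m - 1)).re_pd x 1
  have h2 := (vf_pow (c * m * I) (m - 1)).re_pd x I
  unfold lap
  rw [e 1, e I]
  unfold pd at h1 h2
  rw [h1, h2, ← Complex.add_re]
  have : c * ↑m * 1 * (↑(m - 1) * x ^ (m - 1 - 1)) * 1 +
    c * ↑m * I * (↑(m - 1) * x ^ (m - 1 - 1)) * I =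
    c * ↑m * (↑(m - 1) * x ^ (m - 1 - 1)) * (1 + I * I) := by ring
  rw [this, Complex.I_mul_I]; simp
lemma harm_nderiv (c : ℂ) (m : ℕ) (x : ℂ) :
    nderiv (fun x => (c * x ^ m).re) x = m * (c * x ^ m).re := by
  rw [nderiv_eq, (vf_pow c m).re_pd]
  have : c * (↑m * x ^ (m - 1)) * x = (m : ℝ) * (c * x ^ m) := by
    rcases m with _ | m
    · simp
    · simp only [Nat.add_sub_cancel, pow_succ]; push_cast; ring
  rw [this, Complex.re_ofReal_mul]
def ma (c : ℂ) (m : ℕ) (θ : ℝ) : ℝ := (c * bpt θ ^ m).re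
def mb (c : ℂ) (m : ℕ) (θ : ℝ) : ℝ := (c * bpt θ ^ m).im
lemma mono_der (c : ℂ) (m : ℕ) (θ : ℝ) : HasDerivAt (fun t => c * bpt t ^ m)
    (m * I * (c * bpt θ ^ m)) θ := by
  have h := ((bpt_hasDeriv θ).pow m).const_mul c
  refine h.congr_deriv ?_
  rcases m with _ | m
  · simp
  · simp only [Nat.add_sub_cancel, pow_succ]; push_cast; ring
lemma ma_der (c : ℂ) (m : ℕ) (θ : ℝ) : HasDerivAt (ma c m) (-(m * mb c m θ)) θ := by
  have h := reCLM.hasFDerivAt.comp_hasDerivAt θ (mono_der c m θ)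
  refine h.congr_deriv ?_
  simp [mb, mul_re, mul_im]
lemma mb_der (c : ℂ) (m : ℕ) (θ : ℝ) : HasDerivAt (mb c m) (m * ma c m θ) θ := by
  have h := imCLM.hasFDerivAt.comp_hasDerivAt θ (mono_der c m θ)
  refine h.congr_deriv ?_
  simp [ma, mul_re, mul_im]
lemma ma_cont (c : ℂ) (m : ℕ) : Continuous (ma c m) := by
  unfold ma; have := bpt_cont; fun_prop
lemma mb_cont (c : ℂ) (m : ℕ) : Continuous (mb c m) := by
  unfold mb; have := bpt_cont; fun_prop
lemma ma_two_pi (c : ℂ) (m : ℕ) : ma c m (2 * π) = ma c m 0 := by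
  unfold ma; rw [bpt_zero, bpt_two_pi]
lemma mb_two_pi (c : ℂ) (m : ℕ) : mb c m (2 * π) = mb c m 0 := by
  unfold mb; rw [bpt_zero, bpt_two_pi]
lemma ma_le (c : ℂ) (m : ℕ) (θ : ℝ) : |ma c m θ| ≤ ‖c‖ := by
  refine (abs_re_le_norm _).trans ?_; simp [norm_bpt]
lemma mb_le (c : ℂ) (m : ℕ) (θ : ℝ) : |mb c m θ| ≤ ‖c‖ := by
  refine (abs_im_le_norm _).trans ?_; simp [norm_bpt]
lemma al_pow (c : ℂ) (m : ℕ) (θ : ℝ) : al (fun x => c * x ^ (m + 1)) (bpt θ) = ma c m θ := by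
  have h := bpt_sq θ
  unfold al ma
  simp only [pow_succ, ← mul_assoc]
  simp only [mul_re _ (bpt θ), mul_im _ (bpt θ)]
  linear_combination (c * bpt θ ^ m).re * h
lemma be_pow (c : ℂ) (m : ℕ) (θ : ℝ) : be (fun x => c * x ^ (m + 1)) (bpt θ) = mb c m θ := by
  have h := bpt_sq θ
  unfold be mb
  simp only [pow_succ, ← mul_assoc]
  simp only [mul_re _ (bpt θ), mul_im _ (bpt θ)]
  linear_combination (c * bpt θ ^ m).im * h
lemma moment_exact (hw : S2 w) (k : ℝ) {F F' : ℂ → ℂ} (hF : VF F F')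
    (hχ : S2 (fun x => (F' x).re)) (hχl : ∀ x, lap (fun x => (F' x).re) x = 0) :
    bint (fun x => (1/2 * al F x * (nderiv w x ^ 2 - tderiv w x ^ 2) +
        be F x * nderiv w x * tderiv w x) + 2 * k * (exp (w x) * al F x) +
        2 * ((F' x).re * nderiv w x - w x * nderiv (fun x => (F' x).re) x)) =
      (∫ x in oD, dE k w x * pd w (F x) x) + 2 * ∫ x in oD, (F' x).re * dE k w x := by
  have c1 := hw.s1.cont
  have c2 := hw.lap_cont
  have c3 := hw.dE_cont k
  have c4 := hw.s1.nderiv_cont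
  have c5 := hw.s1.tderiv_cont
  have c6 := hw.s1.pdF_cont (F := F) hF.cont.continuousOn
  have c7 := hχ.s1.cont
  have c8 := hχ.s1.nderiv_cont
  have c9 : ContinuousOn (al F) cD := by have := hF.cont; unfold al; fun_prop
  have c10 : ContinuousOn (be F) cD := by have := hF.cont; unfold be; fun_prop
  have hexp : S1 (fun x => exp (w x)) := fun x hx => (hw.s1 x hx).exp
  have h1 := greenB hw hF
  have h2 := greenC hexp hF
  have h3 := greenD hχ hw
  have e2 : ∫ x in oD, (pd (fun x => exp (w x)) (F x) x + exp (w x) * (2 * (F' x).re)) =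
      (∫ x in oD, exp (w x) * pd w (F x) x) + 2 * ∫ x in oD, (F' x).re * exp (w x) := by
    rw [← dmul, ← dadd (by fun_prop) (by fun_prop)]
    refine dcongr fun x hx => ?_
    rw [pd_comp (Real.hasDerivAt_exp _) (hw.s1.diff (oD_sub hx))]; ring
  have e3 : ∫ x in oD, ((F' x).re * lap w x - w x * lap (fun x => (F' x).re) x) =
      (∫ x in oD, (F' x).re * dE k w x) - 2 * k * ∫ x in oD, (F' x).re * exp (w x) := by
    rw [← dmul, ← dsub (by fun_prop) (by fun_prop)]
    refine dcongr fun x hx => ?_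
    rw [hχl]; unfold dE; ring
  have e1 : ∫ x in oD, lap w x * pd w (F x) x =
      (∫ x in oD, dE k w x * pd w (F x) x) - 2 * k * ∫ x in oD, exp (w x) * pd w (F x) x := by
    rw [← dmul, ← dsub (by fun_prop) (by fun_prop)]
    refine dcongr fun x hx => ?_
    unfold dE; ring
  rw [badd (by fun_prop) (by fun_prop), badd (by fun_prop) (by fun_prop), bmul, bmul, ← h1, ← h2,
    ← h3, e1, e2, e3]
  ring
def tr (w : ℂ → ℝ) (θ : ℝ) : ℝ := w (bpt θ)
lemma tr_def (w : ℂ → ℝ) (θ : ℝ) : w (bpt θ) = tr w θ := rfl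
lemma tr_cont (h : ContinuousOn w cD) : Continuous (tr w) := cont_b h
def NN (s2 : ℝ) (w : ℂ → ℝ) (θ : ℝ) : ℝ :=
  1 + 1/4 * tderiv w (bpt θ) ^ 2 - s2 * exp (w (bpt θ))
lemma NN_cont (hw : S2 w) (s2 : ℝ) : Continuous (NN s2 w) := by
  have h1 := tr_cont hw.s1.cont
  have h2 := tr_cont hw.s1.tderiv_cont
  unfold NN; simp only [tr_def w, tr_def (tderiv w)]; fun_prop
lemma moment_id (hw : S2 w) (k h : ℝ) (c : ℂ) (m : ℕ) :
    (∫ θ in 0..2 * π, (ma c m θ * NN (h ^ 2 + k) w θ + m ^ 2 * (ma c m θ * w (bpt θ)))) =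
    1/2 * (∫ θ in 0..2 * π, dN h w (bpt θ) * (1/2 * ma c m θ * (nderiv w (bpt θ) +
        (2 * h * exp (w (bpt θ) / 2) - 2)) + mb c m θ * tderiv w (bpt θ)
        + 2 * (m + 1) * ma c m θ))
      - 1/2 * ((∫ x in oD, dE k w x * pd w (c * x ^ (m + 1)) x) +
       2 * ∫ x in oD, (c * ((m + 1) * x ^ m)).re * dE k w x) := by
  have hF := vf_pow c (m + 1)
  have hF' : (fun x : ℂ => c * (((m + 1 : ℕ) : ℂ) * x ^ (m + 1 - 1))) =
      fun x => (c * (m + 1)) * x ^ m := by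
    ext x; simp only [Nat.add_sub_cancel]; push_cast; ring
  rw [hF'] at hF
  have h1 := moment_exact hw k hF (harm_S2 _ _) (harm_lap _ _)
  have c1 := tr_cont hw.s1.cont
  have c4 := tr_cont hw.s1.nderiv_cont
  have c5 := tr_cont hw.s1.tderiv_cont
  have c6 := ma_cont c m
  have c7 := mb_cont c m
  have c8 := tr_cont (hw.dN_cont h)
  have c9 := NN_cont hw (h ^ 2 + k)
  have e0 : ∀ x : ℂ, c * ((m + 1) * x ^ m) = c * (m + 1) * x ^ m := fun x => by ring
  simp only [e0]
  rw [← h1]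
  have hd : ∀ θ, HasDerivAt (fun t => mb c m t * (4 * h * exp (w (bpt t) / 2)
      - 2 * w (bpt t) - 4)) (m * ma c m θ * (4 * h * exp (w (bpt θ) / 2)
      - 2 * w (bpt θ) - 4) + mb c m θ * (4 * h * (exp (w (bpt θ) / 2) *
      (tderiv w (bpt θ) / 2)) - 2 * tderiv w (bpt θ))) θ := fun θ => by
    have a := bpt_deriv_comp hw.s1 θ
    exact (mb_der c m θ).mul (((((a.div_const 2).exp).const_mul (4 * h)).sub
      (a.const_mul 2)).sub_const 4)
  have hI : (∫ θ in 0..2 * π, (m * ma c m θ * (4 * h * exp (w (bpt θ) / 2)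
      - 2 * w (bpt θ) - 4) + mb c m θ * (4 * h * (exp (w (bpt θ) / 2) *
      (tderiv w (bpt θ) / 2)) - 2 * tderiv w (bpt θ)))) = 0 := by
    rw [intervalIntegral.integral_eq_sub_of_hasDerivAt (fun t _ => hd t)
      (Continuous.intervalIntegrable (by
      simp only [tr_def w, tr_def (nderiv w), tr_def (tderiv w), tr_def (dN h w)]
      fun_prop) _ _), bpt_two_pi, bpt_zero, mb_two_pi, sub_self]
  unfold bint
  rw [← intervalIntegral.integral_const_mul, ← intervalIntegral.integral_const_mul,
    ← intervalIntegral.integral_sub]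
  · rw [← sub_eq_zero, ← intervalIntegral.integral_sub]
    · rw [← mul_eq_zero_iff_left (two_ne_zero' ℝ),
        ← intervalIntegral.integral_const_mul, ← hI]
      congr 1
      ext θ
      beta_reduce
      rw [al_pow, be_pow, harm_nderiv]
      have e1 : (c * (↑m + 1) * bpt θ ^ m).re = (m + 1) * ma c m θ := by
        have : c * (↑m + 1) * bpt θ ^ m = ((m + 1 : ℝ) : ℂ) * (c * bpt θ ^ m) := by
          push_cast; ring
        rw [this, Complex.re_ofReal_mul]; rfl
      rw [e1]
      unfold NN dN
      have e2 : exp (w (bpt θ)) = exp (w (bpt θ) / 2) ^ 2 := by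
        rw [sq, ← exp_add]; ring_nf
      rw [e2]
      ring
    · exact Continuous.intervalIntegrable (by
      simp only [tr_def w, tr_def (nderiv w), tr_def (tderiv w), tr_def (dN h w)]
      fun_prop) _ _
    · refine Continuous.intervalIntegrable ?_ _ _
      have a1 : Continuous fun θ => al (fun x => c * x ^ (m + 1)) (bpt θ) := by
        simp only [al_pow]; exact c6
      have a2 : Continuous fun θ => be (fun x => c * x ^ (m + 1)) (bpt θ) := by
        simp only [be_pow]; exact c7
      have a3 := bpt_cont
      simp only [harm_nderiv]
      simp only [tr_def w, tr_def (nderiv w), tr_def (tderiv w), tr_def (dN h w)]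
      fun_prop
  · exact Continuous.intervalIntegrable (by
      simp only [tr_def w, tr_def (nderiv w), tr_def (tderiv w), tr_def (dN h w)]
      fun_prop) _ _
  · refine Continuous.intervalIntegrable ?_ _ _
    have a1 : Continuous fun θ => al (fun x => c * x ^ (m + 1)) (bpt θ) := by
      simp only [al_pow]; exact c6
    have a2 : Continuous fun θ => be (fun x => c * x ^ (m + 1)) (bpt θ) := by
      simp only [be_pow]; exact c7
    have a3 := bpt_cont
    simp only [harm_nderiv]
    simp only [tr_def w, tr_def (nderiv w), tr_def (tderiv w), tr_def (dN h w)]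
    fun_prop
structure AS (k h C : ℝ) (w : ℕ → ℂ → ℝ) : Prop where
  bf : ∀ n, BF C (w n)
  e : Tendsto (fun n => ∫ x in oD, |dE k (w n) x|) atTop (nhds 0)
  n : Tendsto (fun n => bint (fun x => |dN h (w n) x|)) atTop (nhds 0)
lemma AS.comp {k h C : ℝ} {w : ℕ → ℂ → ℝ} (hw : AS k h C w) {φ : ℕ → ℕ} (hφ : StrictMono φ) :
    AS k h C (fun n => w (φ n)) :=
  ⟨fun n => hw.bf _, hw.e.comp hφ.tendsto_atTop, hw.n.comp hφ.tendsto_atTop⟩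
def CC (C : ℝ) : ℝ := C * (1 + vD + 2 * π)
def BB (C : ℝ) : ℝ := 2 * π * CC C ^ 2 + 2 * CC C * (vD + 2 * CC C ^ 2)
lemma le_CC {C : ℝ} (h : 0 ≤ C) : C ≤ CC C := by
  unfold CC; have := vD_nonneg; have := pi_pos; nlinarith [mul_nonneg h this.le, mul_nonneg h vD_nonneg]
lemma BF.en {C : ℝ} (hw : BF C w) : ∫ x in oD, gradSq w x ≤ 2 * CC C ^ 2 := by
  have h0 := hw.nonneg
  have c1 := hw.sm.s1.cont
  refine energy hw.sm (fun x hx => (hw.lp x hx).trans (le_CC h0))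
    (fun θ => (hw.nd θ).trans (le_CC h0)) ?_ ?_
  · have : ∫ x in oD, |w x| ≤ ∫ x in oD, C * 1 :=
      dmono (by fun_prop) (by fun_prop) fun x hx => by simpa using hw.bd x (oD_sub hx)
    rw [dmul] at this
    refine this.trans ?_
    unfold CC; have := pi_pos; gcongr; simp only [vD]; linarith
  · have : bint (fun x => |w x|) ≤ bint (fun _ => C) :=
      bmono (by fun_prop) (by fun_prop) fun θ => hw.bd _ (bpt_mem θ)
    rw [bconst] at this
    refine this.trans ?_
    unfold CC; have := vD_nonneg; nlinarith
lemma BF.te {C : ℝ} (hw : BF C w) : bint (fun x => tderiv w x ^ 2) ≤ BB C := by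
  have h0 := hw.nonneg
  exact trace_energy hw.sm (fun x hx => (hw.lp x hx).trans (le_CC h0))
    (fun θ => (hw.nd θ).trans (le_CC h0)) hw.en
lemma tendsto_amgm {a b : ℕ → ℝ} {A Q : ℝ} (hb : Tendsto b atTop (nhds 0))
    (h : ∀ n η, 0 < η → η ≤ 1 → |a n| ≤ A * η + Q / η * b n) : Tendsto a atTop (nhds 0) := by
  rw [Metric.tendsto_atTop]
  intro ε hε
  set η : ℝ := min 1 (ε / (2 * (|A| + 1))) with hη
  have h1 : 0 < η := by positivity
  have h2 : Tendsto (fun n => Q / η * b n) atTop (nhds 0) := by simpa using hb.const_mul (Q / η)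
  obtain ⟨N, hN⟩ := (Metric.tendsto_atTop.1 h2) (ε / 2) (by positivity)
  refine ⟨N, fun n hn => ?_⟩
  have h3 := hN n hn
  have h4 := h n η h1 (min_le_left _ _)
  simp only [Real.dist_eq, sub_zero] at *
  have h5 : A * η ≤ ε / 2 := by
    have h6 : η ≤ ε / (2 * (|A| + 1)) := min_le_right _ _
    have h7 : A * η ≤ |A| * η := mul_le_mul_of_nonneg_right (le_abs_self A) h1.le
    have h8 : |A| * η ≤ (|A| + 1) * (ε / (2 * (|A| + 1))) :=
      mul_le_mul (by linarith) h6 h1.le (by positivity)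
    have h9 : (|A| + 1) * (ε / (2 * (|A| + 1))) = ε / 2 := by field_simp
    linarith
  have := (abs_lt.1 h3).2
  linarith
lemma abs_mul_amgm (a b η : ℝ) (hη : 0 < η) : |a * b| ≤ η * b ^ 2 + a ^ 2 / (4 * η) := by
  have h : 0 ≤ (|a| - 2 * η * |b|) ^ 2 / (4 * η) := by positivity
  have e : (|a| - 2 * η * |b|) ^ 2 / (4 * η) = η * b ^ 2 + a ^ 2 / (4 * η) - |a * b| := by
    rw [abs_mul, ← sq_abs a, ← sq_abs b]; field_simp; ring
  linarith
lemma BF.dE_le {C k : ℝ} (hw : BF C w) (hx : x ∈ oD) :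
    |dE k w x| ≤ C + 2 * |k| * exp C := by
  unfold dE
  refine (abs_add_le _ _).trans (add_le_add (hw.lp x hx) ?_)
  rw [abs_mul, abs_mul, abs_two, abs_exp]
  have := (abs_le.1 (hw.bd x (oD_sub hx))).2
  gcongr
lemma BF.n0_le {C h : ℝ} (hw : BF C w) (θ : ℝ) :
    |2 * h * exp (w (bpt θ) / 2) - 2| ≤ 2 * |h| * exp (C / 2) + 2 := by
  refine (abs_sub _ _).trans ?_
  rw [abs_mul, abs_mul, abs_two, abs_exp]
  have := (abs_le.1 (hw.bd _ (bpt_mem θ))).2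
  gcongr
lemma BF.dN_le {C h : ℝ} (hw : BF C w) (θ : ℝ) :
    |dN h w (bpt θ)| ≤ C + (2 * |h| * exp (C / 2) + 2) := by
  have e : dN h w (bpt θ) = nderiv w (bpt θ) - (2 * h * exp (w (bpt θ) / 2) - 2) := by
    unfold dN; ring
  rw [e]
  exact (abs_sub _ _).trans (add_le_add (hw.nd θ) (hw.n0_le θ))
lemma AS.t1 {k h C : ℝ} {w : ℕ → ℂ → ℝ} (hw : AS k h C w) (c : ℂ) (m : ℕ) :
    Tendsto (fun n => ∫ x in oD, dE k (w n) x * pd (w n) (c * x ^ (m + 1)) x) atTop (nhds 0) := by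
  refine tendsto_amgm (A := ‖c‖ ^ 2 * (2 * CC C ^ 2)) (Q := (C + 2 * |k| * exp C) / 4)
    hw.e fun n η hη _ => ?_
  have hb := hw.bf n
  have c1 := hb.sm.dE_cont k
  have c2 := hb.sm.s1.pdF_cont (F := fun x => c * x ^ (m + 1)) (by fun_prop)
  have c3 := hb.sm.s1.gradSq_cont
  have : |∫ x in oD, dE k (w n) x * pd (w n) (c * x ^ (m + 1)) x| ≤
      ∫ x in oD, (η * ‖c‖ ^ 2 * gradSq (w n) x + (C + 2 * |k| * exp C) / 4 / η *
        |dE k (w n) x|) := by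
    refine dabs (by fun_prop) (by fun_prop) fun x hx => ?_
    refine (abs_mul_amgm _ _ η hη).trans (add_le_add ?_ ?_)
    · have h1 := pd_sq_le (w n) (c * x ^ (m + 1)) x
      have h2 : ‖c * x ^ (m + 1)‖ ≤ ‖c‖ := by
        rw [norm_mul, norm_pow]
        have : ‖x‖ ^ (m + 1) ≤ 1 := pow_le_one₀ (norm_nonneg _) (by simpa using oD_sub hx)
        exact mul_le_of_le_one_right (norm_nonneg _) this
      have h3 : ‖c * x ^ (m + 1)‖ ^ 2 * gradSq (w n) x ≤ ‖c‖ ^ 2 * gradSq (w n) x :=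
        mul_le_mul_of_nonneg_right (by gcongr) (gradSq_nonneg _ _)
      rw [mul_assoc]
      exact mul_le_mul_of_nonneg_left (h1.trans h3) hη.le
    · have h1 := hb.dE_le (k := k) hx
      have h2 : dE k (w n) x ^ 2 ≤ (C + 2 * |k| * exp C) * |dE k (w n) x| := by
        rw [← sq_abs, sq]; exact mul_le_mul_of_nonneg_right h1 (abs_nonneg _)
      calc dE k (w n) x ^ 2 / (4 * η) ≤ (C + 2 * |k| * exp C) * |dE k (w n) x| / (4 * η) := by
            gcongr
        _ = _ := by field_simp
  rw [dadd (by fun_prop) (by fun_prop), dmul, dmul] at this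
  refine this.trans (add_le_add ?_ le_rfl)
  have := mul_le_mul_of_nonneg_left hb.en (a := η * ‖c‖ ^ 2) (by positivity)
  linarith
lemma AS.t2 {k h C : ℝ} {w : ℕ → ℂ → ℝ} (hw : AS k h C w) (c : ℂ) (m : ℕ) :
    Tendsto (fun n => ∫ x in oD, (c * ((m + 1) * x ^ m)).re * dE k (w n) x) atTop (nhds 0) := by
  have := hw.e.const_mul (‖c‖ * (m + 1))
  rw [mul_zero] at this
  refine squeeze_zero_norm (fun n => ?_) this
  have hb := hw.bf n
  have c1 := hb.sm.dE_cont k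
  rw [← dmul]
  refine dabs (by fun_prop) (by fun_prop) fun x hx => ?_
  rw [abs_mul]
  refine mul_le_mul_of_nonneg_right ?_ (abs_nonneg _)
  refine (abs_re_le_norm _).trans ?_
  have e : ‖((m : ℂ) + 1)‖ = m + 1 := by
    have : ((m : ℂ) + 1) = ((m + 1 : ℝ) : ℂ) := by push_cast; ring
    rw [this, norm_real, norm_eq_abs, abs_of_nonneg (by positivity)]
  rw [norm_mul, norm_mul, norm_pow, e]
  have : ‖x‖ ^ m ≤ 1 := pow_le_one₀ (norm_nonneg _) (by simpa using oD_sub hx)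
  have h1 : (m + 1 : ℝ) * ‖x‖ ^ m ≤ m + 1 := mul_le_of_le_one_right (by positivity) this
  exact mul_le_mul_of_nonneg_left h1 (norm_nonneg _)
lemma AS.t3 {k h C : ℝ} {w : ℕ → ℂ → ℝ} (hw : AS k h C w) (c : ℂ) (m : ℕ) :
    Tendsto (fun n => ∫ θ in 0..2 * π, dN h (w n) (bpt θ) * (1/2 * ma c m θ *
        (nderiv (w n) (bpt θ) + (2 * h * exp (w n (bpt θ) / 2) - 2)) +
        mb c m θ * tderiv (w n) (bpt θ) + 2 * (m + 1) * ma c m θ)) atTop (nhds 0) := by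
  set D1 : ℝ := C + (2 * |h| * exp (C / 2) + 2) with hD1
  refine tendsto_amgm (A := ‖c‖ * BB C) (Q := ‖c‖ * (D1 / 4 + (D1 / 2 + 2 * (m + 1))))
    hw.n fun n η hη hη1 => ?_
  have hb := hw.bf n
  have hC := hb.nonneg
  have hD0 : 0 ≤ D1 := by positivity
  have c1 := tr_cont hb.sm.s1.cont
  have c2 := tr_cont (hb.sm.dN_cont h)
  have c3 := tr_cont hb.sm.s1.tderiv_cont
  have c4 := tr_cont hb.sm.s1.nderiv_cont
  have c5 := ma_cont c m
  have c6 := mb_cont c m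
  have i1 : |∫ θ in 0..2 * π, dN h (w n) (bpt θ) * (1/2 * ma c m θ *
        (nderiv (w n) (bpt θ) + (2 * h * exp (w n (bpt θ) / 2) - 2)) +
        mb c m θ * tderiv (w n) (bpt θ) + 2 * (m + 1) * ma c m θ)| ≤
      ∫ θ in 0..2 * π, (‖c‖ * η * tderiv (w n) (bpt θ) ^ 2 +
        ‖c‖ * (D1 / 4 + (D1 / 2 + 2 * (m + 1))) / η * |dN h (w n) (bpt θ)|) := by
    refine (intervalIntegral.abs_integral_le_integral_abs two_pi_nonneg).trans
      (intervalIntegral.integral_mono_on two_pi_nonneg ?_ ?_ fun θ _ => ?_)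
    · refine Continuous.intervalIntegrable ?_ _ _
      simp only [tr_def (w n), tr_def (nderiv (w n)), tr_def (tderiv (w n)), tr_def (dN h (w n))]
      fun_prop
    · refine Continuous.intervalIntegrable ?_ _ _
      simp only [tr_def (w n), tr_def (nderiv (w n)), tr_def (tderiv (w n)), tr_def (dN h (w n))]
      fun_prop
    · have a1 := ma_le c m θ
      have a2 := mb_le c m θ
      have a3 := hb.nd θ
      have a4 := hb.n0_le (h := h) θ
      have a5 := hb.dN_le (h := h) θ
      rw [← hD1] at a5
      generalize 2 * h * exp (w n (bpt θ) / 2) - 2 = n0 at *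
      generalize nderiv (w n) (bpt θ) = nn at *
      generalize tderiv (w n) (bpt θ) = t at *
      generalize dN h (w n) (bpt θ) = d at *
      generalize ma c m θ = α at *
      generalize mb c m θ = β at *
      have b1 : |d * t| ≤ η * t ^ 2 + D1 / 4 / η * |d| := by
        refine (abs_mul_amgm _ _ η hη).trans (add_le_add le_rfl ?_)
        have h2 : d ^ 2 ≤ D1 * |d| := by
          rw [← sq_abs, sq]; exact mul_le_mul_of_nonneg_right a5 (abs_nonneg _)
        calc d ^ 2 / (4 * η) ≤ D1 * |d| / (4 * η) := by gcongr
          _ = _ := by field_simp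
      have b2 : |nn + n0| ≤ D1 := (abs_add_le _ _).trans (by linarith)
      have b3 : |1/2 * (nn + n0) + 2 * (m + 1)| ≤ D1 / 2 + 2 * (m + 1) := by
        refine (abs_add_le _ _).trans ?_
        have : |(2 * ((m : ℝ) + 1))| = 2 * (m + 1) := abs_of_nonneg (by positivity)
        rw [this, abs_mul, abs_of_nonneg (by norm_num : (0:ℝ) ≤ 1/2)]; linarith
      have e : d * (1 / 2 * α * (nn + n0) + β * t + 2 * (m + 1) * α) =
        α * ((1/2 * (nn + n0) + 2 * (m + 1)) * d) + β * (d * t) := by ring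
      rw [e]
      have b4 : |α * ((1/2 * (nn + n0) + 2 * (m + 1)) * d)| ≤
          ‖c‖ * ((D1 / 2 + 2 * (m + 1)) / η * |d|) := by
        rw [abs_mul, abs_mul]
        refine mul_le_mul a1 ?_ (by positivity) (norm_nonneg _)
        refine mul_le_mul_of_nonneg_right (b3.trans ?_) (abs_nonneg _)
        rw [le_div_iff₀ hη]
        exact mul_le_of_le_one_right (by positivity) hη1
      have b5 : |β * (d * t)| ≤ ‖c‖ * (η * t ^ 2 + D1 / 4 / η * |d|) := by
        rw [abs_mul]; exact mul_le_mul a2 b1 (abs_nonneg _) (norm_nonneg _)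
      refine (abs_add_le _ _).trans ((add_le_add b4 b5).trans (le_of_eq ?_))
      ring
  rw [intervalIntegral.integral_add, intervalIntegral.integral_const_mul,
    intervalIntegral.integral_const_mul] at i1
  · refine i1.trans (add_le_add ?_ le_rfl)
    have := mul_le_mul_of_nonneg_left hb.te (a := ‖c‖ * η) (by positivity)
    unfold bint at this
    linarith
  · refine Continuous.intervalIntegrable ?_ _ _
    simp only [tr_def (tderiv (w n))]; fun_prop
  · refine Continuous.intervalIntegrable ?_ _ _
    simp only [tr_def (dN h (w n))]; fun_prop
lemma AS.moment {k h C : ℝ} {w : ℕ → ℂ → ℝ} (hw : AS k h C w) (c : ℂ) (m : ℕ) :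
    Tendsto (fun n => ∫ θ in 0..2 * π, (ma c m θ * NN (h ^ 2 + k) (w n) θ +
      m ^ 2 * (ma c m θ * w n (bpt θ)))) atTop (nhds 0) := by
  have e : ∀ n, _ := fun n => moment_id (hw.bf n).sm k h c m
  simp only [e]
  have := ((hw.t3 c m).const_mul (1/2)).sub
    (((hw.t1 c m).add ((hw.t2 c m).const_mul 2)).const_mul (1/2))
  simpa using this
lemma arzela {f : ℕ → ℝ → ℝ} {C B : ℝ} (hp : ∀ n, Function.Periodic (f n) (2 * π))
    (hC : ∀ n θ, |f n θ| ≤ C) (hc : ∀ n, Continuous (f n))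
    (hB : ∀ n a b, a ≤ b → b ≤ a + 2 * π → |f n b - f n a| ≤ B * √(b - a)) :
    ∃ φ : ℕ → ℕ, StrictMono φ ∧ ∃ ω : ℝ → ℝ, Continuous ω ∧
      ∀ ε > 0, ∃ N, ∀ n ≥ N, ∀ θ, |f (φ n) θ - ω θ| ≤ ε := by
  let X := Set.Icc (0:ℝ) (2 * π)
  let g : ℕ → BoundedContinuousFunction X ℝ := fun n =>
    BoundedContinuousFunction.mkOfCompact ⟨fun x => f n x, (hc n).comp continuous_subtype_val⟩
  have hcomp : IsCompact (closure (Set.range g)) := by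
    refine BoundedContinuousFunction.arzela_ascoli (Set.Icc (-C) C) isCompact_Icc _ ?_ ?_
    · rintro _ x ⟨n, rfl⟩
      exact abs_le.1 (hC n x)
    · refine Metric.equicontinuous_of_continuity_modulus (fun d => B * √d) ?_ _ ?_
      · have : Continuous (fun d => B * √d) := by fun_prop
        simpa using this.tendsto 0
      · rintro x y ⟨_, n, rfl⟩
        have key : ∀ x y : X, x.1 ≤ y.1 → dist (f n x) (f n y) ≤ B * √(dist x y) := by
          intro x y hxy
          rw [dist_comm, Real.dist_eq, dist_comm, Subtype.dist_eq, Real.dist_eq,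
            abs_of_nonneg (by linarith : (0:ℝ) ≤ y.1 - x.1)]
          exact hB n _ _ hxy (by linarith [x.2.1, y.2.2])
        rcases le_total x.1 y.1 with h | h
        · exact key x y h
        · have := key y x h
          rw [dist_comm, dist_comm y x] at this
          exact this
  obtain ⟨G, -, φ, hφ, hlim⟩ := hcomp.tendsto_subseq
    (x := g) (fun n => subset_closure ⟨n, rfl⟩)
  have hu : ∀ ε > 0, ∃ N, ∀ n ≥ N, ∀ m ≥ N, ∀ θ, |f (φ n) θ - f (φ m) θ| ≤ ε := by
    intro ε hε
    obtain ⟨N, hN⟩ := (Metric.tendsto_atTop.1 hlim) (ε / 2) (by positivity)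
    refine ⟨N, fun n hn m hm θ => ?_⟩
    have h2 : (0:ℝ) < 2 * π := by positivity
    obtain ⟨y, hy, hye⟩ : ∃ y ∈ Set.Ico (0:ℝ) (2 * π), ∀ i, f i θ = f i y := by
      refine ⟨toIcoMod h2 0 θ, by simpa using toIcoMod_mem_Ico h2 0 θ, fun i => ?_⟩
      have h3 := (hp i).sub_zsmul_eq (x := θ) (toIcoDiv h2 0 θ)
      rw [← h3]; rfl
    rw [hye, hye]
    have d1 := (BoundedContinuousFunction.dist_coe_le_dist (f := (g ∘ φ) n) (g := G)
      ⟨y, ⟨hy.1, hy.2.le⟩⟩).trans (hN n hn).le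
    have d2 := (BoundedContinuousFunction.dist_coe_le_dist (f := (g ∘ φ) m) (g := G)
      ⟨y, ⟨hy.1, hy.2.le⟩⟩).trans (hN m hm).le
    have := dist_triangle_right (((g ∘ φ) n) ⟨y, ⟨hy.1, hy.2.le⟩⟩)
      (((g ∘ φ) m) ⟨y, ⟨hy.1, hy.2.le⟩⟩) (G ⟨y, ⟨hy.1, hy.2.le⟩⟩)
    rw [← Real.dist_eq]
    exact this.trans (by linarith)
  have hcs : ∀ θ, ∃ l, Tendsto (fun n => f (φ n) θ) atTop (nhds l) := fun θ => by
    refine cauchySeq_tendsto_of_complete (Metric.cauchySeq_iff.2 fun ε hε => ?_)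
    obtain ⟨N, hN⟩ := hu (ε / 2) (by positivity)
    exact ⟨N, fun m hm n hn => by
      rw [Real.dist_eq]; have := hN m hm n hn θ; linarith⟩
  choose ω hω using hcs
  have hun : ∀ ε > 0, ∃ N, ∀ n ≥ N, ∀ θ, |f (φ n) θ - ω θ| ≤ ε := by
    intro ε hε
    obtain ⟨N, hN⟩ := hu ε hε
    refine ⟨N, fun n hn θ => ?_⟩
    have h1 : Tendsto (fun m => |f (φ n) θ - f (φ m) θ|) atTop (nhds |f (φ n) θ - ω θ|) :=
      ((hω θ).const_sub _).abs
    exact le_of_tendsto h1 (eventually_atTop.2 ⟨N, fun m hm => hN n hn m hm θ⟩)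
  refine ⟨φ, hφ, ω, ?_, hun⟩
  have : TendstoUniformly (fun n => f (φ n)) ω atTop := by
    rw [Metric.tendstoUniformly_iff]
    intro ε hε
    obtain ⟨N, hN⟩ := hun (ε / 2) (by positivity)
    filter_upwards [eventually_ge_atTop N] with n hn θ
    rw [dist_comm, Real.dist_eq]; have := hN n hn θ; linarith
  exact this.continuous (Eventually.of_forall fun n => hc _).frequently
def NF (s2 : ℝ) (f σ : ℝ → ℝ) (θ : ℝ) : ℝ := 1 + 1/4 * σ θ ^ 2 - s2 * exp (f θ)
lemma NF_diff {s2 C e η B : ℝ} {f g σ τ : ℝ → ℝ} (hf : Continuous f) (hg : Continuous g)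
    (hσ : Continuous σ) (hτ : Continuous τ) (hs : 0 ≤ s2) (hfC : ∀ θ, |f θ| ≤ C)
    (hgC : ∀ θ, |g θ| ≤ C) (he : ∀ θ, |f θ - g θ| ≤ e) (hη : 0 < η)
    (h1 : ∫ θ in 0..2 * π, σ θ ^ 2 ≤ B) (h2 : ∫ θ in 0..2 * π, τ θ ^ 2 ≤ B) :
    ∫ θ in 0..2 * π, |NF s2 f σ θ - NF s2 g τ θ| ≤
      η * B + 1 / (16 * η) * (∫ θ in 0..2 * π, (σ θ - τ θ) ^ 2) +
        2 * π * (s2 * exp C * e) := by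
  have key : ∫ θ in 0..2 * π, |NF s2 f σ θ - NF s2 g τ θ| ≤
      ∫ θ in 0..2 * π, (η / 2 * σ θ ^ 2 + η / 2 * τ θ ^ 2 + 1 / (16 * η) * (σ θ - τ θ) ^ 2 +
        s2 * exp C * e) := by
    refine intervalIntegral.integral_mono_on two_pi_nonneg ?_ ?_ fun θ _ => ?_
    · refine Continuous.intervalIntegrable ?_ _ _; unfold NF; fun_prop
    · refine Continuous.intervalIntegrable ?_ _ _; fun_prop
    · have e1 : NF s2 f σ θ - NF s2 g τ θ = 1/4 * ((σ θ - τ θ) * (σ θ + τ θ)) -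
          s2 * (exp (f θ) - exp (g θ)) := by unfold NF; ring
      rw [e1]
      refine (abs_sub _ _).trans ?_
      rw [abs_mul, abs_mul s2, abs_of_nonneg hs, abs_of_nonneg (by norm_num : (0:ℝ) ≤ 1/4)]
      have h3 := abs_mul_amgm (σ θ - τ θ) (σ θ + τ θ) η hη
      have h4 : (σ θ + τ θ) ^ 2 ≤ 2 * σ θ ^ 2 + 2 * τ θ ^ 2 := by nlinarith [sq_nonneg (σ θ - τ θ)]
      have h5 := exp_lip (abs_le.1 (hfC θ)).2 (abs_le.1 (hgC θ)).2
      have h6 : s2 * |exp (f θ) - exp (g θ)| ≤ s2 * exp C * e := by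
        rw [mul_assoc]
        exact mul_le_mul_of_nonneg_left (h5.trans (mul_le_mul_of_nonneg_left (he θ)
          (exp_pos _).le)) hs
      have h7 : (σ θ - τ θ) ^ 2 / (4 * η) = 4 * (1 / (16 * η) * (σ θ - τ θ) ^ 2) := by
        field_simp; ring
      have := mul_le_mul_of_nonneg_left h4 hη.le
      linarith
  refine key.trans ?_
  have i1 : IntervalIntegrable (fun θ => η / 2 * σ θ ^ 2) volume 0 (2 * π) :=
    Continuous.intervalIntegrable (by fun_prop) _ _
  have i2 : IntervalIntegrable (fun θ => η / 2 * τ θ ^ 2) volume 0 (2 * π) :=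
    Continuous.intervalIntegrable (by fun_prop) _ _
  have i3 : IntervalIntegrable (fun θ => 1 / (16 * η) * (σ θ - τ θ) ^ 2) volume 0 (2 * π) :=
    Continuous.intervalIntegrable (by fun_prop) _ _
  rw [intervalIntegral.integral_add ((i1.add i2).add i3) (by simp),
    intervalIntegral.integral_add (i1.add i2) i3, intervalIntegral.integral_add i1 i2]
  simp only [intervalIntegral.integral_const_mul, intervalIntegral.integral_const, smul_eq_mul,
    sub_zero]
  nlinarith
lemma wk {g : ℝ → ℝ} (hg : Continuous g) {F d : ℕ → ℝ → ℝ} {B T : ℝ} (hT : 0 ≤ T)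
    (hF : ∀ n, ContinuousOn (F n) (Set.Icc 0 T))
    (hd : ∀ n, ∀ θ ∈ Set.Ioo 0 T, HasDerivAt (F n) (d n θ) θ) (hdc : ∀ n, Continuous (d n))
    (hB : ∀ n, ∫ θ in 0..T, d n θ ^ 2 ≤ B)
    (hu : ∀ ε > 0, ∃ N, ∀ n ≥ N, ∀ θ ∈ Set.Icc 0 T, |F n θ| ≤ ε) :
    Tendsto (fun n => ∫ θ in 0..T, g θ * d n θ) atTop (nhds 0) := by
  have hB0 : 0 ≤ B := le_trans (intervalIntegral.integral_nonneg hT fun _ _ => sq_nonneg _) (hB 0)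
  have hpoly : ∀ q : Polynomial ℝ,
      Tendsto (fun n => ∫ θ in 0..T, q.eval θ * d n θ) atTop (nhds 0) := by
    intro q
    obtain ⟨M, hM⟩ := (isCompact_Icc (a := (0:ℝ)) (b := T)).exists_bound_of_continuousOn
      (f := fun x => q.eval x) q.continuous.continuousOn
    obtain ⟨M', hM'⟩ := (isCompact_Icc (a := (0:ℝ)) (b := T)).exists_bound_of_continuousOn
      (f := fun x => q.derivative.eval x) q.derivative.continuous.continuousOn
    have hM0 : 0 ≤ M := (norm_nonneg _).trans (hM 0 ⟨le_rfl, hT⟩)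
    have hM0' : 0 ≤ M' := (norm_nonneg _).trans (hM' 0 ⟨le_rfl, hT⟩)
    rw [Metric.tendsto_atTop]
    intro ε hε
    obtain ⟨N, hN⟩ := hu (ε / (2 * (2 * M + M' * T + 1))) (by positivity)
    refine ⟨N, fun n hn => ?_⟩
    set e := ε / (2 * (2 * M + M' * T + 1)) with he
    have he0 : 0 < e := by positivity
    have ibp := intervalIntegral.integral_mul_deriv_eq_deriv_mul_of_hasDeriv_right
      (u := fun x => q.eval x) (v := F n) (u' := fun x => q.derivative.eval x) (v' := d n)
      (a := 0) (b := T) q.continuous.continuousOn (by rw [Set.uIcc_of_le hT]; exact hF n)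
      (fun x _ => (q.hasDerivAt x).hasDerivWithinAt)
      (fun x hx => (hd n x (by simpa [hT] using hx)).hasDerivWithinAt)
      (q.derivative.continuous.intervalIntegrable _ _) ((hdc n).intervalIntegrable _ _)
    rw [Real.dist_eq, sub_zero, ibp]
    have b1 : |q.eval T * F n T| ≤ M * e := by
      rw [abs_mul]
      exact mul_le_mul (hM T ⟨hT, le_rfl⟩) (hN n hn T ⟨hT, le_rfl⟩) (abs_nonneg _) hM0
    have b2 : |q.eval 0 * F n 0| ≤ M * e := by
      rw [abs_mul]
      exact mul_le_mul (hM 0 ⟨le_rfl, hT⟩) (hN n hn 0 ⟨le_rfl, hT⟩) (abs_nonneg _) hM0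
    have b3 : |∫ x in 0..T, q.derivative.eval x * F n x| ≤ M' * e * |T - 0| := by
      refine intervalIntegral.norm_integral_le_of_norm_le_const (f := fun x =>
        q.derivative.eval x * F n x) fun x hx => ?_
      rw [Set.uIoc_of_le hT] at hx
      rw [norm_mul]
      exact mul_le_mul (hM' x ⟨hx.1.le, hx.2⟩) (hN n hn x ⟨hx.1.le, hx.2⟩) (abs_nonneg _) hM0'
    rw [sub_zero, abs_of_nonneg hT] at b3
    have b4 : (2 * M + M' * T) * e < ε := by
      have : (2 * (2 * M + M' * T + 1)) * e = ε := by rw [he]; field_simp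
      have : 0 ≤ (2 * M + M' * T) := by positivity
      nlinarith
    rw [abs_lt]
    have := abs_le.1 b1; have := abs_le.1 b2; have := abs_le.1 b3
    constructor <;> nlinarith
  rw [Metric.tendsto_atTop]
  intro ε hε
  set η := ε / (2 * (T + B + 1)) with hη
  have hη0 : 0 < η := by positivity
  obtain ⟨q, hq⟩ := exists_polynomial_near_of_continuousOn 0 T g hg.continuousOn η hη0
  obtain ⟨N, hN⟩ := Metric.tendsto_atTop.1 (hpoly q) (ε / 2) (by positivity)
  refine ⟨N, fun n hn => ?_⟩
  have h1 := hN n hn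
  rw [Real.dist_eq, sub_zero] at h1 ⊢
  have e1 : ∫ θ in 0..T, g θ * d n θ = (∫ θ in 0..T, q.eval θ * d n θ) +
      ∫ θ in 0..T, (g θ - q.eval θ) * d n θ := by
    rw [← intervalIntegral.integral_add]
    · congr 1; ext; ring
    · exact Continuous.intervalIntegrable (by have := hdc n; fun_prop) _ _
    · exact Continuous.intervalIntegrable (by have := hdc n; fun_prop) _ _
  have h2 : |∫ θ in 0..T, (g θ - q.eval θ) * d n θ| ≤ ∫ θ in 0..T, η * (1 + d n θ ^ 2) := by
    have i1 : IntervalIntegrable (fun θ => η * (1 + d n θ ^ 2)) volume 0 T :=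
      (continuous_const.mul (continuous_const.add ((hdc n).pow 2))).intervalIntegrable _ _
    rw [← norm_eq_abs]
    refine intervalIntegral.norm_integral_le_of_norm_le hT (Eventually.of_forall fun θ hθ => ?_) i1
    rw [norm_mul, norm_eq_abs, norm_eq_abs, abs_sub_comm]
    refine mul_le_mul (hq θ ⟨hθ.1.le, hθ.2⟩).le ?_ (abs_nonneg _) hη0.le
    nlinarith [abs_nonneg (d n θ), sq_abs (d n θ), sq_nonneg (|d n θ| - 1)]
  have h3 : ∫ θ in 0..T, η * (1 + d n θ ^ 2) ≤ η * (T + B) := by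
    have i1 : IntervalIntegrable (fun θ => d n θ ^ 2) volume 0 T :=
      ((hdc n).pow 2).intervalIntegrable _ _
    rw [intervalIntegral.integral_const_mul, intervalIntegral.integral_add (by simp) i1]
    have := hB n
    simp only [intervalIntegral.integral_const, smul_eq_mul, sub_zero, mul_one]
    gcongr
  have h4 : η * (T + B) < ε / 2 := by
    have : (2 * (T + B + 1)) * η = ε := by rw [hη]; field_simp
    nlinarith
  rw [e1]
  exact (abs_add_le _ _).trans_lt (by linarith)
lemma fourier_const {D : ℝ → ℝ} (hD : ContinuousOn D (Set.Icc 0 (2 * π))) (h0 : D 0 = D (2 * π))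
    (hm : ∀ (c : ℂ) (m : ℕ), 1 ≤ m → ∫ θ in 0..2 * π, ma c m θ * D θ = 0) :
    ∀ θ ∈ Set.Icc 0 (2 * π), D θ = D 0 := by
  have hT : Fact (0 < 2 * π) := ⟨by positivity⟩
  set f : C(AddCircle (2 * π), ℂ) := ⟨AddCircle.liftIco (2 * π) 0 (fun θ => (D θ : ℂ)),
    AddCircle.liftIco_zero_continuous (by simp [h0]) (by fun_prop)⟩ with hf
  have hint : ∀ (c : ℂ) (m : ℕ), IntervalIntegrable (fun θ => ((ma c m θ * D θ : ℝ) : ℂ)) volume 0 (2 * π) :=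
    fun c m => ContinuousOn.intervalIntegrable (by
      rw [Set.uIcc_of_le two_pi_nonneg]; have := ma_cont c m; fun_prop)
  have hcm : ∀ m : ℕ, 1 ≤ m → ∫ θ in 0..2 * π, (bpt θ) ^ m * (D θ : ℂ) = 0 := by
    intro m hm1
    have e : ∀ θ : ℝ, bpt θ ^ m * (D θ : ℂ) = ((ma 1 m θ * D θ : ℝ) : ℂ) +
        ((ma (-I) m θ * D θ : ℝ) : ℂ) * I := by
      intro θ
      apply Complex.ext <;> simp [ma]
    simp_rw [e]
    rw [intervalIntegral.integral_add, intervalIntegral.integral_mul_const,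
      intervalIntegral.integral_ofReal, intervalIntegral.integral_ofReal, hm _ _ hm1, hm _ _ hm1]
    · simp
    · exact hint 1 m
    · exact (hint _ m).mul_const _
  have hcm' : ∀ m : ℕ, 1 ≤ m → ∫ θ in 0..2 * π, (starRingEnd ℂ (bpt θ)) ^ m * (D θ : ℂ) = 0 := by
    intro m hm1
    have := congrArg (starRingEnd ℂ) (hcm m hm1)
    rw [intervalIntegral.integral_of_le two_pi_nonneg, ← integral_conj,
      ← intervalIntegral.integral_of_le two_pi_nonneg] at this
    simpa using this
  have hb : ∀ θ, starRingEnd ℂ (bpt θ) = Complex.exp (-(θ * I)) := by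
    intro θ; unfold bpt; rw [← Complex.exp_conj]; simp
  have hz : ∀ n : ℤ, n ≠ 0 → fourierCoeff f n = 0 := by
    intro n hn
    have e1 := fourierCoeff_liftIco_eq (T := 2 * π) (a := 0) (fun θ => (D θ : ℂ)) n
    change fourierCoeff (AddCircle.liftIco (2 * π) 0 (fun θ => (D θ : ℂ))) n = 0
    rw [e1, fourierCoeffOn_eq_integral]
    have : ∀ x : ℝ, (fourier (-n) (x : AddCircle (0 + 2 * π - 0)) : ℂ) • (D x : ℂ) =
        Complex.exp (-n * (x * I)) * D x := by
      intro x
      rw [fourier_coe_apply, smul_eq_mul]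
      congr 2
      have : (π : ℂ) ≠ 0 := by exact_mod_cast pi_ne_zero
      push_cast; field_simp; ring
    simp_rw [this]
    rw [zero_add]
    have : ∫ x in 0..2 * π, Complex.exp (-n * (x * I)) * (D x : ℂ) = 0 := by
      rcases lt_trichotomy n 0 with h | h | h
      · obtain ⟨m, rfl⟩ := Int.exists_eq_neg_ofNat h.le
        rw [← hcm m (by omega)]
        congr 1; ext x; rw [bpt, ← Complex.exp_nat_mul]; congr 2; push_cast; ring
      · exact absurd h hn
      · obtain ⟨m, rfl⟩ := Int.eq_ofNat_of_zero_le h.le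
        rw [← hcm' m (by omega)]
        congr 1; ext x; rw [hb, ← Complex.exp_nat_mul]; congr 2; push_cast; ring
    rw [this]; simp
  have hsum : ∀ x, HasSum (fun i => fourierCoeff f i • fourier i x) (f x) :=
    has_pointwise_sum_fourier_series_of_summable
      (summable_of_ne_finset_zero (s := {0}) fun b hb => hz b (by simpa using hb))
  have hc : ∀ x, f x = fourierCoeff f 0 := by
    intro x
    have h1 := hasSum_single (f := fun i => fourierCoeff f i • fourier i x) 0
      (fun b hb => by simp [hz b hb])
    have := (hsum x).unique h1
    simpa using this
  have hI : ∀ θ ∈ Set.Ico 0 (2 * π), (D θ : ℂ) = fourierCoeff f 0 := by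
    intro θ hθ
    rw [← hc (θ : AddCircle (2 * π))]
    exact (AddCircle.liftIco_zero_coe_apply (f := fun θ => (D θ : ℂ)) hθ).symm
  have h00 := hI 0 ⟨le_rfl, by positivity⟩
  intro θ hθ
  rcases hθ.2.lt_or_eq with h | h
  · have := hI θ ⟨hθ.1, h⟩
    rw [← h00] at this; exact_mod_cast this
  · rw [h, h0]
lemma const_Ioo {f : ℝ → ℝ} {T : ℝ} (hf : ContinuousOn f (Set.Icc 0 T))
    (hd : ∀ θ ∈ Set.Ioo 0 T, HasDerivAt f 0 θ) : ∀ θ ∈ Set.Icc 0 T, f θ = f 0 := by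
  intro θ hθ
  rcases hθ.1.lt_or_eq with h | h
  · obtain ⟨c, hc, h2⟩ := exists_hasDerivAt_eq_slope f (fun _ => 0) h
      (hf.mono (Set.Icc_subset_Icc le_rfl hθ.2)) (fun x hx => hd x ⟨hx.1, hx.2.trans_le hθ.2⟩)
    have : θ - 0 ≠ 0 := by linarith
    rw [eq_div_iff this] at h2
    linarith
  · rw [← h]
lemma ode {ω ρ : ℝ → ℝ} {s2 : ℝ} (hs : 0 < s2) (hω : Continuous ω) (hρ : Continuous ρ)
    (d1 : ∀ θ ∈ Set.Ioo 0 (2 * π), HasDerivAt ω (ρ θ) θ)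
    (d2 : ∀ θ ∈ Set.Ioo 0 (2 * π), HasDerivAt ρ (NF s2 ω ρ θ) θ) :
    ∃ A B C : ℝ, 0 < A ∧ A ^ 2 - B ^ 2 - C ^ 2 = s2 ∧ ∀ θ ∈ Set.Icc 0 (2 * π),
      exp (-(ω θ) / 2) = A + B * cos θ + C * sin θ := by
  have g1 : ∀ θ, exp (ω θ / 2) * exp (-(ω θ) / 2) = 1 := fun θ => by
    rw [← exp_add]; ring_nf; simp
  have g2 : ∀ θ, exp (ω θ) = exp (ω θ / 2) ^ 2 := fun θ => by
    rw [← exp_nat_mul]; congr 1; push_cast; ring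
  have dG : ∀ θ ∈ Set.Ioo 0 (2 * π), HasDerivAt (fun t => exp (-(ω t) / 2))
      (-(1/2) * ρ θ * exp (-(ω θ) / 2)) θ := fun θ h => by
    refine HasDerivAt.congr_deriv ((d1 θ h).neg.div_const 2).exp ?_; simp only [Pi.neg_apply]; ring
  have dI : ∀ θ ∈ Set.Ioo 0 (2 * π), HasDerivAt (fun t => exp (ω t / 2))
      (1/2 * ρ θ * exp (ω θ / 2)) θ := fun θ h => by
    refine HasDerivAt.congr_deriv ((d1 θ h).div_const 2).exp ?_; ring
  set Y : ℝ → ℝ := fun θ => s2 / 2 * exp (ω θ / 2) + exp (-(ω θ) / 2) * (1/2 + 1/8 * ρ θ ^ 2)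
    with hY
  have dY : ∀ θ ∈ Set.Ioo 0 (2 * π), HasDerivAt Y 0 θ := fun θ h => by
    have := ((dI θ h).const_mul (s2 / 2)).add ((dG θ h).mul ((((d2 θ h).pow 2).const_mul (1/8)).const_add (1/2)))
    refine HasDerivAt.congr_deriv this ?_
    unfold NF
    rw [g2]
    have := g1 θ
    simp only [Nat.cast_ofNat, Pi.pow_apply]
    linear_combination (-s2/4 * ρ θ * exp (ω θ / 2) ) * this
  have cY := const_Ioo (by fun_prop : ContinuousOn Y (Set.Icc 0 (2 * π))) dY
  have hYe : ∀ θ, 2 * Y θ * exp (-(ω θ) / 2) = s2 + (-(1/2) * ρ θ * exp (-(ω θ) / 2)) ^ 2 +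
      exp (-(ω θ) / 2) ^ 2 := fun θ => by
    simp only [hY]; linear_combination s2 * g1 θ
  have dP : ∀ θ ∈ Set.Ioo 0 (2 * π), HasDerivAt (fun t => -(1/2) * ρ t * exp (-(ω t) / 2))
      (Y θ - exp (-(ω θ) / 2)) θ := fun θ h => by
    have := ((d2 θ h).const_mul (-(1/2))).mul (dG θ h)
    refine HasDerivAt.congr_deriv this ?_
    simp only [hY, NF]; rw [g2]
    linear_combination ((s2 / 2) * exp (ω θ / 2)) * g1 θ
  set A := Y 0 with hA
  set Q1 : ℝ → ℝ := fun θ => (exp (-(ω θ) / 2) - A) * cos θ -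
    (-(1/2) * ρ θ * exp (-(ω θ) / 2)) * sin θ with hQ1
  set Q2 : ℝ → ℝ := fun θ => (exp (-(ω θ) / 2) - A) * sin θ +
    (-(1/2) * ρ θ * exp (-(ω θ) / 2)) * cos θ with hQ2
  have dQ1 : ∀ θ ∈ Set.Ioo 0 (2 * π), HasDerivAt Q1 0 θ := fun θ h => by
    have := (((dG θ h).sub_const A).mul (Real.hasDerivAt_cos θ)).sub ((dP θ h).mul (Real.hasDerivAt_sin θ))
    refine HasDerivAt.congr_deriv this ?_
    rw [cY θ ⟨h.1.le, h.2.le⟩]; ring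
  have dQ2 : ∀ θ ∈ Set.Ioo 0 (2 * π), HasDerivAt Q2 0 θ := fun θ h => by
    have := (((dG θ h).sub_const A).mul (Real.hasDerivAt_sin θ)).add ((dP θ h).mul (Real.hasDerivAt_cos θ))
    refine HasDerivAt.congr_deriv this ?_
    rw [cY θ ⟨h.1.le, h.2.le⟩]; ring
  have c1 := const_Ioo (by fun_prop : ContinuousOn Q1 (Set.Icc 0 (2 * π))) dQ1
  have c2 := const_Ioo (by fun_prop : ContinuousOn Q2 (Set.Icc 0 (2 * π))) dQ2
  refine ⟨A, Q1 0, Q2 0, ?_, ?_, fun θ hθ => ?_⟩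
  · rw [hA]; simp only [hY]; positivity
  · have := hYe 0
    simp only [hQ1, hQ2, cos_zero, sin_zero]
    linear_combination this
  · have h1 := c1 θ hθ
    have h2 := c2 θ hθ
    rw [← h1, ← h2]
    simp only [hQ1, hQ2]
    linear_combination (-(exp (-(ω θ) / 2) - A)) * sin_sq_add_cos_sq θ
lemma NF_small {s2 : ℝ} (hs : 0 ≤ s2) (B C : ℝ) (hB : 0 ≤ B) {ε : ℝ} (hε : 0 < ε) :
    ∃ δ > 0, ∀ f g σ τ : ℝ → ℝ, Continuous f → Continuous g → Continuous σ → Continuous τ →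
      (∀ θ, |f θ| ≤ C) → (∀ θ, |g θ| ≤ C) → (∀ θ, |f θ - g θ| ≤ δ) →
      (∫ θ in 0..2 * π, σ θ ^ 2 ≤ B) → (∫ θ in 0..2 * π, τ θ ^ 2 ≤ B) →
      (∫ θ in 0..2 * π, (σ θ - τ θ) ^ 2 ≤ δ) →
      ∫ θ in 0..2 * π, |NF s2 f σ θ - NF s2 g τ θ| ≤ ε := by
  set η := ε / (3 * (B + 1)) with hη
  have hη0 : 0 < η := by positivity
  set δ := min (ε / 3 * (16 * η)) (ε / (3 * (2 * π * (s2 * exp C) + 1))) with hδ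
  refine ⟨δ, by positivity, ?_⟩
  intro f g σ τ hf hg hσ hτ hfC hgC he h1 h2 h3
  refine (NF_diff hf hg hσ hτ hs hfC hgC he hη0 h1 h2).trans ?_
  have b1 : η * B ≤ ε / 3 := by
    have : η * (3 * (B + 1)) = ε := by rw [hη]; field_simp
    nlinarith
  have b2 : 1 / (16 * η) * (∫ θ in 0..2 * π, (σ θ - τ θ) ^ 2) ≤ ε / 3 := by
    have := h3.trans (min_le_left _ _)
    rw [one_div_mul_eq_div, div_le_iff₀ (by positivity)]
    exact this
  have b3 : 2 * π * (s2 * exp C * δ) ≤ ε / 3 := by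
    have h4 : δ ≤ _ := min_le_right _ _
    have h5 : 0 ≤ 2 * π * (s2 * exp C) := by positivity
    rw [le_div_iff₀ (by positivity)] at h4
    have h6 : 0 < δ := by positivity
    nlinarith
  linarith
lemma sub_sq_int {σ τ : ℝ → ℝ} {B B' : ℝ} (hσ : Continuous σ) (hτ : Continuous τ)
    (h1 : ∫ θ in 0..2 * π, σ θ ^ 2 ≤ B) (h2 : ∫ θ in 0..2 * π, τ θ ^ 2 ≤ B') :
    ∫ θ in 0..2 * π, (σ θ - τ θ) ^ 2 ≤ 2 * B + 2 * B' := by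
  have i1 : IntervalIntegrable (fun θ => 2 * σ θ ^ 2) volume 0 (2 * π) :=
    Continuous.intervalIntegrable (by fun_prop) _ _
  have i2 : IntervalIntegrable (fun θ => 2 * τ θ ^ 2) volume 0 (2 * π) :=
    Continuous.intervalIntegrable (by fun_prop) _ _
  have : ∫ θ in 0..2 * π, (σ θ - τ θ) ^ 2 ≤ ∫ θ in 0..2 * π, (2 * σ θ ^ 2 + 2 * τ θ ^ 2) :=
    intervalIntegral.integral_mono_on two_pi_nonneg
      (Continuous.intervalIntegrable (by fun_prop) _ _) (i1.add i2)
      fun θ _ => by nlinarith [sq_nonneg (σ θ + τ θ)]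
  rw [intervalIntegral.integral_add i1 i2, intervalIntegral.integral_const_mul,
    intervalIntegral.integral_const_mul] at this
  linarith
lemma unif_int {g : ℝ → ℝ} (hg : Continuous g) {F : ℕ → ℝ → ℝ} {G : ℝ → ℝ}
    (hF : ∀ n, Continuous (F n)) (hG : Continuous G)
    (hu : ∀ ε > 0, ∃ N, ∀ n ≥ N, ∀ θ, |F n θ - G θ| ≤ ε) :
    Tendsto (fun n => ∫ θ in 0..2 * π, g θ * F n θ) atTop
      (nhds (∫ θ in 0..2 * π, g θ * G θ)) := by
  set M := ∫ θ in 0..2 * π, |g θ| with hM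
  have hM0 : 0 ≤ M := intervalIntegral.integral_nonneg two_pi_nonneg fun _ _ => abs_nonneg _
  rw [Metric.tendsto_atTop]
  intro ε hε
  obtain ⟨N, hN⟩ := hu (ε / (2 * (M + 1))) (by positivity)
  refine ⟨N, fun n hn => ?_⟩
  have hFn := hF n
  rw [Real.dist_eq, ← intervalIntegral.integral_sub
    (Continuous.intervalIntegrable (by fun_prop) _ _)
    (Continuous.intervalIntegrable (by fun_prop) _ _), ← norm_eq_abs]
  have i1 : IntervalIntegrable (fun θ => ε / (2 * (M + 1)) * |g θ|) volume 0 (2 * π) :=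
    Continuous.intervalIntegrable (by fun_prop) _ _
  have := intervalIntegral.norm_integral_le_of_norm_le two_pi_nonneg (μ := volume)
    (f := fun θ => g θ * F n θ - g θ * G θ) (Eventually.of_forall fun θ hθ => by
      rw [← mul_sub, norm_mul, mul_comm]
      exact mul_le_mul_of_nonneg_right (hN n hn θ) (norm_nonneg _)) i1
  rw [intervalIntegral.integral_const_mul, ← hM] at this
  refine this.trans_lt ?_
  rw [div_mul_eq_mul_div, div_lt_iff₀ (by positivity)]
  nlinarith
def cl (θ : ℝ) : ℝ := max 0 (min θ (2 * π))
lemma cl_cont : Continuous cl := by unfold cl; fun_prop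
lemma cl_mem (θ : ℝ) : cl θ ∈ Set.Icc 0 (2 * π) :=
  ⟨le_max_left _ _, max_le two_pi_nonneg (min_le_right _ _)⟩
lemma cl_eq {θ : ℝ} (h : θ ∈ Set.Icc 0 (2 * π)) : cl θ = θ := by
  unfold cl; rw [min_eq_left h.2, max_eq_right h.1]
lemma part_le {g : ℝ → ℝ} (hg : Continuous g) (θ : ℝ) :
    |∫ t in 0..cl θ, g t| ≤ ∫ t in 0..2 * π, |g t| := by
  have h := cl_mem θ
  refine (intervalIntegral.abs_integral_le_integral_abs h.1).trans ?_
  exact intervalIntegral.integral_mono_interval le_rfl h.1 h.2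
    (Eventually.of_forall fun _ => abs_nonneg _) (Continuous.intervalIntegrable (by fun_prop) _ _)
theorem oneD {f σ : ℕ → ℝ → ℝ} {ω : ℝ → ℝ} {s2 C B : ℝ} (hs : 0 < s2)
    (hf : ∀ n θ, HasDerivAt (f n) (σ n θ) θ) (hσ : ∀ n, Continuous (σ n))
    (hper : ∀ n, f n (2 * π) = f n 0) (hω : Continuous ω) (hC : ∀ n θ, |f n θ| ≤ C)
    (hu : ∀ ε > 0, ∃ N, ∀ n ≥ N, ∀ θ, |f n θ - ω θ| ≤ ε)
    (hB : ∀ n, ∫ θ in 0..2 * π, σ n θ ^ 2 ≤ B)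
    (hc : ∀ ε > 0, ∃ N, ∀ n ≥ N, ∀ m ≥ N, ∫ θ in 0..2 * π, (σ n θ - σ m θ) ^ 2 ≤ ε)
    (hm : ∀ (c : ℂ) (m : ℕ), Tendsto (fun n => ∫ θ in 0..2 * π,
      (ma c m θ * NF s2 (f n) (σ n) θ + m ^ 2 * (ma c m θ * f n θ))) atTop (nhds 0)) :
    ∃ A B C : ℝ, 0 < A ∧ A ^ 2 - B ^ 2 - C ^ 2 = s2 ∧ ∀ θ ∈ Set.Icc 0 (2 * π),
      exp (-(ω θ) / 2) = A + B * cos θ + C * sin θ := by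
  have hB0 : 0 ≤ B := le_trans (intervalIntegral.integral_nonneg two_pi_nonneg
    fun _ _ => sq_nonneg _) (hB 0)
  have hfc : ∀ n, Continuous (f n) := fun n =>
    continuous_iff_continuousAt.2 fun θ => (hf n θ).continuousAt
  have hNc : ∀ n, Continuous (NF s2 (f n) (σ n)) := fun n => by
    have := hfc n; have := hσ n; unfold NF; fun_prop
  have hωl : ∀ θ, Tendsto (fun n => f n θ) atTop (nhds (ω θ)) := fun θ => by
    rw [Metric.tendsto_atTop]; intro ε hε
    obtain ⟨N, hN⟩ := hu (ε / 2) (by positivity)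
    exact ⟨N, fun n hn => (hN n hn θ).trans_lt (by linarith)⟩
  have hωC : ∀ θ, |ω θ| ≤ C := fun θ => le_of_tendsto (hωl θ).abs (Eventually.of_forall fun n => hC n θ)
  have hω0 : ω 0 = ω (2 * π) := by
    refine tendsto_nhds_unique (hωl 0) ?_
    simp_rw [← hper]; exact hωl _
  have hNC : ∀ ε > 0, ∃ N, ∀ n ≥ N, ∀ m ≥ N,
      ∫ θ in 0..2 * π, |NF s2 (f n) (σ n) θ - NF s2 (f m) (σ m) θ| ≤ ε := by
    intro ε hε
    obtain ⟨δ, hδ, h⟩ := NF_small hs.le B C hB0 hε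
    obtain ⟨N1, h1⟩ := hu (δ / 2) (by positivity)
    obtain ⟨N2, h2⟩ := hc δ hδ
    refine ⟨max N1 N2, fun n hn m hm => h _ _ _ _ (hfc n) (hfc m) (hσ n) (hσ m) (hC n) (hC m)
      (fun θ => ?_) (hB n) (hB m) (h2 n (le_of_max_le_right hn) m (le_of_max_le_right hm))⟩
    have a1 := abs_le.1 (h1 n (le_of_max_le_left hn) θ)
    have a2 := abs_le.1 (h1 m (le_of_max_le_left hm) θ)
    rw [abs_le]; constructor <;> linarith
  set R : ℕ → ℝ → ℝ := fun n θ => ∫ t in 0..cl θ, NF s2 (f n) (σ n) t with hR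
  have hRc : ∀ n, Continuous (R n) := fun n =>
    (intervalIntegral.continuous_primitive (fun a b => (hNc n).intervalIntegrable a b) 0).comp cl_cont
  have hRC : ∀ ε > 0, ∃ N, ∀ n ≥ N, ∀ m ≥ N, ∀ θ, |R n θ - R m θ| ≤ ε := by
    intro ε hε
    obtain ⟨N, hN⟩ := hNC ε hε
    refine ⟨N, fun n hn m hm θ => ?_⟩
    simp only [hR]
    rw [← intervalIntegral.integral_sub ((hNc n).intervalIntegrable _ _)
      ((hNc m).intervalIntegrable _ _)]
    exact (part_le ((hNc n).sub (hNc m)) θ).trans (hN n hn m hm)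
  have hlim : ∀ θ, ∃ l, Tendsto (fun n => R n θ) atTop (nhds l) := fun θ => by
    refine cauchySeq_tendsto_of_complete (Metric.cauchySeq_iff.2 fun ε hε => ?_)
    obtain ⟨N, hN⟩ := hRC (ε / 2) (by positivity)
    exact ⟨N, fun m hm n hn => (hN m hm n hn θ).trans_lt (by linarith)⟩
  choose RR hRR using hlim
  have hRu : ∀ ε > 0, ∃ N, ∀ n ≥ N, ∀ θ, |R n θ - RR θ| ≤ ε := by
    intro ε hε
    obtain ⟨N, hN⟩ := hRC ε hε
    refine ⟨N, fun n hn θ => ?_⟩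
    exact le_of_tendsto ((tendsto_const_nhds.sub (hRR θ)).abs)
      (eventually_atTop.2 ⟨N, fun m hm => hN n hn m hm θ⟩)
  have hRRc : Continuous RR := by
    have : TendstoUniformly R RR atTop := by
      rw [Metric.tendstoUniformly_iff]
      intro ε hε
      obtain ⟨N, hN⟩ := hRu (ε / 2) (by positivity)
      refine eventually_atTop.2 ⟨N, fun n hn θ => ?_⟩
      rw [Real.dist_eq, abs_sub_comm]
      exact (hN n hn θ).trans_lt (by linarith)
    exact this.continuous (Frequently.of_forall hRc)
  have h2pi : (2 * π) ∈ Set.Icc 0 (2 * π) := ⟨two_pi_nonneg, le_rfl⟩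
  have hR2 : Tendsto (fun n => R n (2 * π)) atTop (nhds 0) := by
    have := hm 1 0
    refine this.congr fun n => ?_
    simp only [hR, cl_eq h2pi]
    congr 1; ext θ; simp [ma]
  have hmo : ∀ (c : ℂ) (m : ℕ), 1 ≤ m → (∫ θ in 0..2 * π, mb c m θ * RR θ) +
      m * ∫ θ in 0..2 * π, ma c m θ * ω θ = 0 := by
    intro c m hm1
    have cma := ma_cont c m
    have cmb := mb_cont c m
    have e1 : ∀ n, (∫ θ in 0..2 * π,
      (ma c m θ * NF s2 (f n) (σ n) θ + m ^ 2 * (ma c m θ * f n θ))) =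
        ma c m 0 * R n (2 * π) + m * (∫ θ in 0..2 * π, mb c m θ * R n θ) +
          m ^ 2 * ∫ θ in 0..2 * π, ma c m θ * f n θ := by
      intro n
      have c1 := hNc n
      have c2 := hfc n
      have c3 := hRc n
      rw [intervalIntegral.integral_add (Continuous.intervalIntegrable (by fun_prop) _ _)
        (Continuous.intervalIntegrable (by fun_prop) _ _), intervalIntegral.integral_const_mul]
      congr 1
      have ibp := intervalIntegral.integral_mul_deriv_eq_deriv_mul (a := 0) (b := 2 * π)
        (u := ma c m) (v := fun θ => ∫ t in 0..θ, NF s2 (f n) (σ n) t)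
        (u' := fun θ => -(m * mb c m θ)) (v' := NF s2 (f n) (σ n))
        (fun θ _ => ma_der c m θ) (fun θ _ => (hNc n).integral_hasStrictDerivAt 0 θ |>.hasDerivAt)
        (Continuous.intervalIntegrable (by fun_prop) _ _)
        (Continuous.intervalIntegrable (by fun_prop) _ _)
      rw [ibp, ma_two_pi]
      have : R n (2 * π) = ∫ t in 0..2 * π, NF s2 (f n) (σ n) t := by
        simp only [hR, cl_eq h2pi]
      rw [this]
      have e3 : ∫ θ in 0..2 * π, -(m * mb c m θ) * ∫ t in 0..θ, NF s2 (f n) (σ n) t =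
          ∫ θ in 0..2 * π, (-m : ℝ) * (mb c m θ * R n θ) := by
        refine intervalIntegral.integral_congr fun θ hθ => ?_
        rw [Set.uIcc_of_le two_pi_nonneg] at hθ
        simp only [hR, cl_eq hθ]; ring
      rw [e3, intervalIntegral.integral_const_mul]
      simp
    have l1 := ((hR2.const_mul (ma c m 0)).add ((unif_int cmb hRc hRRc hRu).const_mul (m:ℝ))).add
      ((unif_int cma hfc hω hu).const_mul ((m:ℝ) ^ 2))
    have l2 := (hm c m).congr e1
    have := tendsto_nhds_unique l1 l2
    have hm0 : (m:ℝ) ≠ 0 := by positivity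
    apply mul_left_cancel₀ hm0
    linear_combination this
  set Rb := (∫ θ in 0..2 * π, RR θ) / (2 * π) with hRb
  set ρ : ℝ → ℝ := fun θ => RR θ - Rb with hρ
  have hρc : Continuous ρ := by fun_prop
  set S : ℝ → ℝ := fun θ => ∫ t in 0..θ, ρ t with hS
  have dS : ∀ θ, HasDerivAt S (ρ θ) θ := fun θ => (hρc.integral_hasStrictDerivAt 0 θ).hasDerivAt
  have hSc : Continuous S := continuous_iff_continuousAt.2 fun θ => (dS θ).continuousAt
  have hS0 : S 0 = 0 := by simp [hS]
  have hS2 : S (2 * π) = 0 := by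
    simp only [hS, hρ]
    rw [intervalIntegral.integral_sub (hRRc.intervalIntegrable _ _) (by simp)]
    have := pi_pos
    simp [hRb]
  have hDc := fourier_const (D := fun θ => ω θ - S θ) (by fun_prop) (by simp [hS0, hS2, hω0])
    fun c m hm1 => by
      have cma := ma_cont c m
      have cmb := mb_cont c m
      have hm0 : (m:ℝ) ≠ 0 := by positivity
      have ibp := intervalIntegral.integral_mul_deriv_eq_deriv_mul (a := 0) (b := 2 * π)
        (u := mb c m) (v := S) (u' := fun θ => m * ma c m θ) (v' := ρ)
        (fun θ _ => mb_der c m θ) (fun θ _ => dS θ)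
        (Continuous.intervalIntegrable (by fun_prop) _ _)
        (Continuous.intervalIntegrable (by fun_prop) _ _)
      have z : ∫ θ in 0..2 * π, -(m * mb c m θ) = 0 := by
        rw [intervalIntegral.integral_eq_sub_of_hasDerivAt (fun θ _ => ma_der c m θ)
          (Continuous.intervalIntegrable (by fun_prop) _ _), ma_two_pi, sub_self]
      rw [intervalIntegral.integral_neg, intervalIntegral.integral_const_mul, neg_eq_zero,
        mul_eq_zero, or_iff_right hm0] at z
      have e1 : ∫ θ in 0..2 * π, mb c m θ * ρ θ = ∫ θ in 0..2 * π, mb c m θ * RR θ := by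
        simp only [hρ, mul_sub]
        rw [intervalIntegral.integral_sub (Continuous.intervalIntegrable (by fun_prop) _ _)
          (Continuous.intervalIntegrable (by fun_prop) _ _), intervalIntegral.integral_mul_const, z]
        simp
      rw [e1, hS0, hS2] at ibp
      simp only [mul_assoc] at ibp
      rw [intervalIntegral.integral_const_mul] at ibp
      have h := hmo c m hm1
      simp only [mul_sub]
      rw [intervalIntegral.integral_sub (Continuous.intervalIntegrable (by fun_prop) _ _)
          (Continuous.intervalIntegrable (by fun_prop) _ _)]
      apply mul_left_cancel₀ hm0
      linear_combination h - ibp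
  have dω : ∀ θ ∈ Set.Ioo 0 (2 * π), HasDerivAt ω (ρ θ) θ := by
    intro θ hθ
    have h1 : HasDerivAt (fun t => S t + (ω 0 - S 0)) (ρ θ) θ := (dS θ).add_const _
    refine h1.congr_of_eventuallyEq ?_
    filter_upwards [Ioo_mem_nhds hθ.1 hθ.2] with t ht
    have := hDc t ⟨ht.1.le, ht.2.le⟩
    linarith
  set B' := ∫ θ in 0..2 * π, ρ θ ^ 2 with hB'
  have hB'0 : 0 ≤ B' := intervalIntegral.integral_nonneg two_pi_nonneg fun _ _ => sq_nonneg _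
  have hL2 : ∀ ε > 0, ∃ N, ∀ n ≥ N, ∫ θ in 0..2 * π, (σ n θ - ρ θ) ^ 2 ≤ ε := by
    intro ε hε
    obtain ⟨N, hN⟩ := hc ε hε
    refine ⟨N, fun n hn => ?_⟩
    have cn := hσ n
    have hw := wk (g := fun θ => σ n θ - ρ θ) (by fun_prop) (F := fun m θ => f m θ - ω θ)
      (d := fun m θ => σ m θ - ρ θ) (B := 2 * B + 2 * B') two_pi_nonneg
      (fun m => ((hfc m).sub hω).continuousOn) (fun m θ hθ => (hf m θ).sub (dω θ hθ))
      (fun m => (hσ m).sub hρc) (fun m => sub_sq_int (hσ m) hρc (hB m) le_rfl)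
      (fun ε hε => by
        obtain ⟨N, hN⟩ := hu ε hε
        exact ⟨N, fun n hn θ _ => hN n hn θ⟩)
    have hineq : ∀ m ≥ N, ∫ θ in 0..2 * π, (σ n θ - ρ θ) ^ 2 ≤
        ε + 2 * ∫ θ in 0..2 * π, (σ n θ - ρ θ) * (σ m θ - ρ θ) := by
      intro m hmN
      have cm := hσ m
      have h1 := hN n hn m hmN
      have : ∫ θ in 0..2 * π, (σ n θ - ρ θ) ^ 2 ≤ ∫ θ in 0..2 * π, ((σ n θ - σ m θ) ^ 2 +
          2 * ((σ n θ - ρ θ) * (σ m θ - ρ θ))) := by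
        refine intervalIntegral.integral_mono_on two_pi_nonneg
          (Continuous.intervalIntegrable (by fun_prop) _ _)
          (Continuous.intervalIntegrable (by fun_prop) _ _) fun θ _ => ?_
        nlinarith [sq_nonneg (σ m θ - ρ θ)]
      rw [intervalIntegral.integral_add (Continuous.intervalIntegrable (by fun_prop) _ _)
        (Continuous.intervalIntegrable (by fun_prop) _ _), intervalIntegral.integral_const_mul] at this
      linarith
    have hl := (hw.const_mul 2).const_add ε
    rw [mul_zero, add_zero] at hl
    exact ge_of_tendsto hl (eventually_atTop.2 ⟨N, hineq⟩)
  have hNlc : Continuous (NF s2 ω ρ) := by unfold NF; fun_prop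
  have hRfin : ∀ θ ∈ Set.Icc 0 (2 * π), RR θ = ∫ t in 0..θ, NF s2 ω ρ t := by
    intro θ hθ
    refine tendsto_nhds_unique (hRR θ) ?_
    rw [Metric.tendsto_atTop]
    intro ε hε
    obtain ⟨δ, hδ, h⟩ := NF_small hs.le (B + B') C (by positivity) (ε := ε / 2) (by positivity)
    obtain ⟨N1, h1⟩ := hu δ hδ
    obtain ⟨N2, h2⟩ := hL2 δ hδ
    refine ⟨max N1 N2, fun n hn => ?_⟩
    have := h _ _ _ _ (hfc n) hω (hσ n) hρc (hC n) hωC (h1 n (le_of_max_le_left hn))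
      ((hB n).trans (by linarith)) (by linarith) (h2 n (le_of_max_le_right hn))
    rw [Real.dist_eq]
    simp only [hR]
    rw [cl_eq hθ, ← intervalIntegral.integral_sub ((hNc n).intervalIntegrable _ _)
      (hNlc.intervalIntegrable _ _)]
    have h3 := part_le ((hNc n).sub hNlc) θ
    rw [cl_eq hθ] at h3
    exact (h3.trans this).trans_lt (by linarith)
  refine ode hs hω hρc dω fun θ hθ => ?_
  have h1 : HasDerivAt (fun t => (∫ t in 0..t, NF s2 ω ρ t) - Rb) (NF s2 ω ρ θ) θ :=
    ((hNlc.integral_hasStrictDerivAt 0 θ).hasDerivAt).sub_const _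
  refine h1.congr_of_eventuallyEq ?_
  filter_upwards [Ioo_mem_nhds hθ.1 hθ.2] with t ht
  simp only [hρ]
  rw [hRfin t ⟨ht.1.le, ht.2.le⟩]
lemma cauchy2 (C h k : ℝ) (hC : 0 ≤ C) (hk : k ≤ 0) {ε : ℝ} (hε : 0 < ε) : ∃ δ > 0,
    ∀ w z : ℂ → ℝ, BF C w → BF C z → ∫ x in oD, |dE k w x| ≤ δ → ∫ x in oD, |dE k z x| ≤ δ →
      bint (fun x => |dN h w x|) ≤ δ → bint (fun x => |dN h z x|) ≤ δ →
      bint (fun x => |w x - z x|) ≤ δ →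
      bint (fun x => tderiv (fun y => w y - z y) x ^ 2) ≤ ε := by
  have hv := vD_nonneg
  set η := ε / (2 * (4 * C * vD + 1)) with hη
  have hη0 : 0 < η := by positivity
  set Q := 2 * C * (|h| * exp (C / 2) + 2) + 4 * C * (1 / (4 * η) * (6 * C)) with hQ
  have hQ0 : 0 ≤ Q := by positivity
  refine ⟨ε / (2 * (Q + 1)), by positivity, fun w z hw hz h1 h2 h3 h4 h5 => ?_⟩
  set δ := ε / (2 * (Q + 1)) with hδ
  have hδ0 : 0 < δ := by positivity
  have c1 := comp1 hk hw hz
  have hn : 0 ≤ ∫ x in oD, (w x - z x) ^ 2 := integral_nonneg fun _ => sq_nonneg _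
  have hn2 : 0 ≤ 2 * (-k) * exp (-C) * ∫ x in oD, (w x - z x) ^ 2 := by
    have : 0 ≤ -k := by linarith
    positivity
  have g1 : ∫ x in oD, gradSq (fun y => w y - z y) x ≤ 6 * C * δ := by
    have : 2 * C * ((∫ x in oD, |dE k w x|) + ∫ x in oD, |dE k z x|) ≤ 2 * C * (δ + δ) := by gcongr
    have : 2 * C * bint (fun x => |w x - z x|) ≤ 2 * C * δ := by gcongr
    linarith
  have c2 := comp2 (h := h) hw hz hη0
  refine c2.trans ?_
  calc _ ≤ 2 * C * (|h| * exp (C / 2) * δ + (δ + δ)) +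
        4 * C * (η * vD + 1 / (4 * η) * (6 * C * δ)) := by gcongr
    _ = Q * δ + (4 * C * vD) * η := by rw [hQ]; ring
    _ ≤ ε / 2 + ε / 2 := by
        refine add_le_add ?_ ?_
        · rw [hδ, mul_div_assoc', div_le_div_iff₀ (by positivity) (by positivity)]; nlinarith
        · have : (4 * C * vD + 1) * η = ε / 2 := by rw [hη]; field_simp
          nlinarith
    _ = ε := by ring
lemma bint_le_sup (hf : ContinuousOn f cD) {e : ℝ} (h : ∀ θ, |f (bpt θ)| ≤ e) :
    bint (fun x => |f x|) ≤ 2 * π * e := by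
  rw [← bconst]; exact bmono (by fun_prop) (by fun_prop) h
lemma exists_rep (θ : ℝ) : ∃ t ∈ Set.Icc 0 (2 * π), bpt t = bpt θ := by
  have hp : Function.Periodic bpt (2 * π) := bpt_add_two_pi
  obtain ⟨y, hy, h⟩ := hp.exists_mem_Ico₀ (by positivity) θ
  exact ⟨y, ⟨hy.1, hy.2.le⟩, h.symm⟩
theorem AS.trace {k h C : ℝ} {w : ℕ → ℂ → ℝ} (hw : AS k h C w) (hk : k ≤ 0)
    (hs : 0 < h ^ 2 + k) : ∃ φ : ℕ → ℕ, StrictMono φ ∧ ∃ A B B' : ℝ, 0 < A ∧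
      A ^ 2 - B ^ 2 - B' ^ 2 = h ^ 2 + k ∧ ∀ ε > 0, ∃ N, ∀ n ≥ N, ∀ θ,
      |w (φ n) (bpt θ) - -2 * log (A + B * (bpt θ).re + B' * (bpt θ).im)| ≤ ε := by
  have hC0 := (hw.bf 0).nonneg
  obtain ⟨φ, hφ, ω, hω, hu⟩ := arzela (f := fun n => tr (w n)) (C := C) (B := (1 + BB C) / 2)
    (fun n θ => by simp only [tr, bpt_add_two_pi]) (fun n θ => (hw.bf n).bd _ (bpt_mem θ))
    (fun n => tr_cont (hw.bf n).sm.s1.cont)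
    (fun n a b hab hb => holder_trace (hw.bf n).sm (hw.bf n).te hab hb)
  have hw' := hw.comp hφ
  have hcont : ∀ n, Continuous (fun θ => tderiv (w (φ n)) (bpt θ)) := fun n =>
    cont_b (hw.bf _).sm.s1.tderiv_cont
  obtain ⟨A, B, B', hA, hAB, hf⟩ := oneD (f := fun n => tr (w (φ n)))
    (σ := fun n θ => tderiv (w (φ n)) (bpt θ)) (ω := ω) (C := C) (B := BB C) hs
    (fun n θ => bpt_deriv_comp (hw.bf _).sm.s1 θ) hcont
    (fun n => by simp only [tr, bpt_two_pi, bpt_zero]) hω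
    (fun n θ => (hw.bf _).bd _ (bpt_mem θ)) hu (fun n => (hw.bf _).te) (fun ε hε => by
      obtain ⟨δ, hδ, H⟩ := cauchy2 C h k hC0 hk hε
      obtain ⟨N1, h1⟩ := Metric.tendsto_atTop.1 hw'.e δ hδ
      obtain ⟨N2, h2⟩ := Metric.tendsto_atTop.1 hw'.n δ hδ
      obtain ⟨N3, h3⟩ := hu (δ / (4 * π)) (by positivity)
      refine ⟨max N1 (max N2 N3), fun n hn m hm => ?_⟩
      have a1 := le_of_max_le_left hn
      have a2 := le_of_max_le_left (le_of_max_le_right hn)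
      have a3 := le_of_max_le_right (le_of_max_le_right hn)
      have b1 := le_of_max_le_left hm
      have b2 := le_of_max_le_left (le_of_max_le_right hm)
      have b3 := le_of_max_le_right (le_of_max_le_right hm)
      have q : ∀ {t : ℝ}, dist t 0 < δ → t ≤ δ := fun {t} ht => by
        rw [Real.dist_eq, sub_zero] at ht; exact (le_abs_self t).trans ht.le
      have := H _ _ (hw.bf (φ n)) (hw.bf (φ m)) (q (h1 n a1)) (q (h1 m b1)) (q (h2 n a2))
        (q (h2 m b2)) (by
          refine (bint_le_sup (e := δ / (2 * π))
            ((hw.bf _).sm.s1.cont.sub (hw.bf _).sm.s1.cont) fun θ => ?_).trans ?_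
          · have u1 := abs_le.1 (h3 n a3 θ)
            have u2 := abs_le.1 (h3 m b3 θ)
            simp only [tr] at u1 u2
            have e : δ / (2 * π) = δ / (4 * π) + δ / (4 * π) := by field_simp; norm_num
            show |w (φ n) (bpt θ) - w (φ m) (bpt θ)| ≤ _
            rw [abs_le]; constructor <;> linarith
          · have := pi_pos
            apply le_of_eq; field_simp)
      refine le_trans (le_of_eq ?_) this
      unfold bint
      congr 1; ext θ
      beta_reduce
      rw [tderiv_sub (hw.bf _).sm.s1 (hw.bf _).sm.s1 (bpt_mem θ)])
    (fun c m => hw'.moment c m)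
  refine ⟨φ, hφ, A, B, B', hA, hAB, fun ε hε => ?_⟩
  obtain ⟨N, hN⟩ := hu ε hε
  refine ⟨N, fun n hn θ => ?_⟩
  obtain ⟨t, ht, hte⟩ := exists_rep θ
  rw [← hte]
  have h1 := hN n hn t
  have h2 := hf t ht
  have h3 : -2 * log (A + B * (bpt t).re + B' * (bpt t).im) = ω t := by
    rw [bpt_re, bpt_im, ← h2, log_exp]; ring
  rw [h3]; exact h1
lemma int_lap (hw : S2 w) : ∫ x in oD, lap w x = bint (nderiv w) := by
  have h := greenA (φ := fun _ => 1) (fun x _ => contDiffAt_const) hw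
  have e : ∀ v x : ℂ, pd (fun _ => (1:ℝ)) v x = 0 := by intro v x; simp [pd]
  simpa [e] using h
lemma AS.hpos {k h C : ℝ} {w : ℕ → ℂ → ℝ} (hw : AS k h C w) (hk : k < 0) : 0 < h := by
  by_contra hh
  push Not at hh
  have hp := pi_pos
  obtain ⟨N1, h1⟩ := Metric.tendsto_atTop.1 hw.e π hp
  obtain ⟨N2, h2⟩ := Metric.tendsto_atTop.1 hw.n π hp
  have a1 := h1 (max N1 N2) (le_max_left _ _)
  have a2 := h2 (max N1 N2) (le_max_right _ _)
  have sm := (hw.bf (max N1 N2)).sm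
  generalize w (max N1 N2) = w at *
  rw [Real.dist_eq, sub_zero] at a1 a2
  have c1 := sm.s1.cont
  have cE := sm.dE_cont k
  have cN := sm.dN_cont h
  have e1 : ∫ x in oD, lap w x = (∫ x in oD, dE k w x) - ∫ x in oD, 2 * k * exp (w x) := by
    rw [← dsub cE (by fun_prop)]; exact dcongr fun x _ => by unfold dE; ring
  have e2 : bint (nderiv w) = bint (fun x => dN h w x) + bint (fun x => 2 * h * exp (w x / 2) - 2) := by
    rw [← badd cN (by fun_prop)]; exact bcongr fun x => by unfold dN; ring
  have e3 := int_lap sm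
  have u1 : ∫ x in oD, 2 * k * exp (w x) ≤ 0 :=
    integral_nonpos fun x => by
      have := exp_pos (w x)
      show _ ≤ (0:ℝ)
      nlinarith
  have u2 : bint (fun x => 2 * h * exp (w x / 2) - 2) ≤ bint (fun _ => -2) :=
    bmono (by fun_prop) (by fun_prop) fun θ => by nlinarith [exp_pos (w (bpt θ) / 2)]
  rw [bconst] at u2
  have u3 := dabs cE cE.abs fun x _ => le_rfl
  have u4 := babs cN cN.abs fun x => le_rfl
  have := (abs_le.1 u3).1
  have := (abs_le.1 u4).2
  have := (abs_lt.1 a1).2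
  have := (abs_lt.1 a2).2
  linarith
def gg (A B B' h : ℝ) (x : ℂ) : ℝ :=
  (A + h) / 2 + (A - h) / 2 * (x.re ^ 2 + x.im ^ 2) + B * x.re + B' * x.im
def VV (A B B' h : ℝ) (x : ℂ) : ℝ := -2 * log (gg A B B' h x)
lemma gg_cd (A B B' h : ℝ) : ContDiff ℝ 3 (gg A B B' h) := by
  have h1 : ContDiff ℝ 3 (fun x : ℂ => x.re) := reCLM.contDiff
  have h2 : ContDiff ℝ 3 (fun x : ℂ => x.im) := imCLM.contDiff
  unfold gg; fun_prop
lemma pd_re (v x : ℂ) : pd (fun y => y.re) v x = v.re := by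
  simpa using vf_id.re_pd x v
lemma pd_im (v x : ℂ) : pd (fun y => y.im) v x = v.im := by
  simpa using vf_id.im_pd x v
lemma gg_pd (A B B' h : ℝ) (v x : ℂ) : pd (gg A B B' h) v x =
    (A - h) * (x.re * v.re + x.im * v.im) + B * v.re + B' * v.im := by
  have h1 : HasFDerivAt (fun x : ℂ => x.re) reCLM x := reCLM.hasFDerivAt
  have h2 : HasFDerivAt (fun x : ℂ => x.im) imCLM x := imCLM.hasFDerivAt
  have h3 := ((((h1.pow 2).add (h2.pow 2)).const_mul ((A - h) / 2)).const_add ((A + h) / 2)).add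
    (h1.const_mul B) |>.add (h2.const_mul B')
  have h4 : fderiv ℝ (gg A B B' h) x = _ := h3.fderiv
  unfold pd; rw [h4]; simp; ring
lemma gg_pos {A B B' h s : ℝ} (hA : 0 < A) (hs : 0 < s) (hAB : A ^ 2 - B ^ 2 - B' ^ 2 = s)
    (hh : 0 < h) (hx : x ∈ cD) : 0 < gg A B B' h x := by
  have h1 := disk_sq hx
  set ρ := x.re ^ 2 + x.im ^ 2 with hρ
  have hρ0 : 0 ≤ ρ := by positivity
  have h2 : (B * x.re + B' * x.im) ^ 2 ≤ (B ^ 2 + B' ^ 2) * ρ := by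
    nlinarith [sq_nonneg (B * x.im - B' * x.re)]
  have h3 : ρ ≤ ((1 + ρ) / 2) ^ 2 := by nlinarith [sq_nonneg (1 - ρ)]
  have h4 : (B * x.re + B' * x.im) ^ 2 < (A * ((1 + ρ) / 2)) ^ 2 := by
    have : (B ^ 2 + B' ^ 2) * ρ ≤ (B ^ 2 + B' ^ 2) * ((1 + ρ) / 2) ^ 2 := by gcongr
    have : 0 < s * ((1 + ρ) / 2) ^ 2 := by positivity
    nlinarith
  have h5 := (abs_lt.1 (abs_lt_of_sq_lt_sq h4 (by positivity))).1
  unfold gg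
  rw [← hρ]
  nlinarith
section
variable {A B B' h : ℝ}
lemma VV_cd (hx : 0 < gg A B B' h x) : ContDiffAt ℝ 2 (VV A B B' h) x :=
  contDiffAt_const.mul (((gg_cd A B B' h).contDiffAt.of_le (by norm_num)).log hx.ne')
lemma gg_diff (x : ℂ) : DifferentiableAt ℝ (gg A B B' h) x :=
  (gg_cd A B B' h).contDiffAt.differentiableAt (by norm_num)
lemma VV_pd (hx : 0 < gg A B B' h x) (v : ℂ) :
    pd (VV A B B' h) v x = -2 * ((gg A B B' h x)⁻¹ * pd (gg A B B' h) v x) := by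
  have hd := gg_diff (A := A) (B := B) (B' := B') (h := h) x
  have := pd_comp (Real.hasDerivAt_log hx.ne') hd v
  rw [← this]
  exact pd_cmul (-2) (hd.log hx.ne') v
lemma VV_pd2 (hx : 0 < gg A B B' h x) (v : ℂ) :
    pd (fun y => pd (VV A B B' h) v y) v x = -2 * ((gg A B B' h x)⁻¹ *
      ((A - h) * (v.re ^ 2 + v.im ^ 2)) - (gg A B B' h x)⁻¹ ^ 2 * pd (gg A B B' h) v x ^ 2) := by
  have hd := gg_diff (A := A) (B := B) (B' := B') (h := h) x
  have e : (fun y => pd (VV A B B' h) v y) =ᶠ[nhds x]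
      fun y => -2 * ((gg A B B' h y)⁻¹ * pd (gg A B B' h) v y) := by
    filter_upwards [hd.continuousAt.eventually (lt_mem_nhds hx)] with y hy using VV_pd hy v
  rw [pd_congr e]
  have e2 : (fun y => pd (gg A B B' h) v y) = gg (B * v.re + B' * v.im) ((A-h)*v.re) ((A-h)*v.im) (B * v.re + B' * v.im) := by
    ext y; rw [gg_pd]; unfold gg; ring
  have d2 : DifferentiableAt ℝ (fun y => pd (gg A B B' h) v y) x := by rw [e2]; exact gg_diff x
  have d1 : DifferentiableAt ℝ (fun y => (gg A B B' h y)⁻¹) x := hd.inv hx.ne'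
  have d3 : DifferentiableAt ℝ (fun y => (gg A B B' h y)⁻¹ * pd (gg A B B' h) v y) x := d1.mul d2
  rw [pd_cmul _ d3, pd_mul d1 d2, e2, gg_pd]
  have := pd_comp (f := gg A B B' h) (hasDerivAt_inv hx.ne') hd v
  rw [this]
  ring
lemma VV_lap (hx : 0 < gg A B B' h x) : lap (VV A B B' h) x =
    -2 * (A ^ 2 - B ^ 2 - B' ^ 2 - h ^ 2) * (gg A B B' h x)⁻¹ ^ 2 := by
  have h1 := VV_pd2 hx 1
  have h2 := VV_pd2 hx I
  have : lap (VV A B B' h) x = pd (fun y => pd (VV A B B' h) 1 y) 1 x +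
    pd (fun y => pd (VV A B B' h) I y) I x := rfl
  rw [this, h1, h2, gg_pd, gg_pd]
  simp only [one_re, Complex.one_im, Complex.I_re, Complex.I_im]
  have hne := hx.ne'
  have e : gg A B B' h x = (A + h) / 2 + (A - h) / 2 * (x.re ^ 2 + x.im ^ 2) + B * x.re + B' * x.im := rfl
  have : (gg A B B' h x)⁻¹ = (gg A B B' h x)⁻¹ ^ 2 * gg A B B' h x := by field_simp
  generalize (gg A B B' h x)⁻¹ = q at *
  rw [e] at this
  generalize q ^ 2 = q2 at *
  subst this
  ring
lemma VV_exp (hx : 0 < gg A B B' h x) : exp (VV A B B' h x) = (gg A B B' h x)⁻¹ ^ 2 := by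
  unfold VV
  have : -2 * log (gg A B B' h x) = -(log (gg A B B' h x) + log (gg A B B' h x)) := by ring
  rw [this, exp_neg, exp_add, exp_log hx]
  field_simp
lemma VV_exp2 (hx : 0 < gg A B B' h x) : exp (VV A B B' h x / 2) = (gg A B B' h x)⁻¹ := by
  unfold VV
  have : -2 * log (gg A B B' h x) / 2 = -(log (gg A B B' h x)) := by ring
  rw [this, exp_neg, exp_log hx]
lemma VV_dE (hg : ∀ x ∈ cD, 0 < gg A B B' h x) {k : ℝ} (hk : A ^ 2 - B ^ 2 - B' ^ 2 = h ^ 2 + k) (hx : x ∈ cD) :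
    dE k (VV A B B' h) x = 0 := by
  unfold dE; rw [VV_lap (hg x hx), VV_exp (hg x hx)]
  linear_combination -2 * (gg A B B' h x)⁻¹ ^ 2 * hk
lemma gg_bpt (θ : ℝ) : gg A B B' h (bpt θ) = A + B * (bpt θ).re + B' * (bpt θ).im := by
  unfold gg; rw [bpt_sq]; ring
lemma VV_dN (hg : ∀ x ∈ cD, 0 < gg A B B' h x) (θ : ℝ) : dN h (VV A B B' h) (bpt θ) = 0 := by
  have hx := hg _ (bpt_mem θ)
  unfold dN; rw [nderiv_eq, VV_pd hx, VV_exp2 hx, gg_pd]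
  have e : (A - h) * ((bpt θ).re * (bpt θ).re + (bpt θ).im * (bpt θ).im) + B * (bpt θ).re + B' * (bpt θ).im
    = gg A B B' h (bpt θ) - h := by rw [gg_bpt]; linear_combination (A - h) * bpt_sq θ
  rw [e]; have := hx.ne'; field_simp; ring
lemma VV_S2 (hg : ∀ x ∈ cD, 0 < gg A B B' h x) : S2 (VV A B B' h) := fun x hx => VV_cd (hg x hx)
end
lemma S2.bf (hw : S2 w) : ∃ C, BF C w := by
  have K : IsCompact cD := isCompact_closedBall _ _
  obtain ⟨C1, h1⟩ := K.exists_bound_of_continuousOn hw.s1.cont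
  obtain ⟨C2, h2⟩ := K.exists_bound_of_continuousOn hw.lap_cont
  obtain ⟨C3, h3⟩ := K.exists_bound_of_continuousOn hw.s1.nderiv_cont
  refine ⟨max C1 (max C2 C3), hw, fun x hx => (h1 x hx).trans (le_max_left _ _),
    fun x hx => (h2 x (oD_sub hx)).trans (by simp), fun θ => (h3 _ (bpt_mem θ)).trans (by simp)⟩
lemma BF.mono {C C' : ℝ} (h : BF C w) (hC : C ≤ C') : BF C' w :=
  ⟨h.sm, fun x hx => (h.bd x hx).trans hC, fun x hx => (h.lp x hx).trans hC,
    fun θ => (h.nd θ).trans hC⟩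
theorem AS.limit {k h C : ℝ} {w : ℕ → ℂ → ℝ} (hw : AS k h C w) (hk : k < 0)
    (hs : 0 < h ^ 2 + k) : 0 < h ∧ ∃ φ : ℕ → ℕ, StrictMono φ ∧ ∃ A B B' : ℝ, 0 < A ∧
      A ^ 2 - B ^ 2 - B' ^ 2 = h ^ 2 + k ∧ (∀ x ∈ cD, 0 < gg A B B' h x) ∧
      (∀ ε > 0, ∃ N, ∀ n ≥ N, ∀ θ, |w (φ n) (bpt θ) - VV A B B' h (bpt θ)| ≤ ε) ∧
      Tendsto (fun n => ∫ x in oD, (w (φ n) x - VV A B B' h x) ^ 2) atTop (nhds 0) := by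
  have hh := hw.hpos hk
  obtain ⟨φ, hφ, A, B, B', hA, hAB, hu⟩ := hw.trace hk.le hs
  have hg : ∀ x ∈ cD, 0 < gg A B B' h x := fun x hx => gg_pos hA hs hAB hh hx
  have hu' : ∀ ε > 0, ∃ N, ∀ n ≥ N, ∀ θ, |w (φ n) (bpt θ) - VV A B B' h (bpt θ)| ≤ ε := by
    intro ε hε
    obtain ⟨N, hN⟩ := hu ε hε
    refine ⟨N, fun n hn θ => ?_⟩
    have := hN n hn θ
    unfold VV; rwa [gg_bpt]
  refine ⟨hh, φ, hφ, A, B, B', hA, hAB, hg, hu', ?_⟩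
  have hS := VV_S2 hg
  obtain ⟨C1, hC1⟩ := hS.bf
  set C' := max C C1
  have b1 := hC1.mono (le_max_right C C1)
  have b2 := fun n => (hw.bf (φ n)).mono (le_max_left C C1)
  have hC' : 0 ≤ C' := b1.nonneg
  have z : ∫ x in oD, |dE k (VV A B B' h) x| = 0 := by
    rw [dcongr (g := fun _ => 0) fun x hx => by rw [VV_dE hg hAB (oD_sub hx), abs_zero]]; simp
  have tb : Tendsto (fun n => bint (fun x => |w (φ n) x - VV A B B' h x|)) atTop (nhds 0) := by
    rw [Metric.tendsto_atTop]
    intro ε hε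
    obtain ⟨N, hN⟩ := hu' (ε / (4 * π)) (by positivity)
    refine ⟨N, fun n hn => ?_⟩
    have h1 := bint_le_sup ((b2 n).sm.sub hS).s1.cont (hN n hn)
    have h0 : 0 ≤ bint (fun x => |w (φ n) x - VV A B B' h x|) :=
      intervalIntegral.integral_nonneg two_pi_nonneg fun t _ => abs_nonneg _
    rw [Real.dist_eq, sub_zero, abs_of_nonneg h0]
    have : 2 * π * (ε / (4 * π)) = ε / 2 := by field_simp; norm_num
    linarith
  have te : Tendsto (fun n => ∫ x in oD, |dE k (w (φ n)) x|) atTop (nhds 0) := (hw.comp hφ).e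
  have c0 : 0 < 2 * (-k) * exp (-C') := mul_pos (by linarith) (exp_pos _)
  have lim : Tendsto (fun n => (2 * C' * ((∫ x in oD, |dE k (w (φ n)) x|) + 0) +
      2 * C' * bint (fun x => |w (φ n) x - VV A B B' h x|)) / (2 * (-k) * exp (-C'))) atTop
      (nhds ((2 * C' * (0 + 0) + 2 * C' * 0) / (2 * (-k) * exp (-C')))) :=
    (((te.add_const 0).const_mul _).add (tb.const_mul _)).div_const _
  have e0 : (2 * C' * (0 + 0) + 2 * C' * 0) / (2 * (-k) * exp (-C')) = 0 := by simp
  rw [e0] at lim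
  refine squeeze_zero (fun n => integral_nonneg fun _ => sq_nonneg _) (fun n => ?_) lim
  rw [le_div_iff₀ c0]
  have := comp1 hk.le (b2 n) b1
  have h0 : 0 ≤ ∫ x in oD, gradSq (fun y => w (φ n) y - VV A B B' h y) x :=
    integral_nonneg fun _ => gradSq_nonneg _ _
  rw [z] at this
  linarith
lemma mD : MeasurableSet oD := Metric.isOpen_ball.measurableSet
lemma ddct {F : ℕ → ℂ → ℝ} (hF : ∀ n, ContinuousOn (F n) oD)
    (hg : IntegrableOn g oD) (hb : ∀ n, ∀ x ∈ oD, |F n x| ≤ g x)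
    (hl : ∀ᵐ x ∂(volume.restrict oD), Tendsto (fun n => F n x) atTop (nhds (f x))) :
    Tendsto (fun n => ∫ x in oD, F n x) atTop (nhds (∫ x in oD, f x)) :=
  tendsto_integral_of_dominated_convergence g (fun n => (hF n).aestronglyMeasurable mD) hg
    (fun n => by filter_upwards [ae_restrict_mem mD] with x hx using hb n x hx) hl
lemma l2_ae {w : ℕ → ℂ → ℝ} {V : ℂ → ℝ} (hw : ∀ n, ContinuousOn (w n) cD)
    (hV : ContinuousOn V cD)
    (h : Tendsto (fun n => ∫ x in oD, (w n x - V x) ^ 2) atTop (nhds 0)) :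
    ∃ φ : ℕ → ℕ, StrictMono φ ∧ ∀ᵐ x ∂(volume.restrict oD),
      Tendsto (fun n => w (φ n) x) atTop (nhds (V x)) := by
  have hc : ∀ n, ContinuousOn (fun x => (w n x - V x) ^ 2) cD := fun n => by
    have := hw n
    fun_prop
  have tm : TendstoInMeasure (volume.restrict oD) (fun n x => (w n x - V x) ^ 2) atTop
      (fun _ => (0:ℝ)) := by
    refine tendstoInMeasure_of_tendsto_eLpNorm (p := 1) (by norm_num)
      (fun n => (intD (hc n)).aestronglyMeasurable) aestronglyMeasurable_const ?_
    have e : ∀ n, eLpNorm ((fun x => (w n x - V x) ^ 2) - fun _ => (0:ℝ)) 1 (volume.restrict oD) =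
        ENNReal.ofReal (∫ x in oD, (w n x - V x) ^ 2) := by
      intro n
      rw [eLpNorm_one_eq_lintegral_enorm]
      have := ofReal_integral_norm_eq_lintegral_enorm (intD (hc n))
      simp only [norm_eq_abs, abs_sq] at this
      rw [this]; simp
    simp only [e]
    have := (ENNReal.continuous_ofReal.tendsto 0).comp h
    rw [ENNReal.ofReal_zero] at this
    exact this
  obtain ⟨φ, hφ, ha⟩ := tm.exists_seq_tendsto_ae
  refine ⟨φ, hφ, ?_⟩
  filter_upwards [ha] with x hx
  have h1 : Tendsto (fun n => √((w (φ n) x - V x) ^ 2)) atTop (nhds (√0)) :=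
    (Real.continuous_sqrt.tendsto 0).comp hx
  simp only [sqrt_sq_eq_abs, sqrt_zero] at h1
  exact tendsto_iff_norm_sub_tendsto_zero.2 h1
lemma int_neg (J : ℂ → ℝ) : ∫ x in oD, J (-x) = ∫ x in oD, J x := by
  have := (Measure.measurePreserving_neg (volume : Measure ℂ)).setIntegral_preimage_emb
    (MeasurableEquiv.neg ℂ).measurableEmbedding J oD
  have e : (Neg.neg ⁻¹' oD : Set ℂ) = oD := by ext x; simp
  rwa [e] at this
lemma bary {A B B' h : ℝ} (hA : 0 < A) (hh : 0 < h) (hg : ∀ x ∈ cD, 0 < gg A B B' h x)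
    (h1 : ∫ x in oD, x.re * exp (VV A B B' h x) = 0)
    (h2 : ∫ x in oD, x.im * exp (VV A B B' h x) = 0) : B = 0 ∧ B' = 0 := by
  have cg : Continuous (gg A B B' h) := (gg_cd A B B' h).continuous
  have hn : ∀ x ∈ cD, -x ∈ cD := fun x hx => by simpa using hx
  set J : ℂ → ℝ := fun x => (B * x.re + B' * x.im) * (gg A B B' h x)⁻¹ ^ 2 with hJ
  have cre := continuous_re
  have cim := continuous_im
  have ci : ContinuousOn (fun x => (gg A B B' h x)⁻¹) cD :=
    cg.continuousOn.inv₀ fun x hx => (hg x hx).ne'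
  have ci2 : ContinuousOn (fun x => (gg A B B' h (-x))⁻¹) cD :=
    (cg.comp continuous_neg).continuousOn.inv₀ fun x hx => (hg _ (hn x hx)).ne'
  have cJ : ContinuousOn J cD := by
    have : ContinuousOn (fun x : ℂ => B * x.re + B' * x.im) cD := by fun_prop
    exact this.mul (ci.pow 2)
  have cJ2 : ContinuousOn (fun x => J (-x)) cD := by
    have : ContinuousOn (fun x : ℂ => B * (-x).re + B' * (-x).im) cD := by fun_prop
    exact this.mul (ci2.pow 2)
  have iJ : ∫ x in oD, J x = 0 := by
    have e : ∫ x in oD, J x = ∫ x in oD, (B * (x.re * exp (VV A B B' h x)) +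
        B' * (x.im * exp (VV A B B' h x))) :=
      dcongr fun x hx => by rw [VV_exp (hg x (oD_sub hx))]; simp only [hJ]; ring
    have cV := (VV_S2 hg).s1.cont
    rw [e, dadd (by fun_prop) (by fun_prop), dmul, dmul, h1, h2]; simp
  set Q : ℂ → ℝ := fun x => 4 * ((A + h) / 2 + (A - h) / 2 * (x.re ^ 2 + x.im ^ 2)) *
    (B * x.re + B' * x.im) ^ 2 * ((gg A B B' h x)⁻¹ ^ 2 * (gg A B B' h (-x))⁻¹ ^ 2) with hQ
  have ep : ∀ x ∈ cD, 0 < (A + h) / 2 + (A - h) / 2 * (x.re ^ 2 + x.im ^ 2) := fun x hx => by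
    have := disk_sq hx
    nlinarith [sq_nonneg x.re, sq_nonneg x.im]
  have cQ : ContinuousOn Q cD := by
    have : ContinuousOn (fun x : ℂ => 4 * ((A + h) / 2 + (A - h) / 2 * (x.re ^ 2 + x.im ^ 2)) *
      (B * x.re + B' * x.im) ^ 2) cD := by fun_prop
    exact this.mul ((ci.pow 2).mul (ci2.pow 2))
  have eQ : ∀ x ∈ oD, Q x = - (J x + J (-x)) := fun x hx => by
    have p1 := (hg x (oD_sub hx)).ne'
    have p2 := (hg _ (hn x (oD_sub hx))).ne'
    simp only [hQ, hJ]
    field_simp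
    unfold gg
    simp only [Complex.neg_re, Complex.neg_im]
    ring
  have iQ : ∫ x in oD, Q x = 0 := by
    rw [dcongr eQ, integral_neg, dadd cJ cJ2, int_neg, iJ]; simp
  have zQ := (setIntegral_eq_zero_iff_of_nonneg_ae (by
    filter_upwards [ae_restrict_mem mD] with x hx
    have := ep x (oD_sub hx)
    simp only [hQ, Pi.zero_apply]; positivity) (intD cQ)).1 iQ
  have z := Measure.eqOn_open_of_ae_eq zQ Metric.isOpen_ball (cQ.mono oD_sub) continuousOn_const
  have key : ∀ x ∈ oD, B * x.re + B' * x.im = 0 := fun x hx => by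
    have h0 : Q x = 0 := z hx
    have p0 := ep x (oD_sub hx)
    have p1 := inv_pos.2 (hg x (oD_sub hx))
    have p2 := inv_pos.2 (hg _ (hn x (oD_sub hx)))
    simp only [hQ] at h0
    by_contra hne
    have : 0 < (B * x.re + B' * x.im) ^ 2 := by positivity
    have : 0 < 4 * ((A + h) / 2 + (A - h) / 2 * (x.re ^ 2 + x.im ^ 2)) *
      (B * x.re + B' * x.im) ^ 2 * ((gg A B B' h x)⁻¹ ^ 2 * (gg A B B' h (-x))⁻¹ ^ 2) := by positivity
    linarith
  have k1 := key (1/2 : ℝ) (by rw [Metric.mem_ball, dist_zero_right, norm_real]; norm_num)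
  have k2 := key ((1/2 : ℝ) * I) (by
    rw [Metric.mem_ball, dist_zero_right, norm_mul, norm_real]; norm_num)
  simp at k1 k2
  exact ⟨k1, k2⟩
lemma mass {h k s : ℝ} (hk : k < 0) (hs : 0 < s) (hsk : s ^ 2 = h ^ 2 + k) (hh : 0 < h)
    (hg : ∀ x ∈ cD, 0 < gg s 0 0 h x) :
    ∫ x in oD, exp (VV s 0 0 h x) = 2 * π / (s * (h + s)) := by
  have sm := VV_S2 hg
  have e := int_lap sm
  have e1 : ∫ x in oD, lap (VV s 0 0 h) x = (-2 * k) * ∫ x in oD, exp (VV s 0 0 h x) := by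
    rw [← dmul]
    refine dcongr fun x hx => ?_
    have := VV_dE hg (k := k) (by linarith) (oD_sub hx)
    unfold dE at this; linarith
  have e2 : bint (nderiv (VV s 0 0 h)) = bint (fun _ => 2 * h / s - 2) := bcongr fun θ => by
    have := VV_dN hg θ
    unfold dN at this
    rw [VV_exp2 (hg _ (bpt_mem θ)), gg_bpt] at this
    simp only [zero_mul, add_zero] at this
    rw [div_eq_mul_inv]; linarith
  rw [e1, e2, bconst] at e
  have : (-2 * k) * (2 * π / (s * (h + s))) = 2 * π * (2 * h / s - 2) := by
    have : h + s ≠ 0 := by positivity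
    have e3 : k = (s - h) * (h + s) := by linear_combination -hsk
    rw [e3]; field_simp; ring
  exact mul_left_cancel₀ (by linarith : -2 * k ≠ 0 ) (e.trans this.symm)
theorem AS.core {k h C : ℝ} {w : ℕ → ℂ → ℝ} (hw : AS k h C w) (hk : k < 0)
    (hs : 0 < h ^ 2 + k)
    (hb1 : Tendsto (fun n => ∫ x in oD, x.re * exp (w n x)) atTop (nhds 0))
    (hb2 : Tendsto (fun n => ∫ x in oD, x.im * exp (w n x)) atTop (nhds 0)) :
    0 < h ∧ ∃ φ : ℕ → ℕ, StrictMono φ ∧ (∀ x ∈ cD, 0 < gg √(h ^ 2 + k) 0 0 h x) ∧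
      (∀ ε > 0, ∃ N, ∀ n ≥ N, ∀ θ, |w (φ n) (bpt θ) + 2 * log √(h ^ 2 + k)| ≤ ε) ∧
      (∀ᵐ x ∂(volume.restrict oD), Tendsto (fun n => w (φ n) x) atTop
        (nhds (VV √(h ^ 2 + k) 0 0 h x))) ∧
      ∫ x in oD, exp (VV √(h ^ 2 + k) 0 0 h x) =
        2 * π / (√(h ^ 2 + k) * (h + √(h ^ 2 + k))) := by
  obtain ⟨hh, φ, hφ, A, B, B', hA, hAB, hg, hu, hl⟩ := hw.limit hk hs
  obtain ⟨χ, hχ, hae⟩ := l2_ae (fun n => (hw.bf (φ n)).sm.s1.cont) (VV_S2 hg).s1.cont hl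
  have hφχ : StrictMono (fun n => φ (χ n)) := hφ.comp hχ
  have cre := continuous_re
  have cim := continuous_im
  have dct : ∀ q : ℂ → ℝ, Continuous q → (∀ x ∈ oD, |q x| ≤ 1) →
      Tendsto (fun n => ∫ x in oD, q x * exp (w (φ (χ n)) x)) atTop
        (nhds (∫ x in oD, q x * exp (VV A B B' h x))) := fun q hq hq1 => by
    refine ddct (g := fun _ => exp C) (fun n => ?_) (intD continuousOn_const)
      (fun n x hx => ?_) ?_
    · have := (hw.bf (φ (χ n))).sm.s1.cont.mono oD_sub
      fun_prop
    · rw [abs_mul, abs_exp]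
      have b := (abs_le.1 ((hw.bf (φ (χ n))).bd x (oD_sub hx))).2
      have := exp_le_exp.2 b
      nlinarith [hq1 x hx, abs_nonneg (q x), exp_pos (w (φ (χ n)) x)]
    · filter_upwards [hae] with x hx
      exact ((Real.continuous_exp.tendsto _).comp hx).const_mul _
  have nb : ∀ x ∈ oD, ‖x‖ ≤ 1 := fun x hx => by simpa using oD_sub hx
  have z1 := tendsto_nhds_unique (dct _ cre fun x hx => (abs_re_le_norm x).trans (nb x hx))
    (hb1.comp hφχ.tendsto_atTop)
  have z2 := tendsto_nhds_unique (dct _ cim fun x hx => (abs_im_le_norm x).trans (nb x hx))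
    (hb2.comp hφχ.tendsto_atTop)
  obtain ⟨rfl, rfl⟩ := bary hA hh hg z1 z2
  have hsA : √(h ^ 2 + k) = A := by
    rw [sqrt_eq_iff_mul_self_eq hs.le hA.le]; linarith
  rw [hsA]
  refine ⟨hh, _, hφχ, hg, fun ε hε => ?_, hae, mass hk hA (by linarith) hh hg⟩
  obtain ⟨N, hN⟩ := hu ε hε
  refine ⟨N, fun n hn θ => ?_⟩
  have := hN (χ n) (hn.trans (hχ.id_le n)) θ
  unfold VV at this; rw [gg_bpt] at this
  simpa using this
lemma nsq (x : ℂ) : ‖x‖ ^ 2 = x.re ^ 2 + x.im ^ 2 := by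
  rw [← normSq_eq_norm_sq, normSq_apply]; ring
lemma pd_holo {U : ℂ → ℝ} {f : ℂ → ℂ} {f' y : ℂ} (hf : HasDerivAt f f' y)
    (hU : DifferentiableAt ℝ U (f y)) (v : ℂ) :
    pd (fun z => U (f z)) v y = pd U (f' * v) (f y) := by
  have h1 : HasFDerivAt f _ y := hf.complexToReal_fderiv
  have h2 : HasFDerivAt (fun z => U (f z)) _ y := hU.hasFDerivAt.comp y h1
  unfold pd; rw [h2.fderiv]; simp [mul_comm]
lemma cd_ev {U : ℂ → ℝ} (hU : ContDiffAt ℝ 2 U x) :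
    ∀ᶠ y in nhds x, DifferentiableAt ℝ U y := by
  filter_upwards [hU.eventually (by simp)] with y hy using hy.differentiableAt (by norm_num)
lemma cd_pd {U : ℂ → ℝ} (hU : ContDiffAt ℝ 2 U x) (v : ℂ) :
    DifferentiableAt ℝ (fun y => pd U v y) x := by
  have := hU.fderiv_right (m := 1) (by norm_num)
  exact (this.clm_apply contDiffAt_const).differentiableAt (by norm_num)
lemma lap_eq (w : ℂ → ℝ) (x : ℂ) : lap w x = pd (fun y => pd w 1 y) 1 x +
    pd (fun y => pd w I y) I x := rfl
lemma lap_add (hf : ContDiffAt ℝ 2 f x) (hg : ContDiffAt ℝ 2 g x) :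
    lap (fun y => f y + g y) x = lap f x + lap g x := by
  have e : ∀ v : ℂ, pd (fun y => pd (fun y => f y + g y) v y) v x =
      pd (fun y => pd f v y) v x + pd (fun y => pd g v y) v x := fun v => by
    rw [← pd_add (cd_pd hf v) (cd_pd hg v)]
    refine pd_congr ?_ _
    filter_upwards [cd_ev hf, cd_ev hg] with y h1 h2 using pd_add h1 h2 v
  simp only [lap_eq, e]; ring
lemma lap_cmul (c : ℝ) (hf : ContDiffAt ℝ 2 f x) :
    lap (fun y => c * f y) x = c * lap f x := by
  have e : ∀ v : ℂ, pd (fun y => pd (fun y => c * f y) v y) v x =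
      c * pd (fun y => pd f v y) v x := fun v => by
    rw [← pd_cmul c (cd_pd hf v)]
    refine pd_congr ?_ _
    filter_upwards [cd_ev hf] with y h1 using pd_cmul c h1 v
  simp only [lap_eq, e]; ring
lemma pd_const (c : ℝ) (v x : ℂ) : pd (fun _ => c) v x = 0 := by simp [pd]
lemma lap_const (c : ℝ) (x : ℂ) : lap (fun _ => c) x = 0 := by
  simp only [lap_eq, pd_const]; simp
lemma lap_holo {U : ℂ → ℝ} {f g : ℂ → ℂ} {g' y : ℂ} (hf : ∀ᶠ z in nhds y, HasDerivAt f (g z) z)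
    (hg : HasDerivAt g g' y) (hU : ContDiffAt ℝ 2 U (f y)) :
    lap (fun z => U (f z)) y = ‖g y‖ ^ 2 * lap U (f y) := by
  have hfy := hf.self_of_nhds
  have e : ∀ v : ℂ, pd (fun z => pd (fun z => U (f z)) v z) v y =
      (g y * v).re * (pd (fun x => pd U 1 x) (g y * v) (f y)) + pd U 1 (f y) * (g' * v * v).re +
      ((g y * v).im * (pd (fun x => pd U I x) (g y * v) (f y)) +
        pd U I (f y) * (g' * v * v).im) := fun v => by
    have e1 : (fun z => pd (fun z => U (f z)) v z) =ᶠ[nhds y] fun z =>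
        (g z * v).re * pd U 1 (f z) + (g z * v).im * pd U I (f z) := by
      filter_upwards [hf, hfy.continuousAt.eventually (cd_ev hU)] with z h1 h2
      rw [pd_holo h1 h2, pd_eq]
    have d1 : HasDerivAt (fun z => g z * v) (g' * v) y := hg.mul_const v
    have d1r : HasFDerivAt (fun z => g z * v) _ y := d1.complexToReal_fderiv
    have fr : HasFDerivAt (fun z => (g z * v).re) _ y := reCLM.hasFDerivAt.comp y d1r
    have fi : HasFDerivAt (fun z => (g z * v).im) _ y := imCLM.hasFDerivAt.comp y d1r
    have u1 : DifferentiableAt ℝ (fun z => pd U 1 (f z)) y :=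
      (cd_pd hU 1).comp y hfy.complexToReal_fderiv.differentiableAt
    have u2 : DifferentiableAt ℝ (fun z => pd U I (f z)) y :=
      (cd_pd hU I).comp y hfy.complexToReal_fderiv.differentiableAt
    have m1 : DifferentiableAt ℝ (fun z => (g z * v).re * pd U 1 (f z)) y :=
      fr.differentiableAt.mul u1
    have m2 : DifferentiableAt ℝ (fun z => (g z * v).im * pd U I (f z)) y :=
      fi.differentiableAt.mul u2
    rw [pd_congr e1, pd_add m1 m2,
      pd_mul fr.differentiableAt u1, pd_mul fi.differentiableAt u2,
      pd_holo (U := fun x => pd U 1 x) hfy (cd_pd hU 1),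
      pd_holo (U := fun x => pd U I x) hfy (cd_pd hU I)]
    have r1 : pd (fun z => (g z * v).re) v y = (g' * v * v).re := by
      unfold pd; rw [fr.fderiv]; simp [mul_comm]
    have r2 : pd (fun z => (g z * v).im) v y = (g' * v * v).im := by
      unfold pd; rw [fi.fderiv]; simp [mul_comm]
    rw [r1, r2]
  rw [lap_eq, e, e, lap_eq, nsq]
  simp only [pd_eq (fun x => pd U 1 x) (g y * _), pd_eq (fun x => pd U I x) (g y * _)]
  have s : pd (fun x => pd U 1 x) I (f y) = pd (fun x => pd U I x) 1 (f y) := by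
    have hs : IsSymmSndFDerivAt ℝ U (f y) := hU.isSymmSndFDerivAt (by simp)
    have hd : DifferentiableAt ℝ (fderiv ℝ U) (f y) :=
      (hU.fderiv_right (m := 1) (by norm_num)).differentiableAt (by norm_num)
    have e : ∀ u v : ℂ, pd (fun y => pd U u y) v (f y) = fderiv ℝ (fderiv ℝ U) (f y) v u := by
      intro u v
      have := (hd.hasFDerivAt.clm_apply (hasFDerivAt_const u (f y))).fderiv
      unfold pd; rw [this]; simp
    rw [e, e, hs.eq]
  rw [s]
  simp
  ring
lemma lognorm_cd {z : ℂ} (hz : z ≠ 0) : ContDiffAt ℝ 2 (fun z : ℂ => log ‖z‖) z :=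
  ((contDiffAt_norm ℝ hz).log (norm_ne_zero_iff.2 hz))
lemma lognorm_pd {z : ℂ} (hz : z ≠ 0) (v : ℂ) :
    pd (fun z : ℂ => log ‖z‖) v z = (v / z).re := by
  have e : (fun z : ℂ => log ‖z‖) = fun z => (1/2) * log (z.re ^ 2 + z.im ^ 2) := by
    ext x; rw [← nsq, log_pow]; push_cast; ring
  have hp : 0 < z.re ^ 2 + z.im ^ 2 := by rw [← nsq]; positivity
  have h1 : HasFDerivAt (fun x : ℂ => x.re) reCLM z := reCLM.hasFDerivAt
  have h2 : HasFDerivAt (fun x : ℂ => x.im) imCLM z := imCLM.hasFDerivAt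
  have h3 := (((h1.pow 2).add (h2.pow 2)).log hp.ne').const_mul (1/2)
  have h4 : fderiv ℝ (fun z : ℂ => (1/2) * log (z.re ^ 2 + z.im ^ 2)) z = _ := h3.fderiv
  unfold pd; rw [e, h4]
  rw [Complex.div_re, normSq_apply]
  have : z.re * z.re + z.im * z.im ≠ 0 := by nlinarith
  have hp' := hp.ne'
  simp
  field_simp
lemma lognorm_lap {z : ℂ} (hz : z ≠ 0) : lap (fun z : ℂ => log ‖z‖) z = 0 := by
  have e : ∀ v : ℂ, pd (fun y => pd (fun z : ℂ => log ‖z‖) v y) v z =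
      (-(v * v) / z ^ 2).re := fun v => by
    have e1 : (fun y => pd (fun z : ℂ => log ‖z‖) v y) =ᶠ[nhds z] fun y => (v / y).re := by
      filter_upwards [isOpen_ne.mem_nhds hz] with y hy using lognorm_pd hy v
    rw [pd_congr e1]
    have d : HasDerivAt (fun y : ℂ => v / y) (v * -(z ^ 2)⁻¹) z := by
      simpa [div_eq_mul_inv] using (hasDerivAt_inv hz).const_mul v
    have fr : HasFDerivAt (fun y : ℂ => (v / y).re) _ z :=
      reCLM.hasFDerivAt.comp z d.complexToReal_fderiv
    unfold pd; rw [fr.fderiv]; simp [div_eq_mul_inv]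
    ring_nf
  rw [lap_eq, e, e]; simp [neg_div]
lemma sqn_cd (z : ℂ) : ContDiffAt ℝ 2 (fun z : ℂ => ‖z‖ ^ 2) z := (contDiff_norm_sq ℝ).contDiffAt
lemma sqn_pd (z v : ℂ) : pd (fun z : ℂ => ‖z‖ ^ 2) v z = 2 * (z.re * v.re + z.im * v.im) := by
  have e : (fun z : ℂ => ‖z‖ ^ 2) = gg 1 0 0 (-1) := by ext x; rw [nsq]; unfold gg; ring
  rw [e, gg_pd]; ring
lemma sqn_lap (z : ℂ) : lap (fun z : ℂ => ‖z‖ ^ 2) z = 4 := by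
  have e : ∀ v : ℂ, pd (fun y => pd (fun z : ℂ => ‖z‖ ^ 2) v y) v z =
      2 * (v.re ^ 2 + v.im ^ 2) := fun v => by
    have : (fun y => pd (fun z : ℂ => ‖z‖ ^ 2) v y) = gg 0 (2 * v.re) (2 * v.im) 0 := by
      ext y; rw [sqn_pd]; unfold gg; ring
    rw [this, gg_pd]; ring
  rw [lap_eq, e, e]; simp; norm_num
def mg (q : ℂ) (r : ℝ) (y : ℂ) : ℂ := q * ((r + y) / (1 + r * y))
def mgd (q : ℂ) (r : ℝ) (y : ℂ) : ℂ := q * ((1 - r ^ 2) / (1 + r * y) ^ 2)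
def el (r : ℝ) (y : ℂ) : ℝ := log ‖1 + r * y‖
def LL (δ : ℝ) (q : ℂ) (r : ℝ) (y : ℂ) : ℝ := -(δ / 4) * (‖mg q r y‖ ^ 2 - 1) - 5 * δ * el r y
def vv (u : ℂ → ℝ) (q : ℂ) (r : ℝ) (y : ℂ) : ℝ :=
  u (mg q r y) + 2 * log (1 - r ^ 2) - 4 * el r y
def ww (δ : ℝ) (u : ℂ → ℝ) (q : ℂ) (r : ℝ) (y : ℂ) : ℝ := vv u q r y - LL δ q r y
section
variable {q : ℂ} {r : ℝ}
lemma cD_norm (hy : y ∈ cD) : ‖y‖ ≤ 1 := by simpa using hy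
lemma oD_norm (hy : y ∈ oD) : ‖y‖ < 1 := by simpa using hy
lemma ry_norm (h0 : 0 < r) (y : ℂ) : ‖(r:ℂ) * y‖ = r * ‖y‖ := by
  rw [norm_mul, norm_real, Real.norm_of_nonneg h0.le]
lemma den_lo (h0 : 0 < r) (hy : y ∈ cD) : 1 - r ≤ ‖1 + r * y‖ := by
  have h := norm_sub_norm_le (1:ℂ) (-(r * y))
  rw [norm_neg, sub_neg_eq_add, ry_norm h0, norm_one] at h
  nlinarith [cD_norm hy]
lemma den_pos (h0 : 0 < r) (h1 : r < 1) (hy : y ∈ cD) : 0 < ‖1 + r * y‖ := by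
  linarith [den_lo h0 hy]
lemma den_ne (h0 : 0 < r) (h1 : r < 1) (hy : y ∈ cD) : 1 + r * y ≠ 0 :=
  norm_pos_iff.1 (den_pos h0 h1 hy)
lemma den_hi (h0 : 0 < r) (h1 : r < 1) (hy : y ∈ cD) : ‖1 + r * y‖ ≤ 2 := by
  have h := norm_add_le (1:ℂ) (r * y)
  rw [ry_norm h0, norm_one] at h
  nlinarith [cD_norm hy, norm_nonneg y]
lemma den_lo2 (h0 : 0 < r) (h1 : r < 1) (hy : y ∈ cD) : ‖1 + y‖ ≤ 2 * ‖1 + r * y‖ := by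
  have h := norm_add_le (1 + r * y) ((1 - r : ℝ) * y)
  have e : 1 + r * y + ((1 - r : ℝ) : ℂ) * y = 1 + y := by push_cast; ring
  rw [e, ry_norm (by linarith)] at h
  nlinarith [cD_norm hy, den_lo h0 hy, norm_nonneg y]
lemma den_sq (y : ℂ) : ‖1 + r * y‖ ^ 2 - ‖r + y‖ ^ 2 = (1 - r ^ 2) * (1 - ‖y‖ ^ 2) := by
  simp only [nsq]; simp; ring
lemma mg_norm (hq : ‖q‖ = 1) (y : ℂ) : ‖mg q r y‖ = ‖r + y‖ / ‖1 + r * y‖ := by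
  unfold mg; rw [norm_mul, hq, one_mul, norm_div]
lemma mg_cD (hq : ‖q‖ = 1) (h0 : 0 < r) (h1 : r < 1) (hy : y ∈ cD) : mg q r y ∈ cD := by
  have hp := den_pos h0 h1 hy
  rw [Metric.mem_closedBall, dist_zero_right, mg_norm hq, div_le_one hp]
  have := den_sq (r := r) y
  have : ‖(r:ℂ) + y‖ ^ 2 ≤ ‖1 + r * y‖ ^ 2 := by
    have a : 0 ≤ 1 - r ^ 2 := by nlinarith
    have b : 0 ≤ 1 - ‖y‖ ^ 2 := by nlinarith [cD_norm hy, norm_nonneg y]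
    nlinarith [mul_nonneg a b]
  exact (sq_le_sq₀ (norm_nonneg _) hp.le).1 this
lemma mg_oD (hq : ‖q‖ = 1) (h0 : 0 < r) (h1 : r < 1) (hy : y ∈ oD) : mg q r y ∈ oD := by
  have hp := den_pos h0 h1 (oD_sub hy)
  rw [Metric.mem_ball, dist_zero_right, mg_norm hq, div_lt_one hp]
  have := den_sq (r := r) y
  have : ‖(r:ℂ) + y‖ ^ 2 < ‖1 + r * y‖ ^ 2 := by
    have a : 0 < 1 - r ^ 2 := by nlinarith
    have b : 0 < 1 - ‖y‖ ^ 2 := by nlinarith [oD_norm hy, norm_nonneg y]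
    nlinarith [mul_pos a b]
  exact (sq_lt_sq₀ (norm_nonneg _) hp.le).1 this
lemma mg_circ (hq : ‖q‖ = 1) (h0 : 0 < r) (h1 : r < 1) (θ : ℝ) : ‖mg q r (bpt θ)‖ = 1 := by
  have hp := den_pos h0 h1 (bpt_mem θ)
  rw [mg_norm hq, div_eq_one_iff_eq hp.ne']
  have := den_sq (r := r) (bpt θ)
  rw [norm_bpt] at this
  exact (sq_eq_sq₀ (norm_nonneg _) hp.le).1 (by linarith)
lemma den_der (y : ℂ) : HasDerivAt (fun y : ℂ => 1 + (r:ℂ) * y) r y := by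
  simpa using ((hasDerivAt_id y).const_mul (r:ℂ)).const_add 1
lemma mg_der (hy : 1 + r * y ≠ 0) : HasDerivAt (mg q r) (mgd q r y) y := by
  have h1 : HasDerivAt (fun y : ℂ => (r:ℂ) + y) 1 y := (hasDerivAt_id y).const_add _
  refine ((h1.div (den_der y) hy).const_mul q).congr_deriv ?_
  unfold mgd; field_simp; ring
lemma mgd_der (hy : 1 + r * y ≠ 0) : ∃ g', HasDerivAt (mgd q r) g' y :=
  ⟨_, ((hasDerivAt_const y ((1:ℂ) - r ^ 2)).div ((den_der y).pow 2) (pow_ne_zero 2 hy)).const_mul q⟩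
lemma mgd_norm (hq : ‖q‖ = 1) (h0 : 0 < r) (h1 : r < 1) (y : ℂ) :
    ‖mgd q r y‖ = (1 - r ^ 2) / ‖1 + r * y‖ ^ 2 := by
  unfold mgd
  rw [norm_mul, hq, one_mul, norm_div, norm_pow]
  congr 1
  have : (1 - (r:ℂ) ^ 2) = ((1 - r ^ 2 : ℝ) : ℂ) := by push_cast; ring
  rw [this, norm_real, Real.norm_of_nonneg (by nlinarith)]
lemma den_open (hy : 1 + r * y ≠ 0) : ∀ᶠ z : ℂ in nhds y, 1 + r * z ≠ 0 :=
  (den_der y).continuousAt.eventually (isOpen_ne.mem_nhds hy)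
lemma mg_cd (hy : 1 + r * y ≠ 0) : ContDiffAt ℝ 2 (mg q r) y := by
  have : ContDiffAt ℂ 2 (mg q r) y := contDiffAt_const.mul ((contDiffAt_const.add contDiffAt_id).div
    (contDiffAt_const.add (contDiffAt_const.mul contDiffAt_id)) hy)
  exact this.restrict_scalars ℝ
lemma el_cd (hy : 1 + r * y ≠ 0) : ContDiffAt ℝ 2 (el r) y :=
  (lognorm_cd hy).comp y (f := fun y : ℂ => 1 + r * y)
    (contDiffAt_const.add (contDiffAt_const.mul contDiffAt_id))
lemma el_pd (hy : 1 + r * y ≠ 0) (v : ℂ) : pd (el r) v y = (r * v / (1 + r * y)).re := by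
  have := pd_holo (U := fun z : ℂ => log ‖z‖) (den_der y)
    ((lognorm_cd hy).differentiableAt (by norm_num)) v
  rw [lognorm_pd hy] at this; exact this
lemma el_lap (hy : 1 + r * y ≠ 0) : lap (el r) y = 0 := by
  have := lap_holo (U := fun z : ℂ => log ‖z‖) (g := fun _ => (r:ℂ))
    (Eventually.of_forall fun z => den_der z) (hasDerivAt_const y (r:ℂ)) (lognorm_cd hy)
  rw [lognorm_lap hy, mul_zero] at this; exact this
lemma comp_S2 (h0 : 0 < r) (h1 : r < 1) (hu : ContDiff ℝ 2 u) :
    S2 (fun y => u (mg q r y)) := fun y hy =>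
  (hu.contDiffAt).comp y (mg_cd (den_ne h0 h1 hy))
lemma comp_S1 (h0 : 0 < r) (h1 : r < 1) (hu : ContDiff ℝ 1 u) :
    S1 (fun y => u (mg q r y)) := fun y hy =>
  (hu.contDiffAt).comp y ((mg_cd (den_ne h0 h1 hy)).of_le (by norm_num))
lemma el_S2 (h0 : 0 < r) (h1 : r < 1) : S2 (el r) := fun _ hy => el_cd (den_ne h0 h1 hy)
lemma LL_S2 (δ : ℝ) (h0 : 0 < r) (h1 : r < 1) : S2 (LL δ q r) := fun y hy => by
  have a : ContDiffAt ℝ 2 (fun y => ‖mg q r y‖ ^ 2) y :=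
    comp_S2 h0 h1 (contDiff_norm_sq ℝ) y hy
  exact (contDiffAt_const.mul (a.sub contDiffAt_const)).sub
    (contDiffAt_const.mul (el_S2 h0 h1 y hy))
lemma vv_S2 (hu : ContDiff ℝ 2 u) (h0 : 0 < r) (h1 : r < 1) : S2 (vv u q r) :=
  fun y hy => ((comp_S2 h0 h1 hu y hy).add contDiffAt_const).sub
    (contDiffAt_const.mul (el_S2 h0 h1 y hy))
lemma ww_S2 {δ : ℝ} (hu : ContDiff ℝ 2 u) (h0 : 0 < r) (h1 : r < 1) :
    S2 (ww δ u q r) := (vv_S2 hu h0 h1).sub (LL_S2 δ h0 h1)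
lemma ww_eq (δ : ℝ) (u : ℂ → ℝ) : ww δ u q r = fun y =>
    (fun x => u x + δ / 4 * ‖x‖ ^ 2) (mg q r y) +
      ((5 * δ - 4) * el r y + (2 * log (1 - r ^ 2) - δ / 4)) := by
  ext y; unfold ww vv LL; ring
lemma UU_cd (hu : ContDiff ℝ 2 u) (δ : ℝ) (x : ℂ) :
    ContDiffAt ℝ 2 (fun x => u x + δ / 4 * ‖x‖ ^ 2) x :=
  hu.contDiffAt.add (contDiffAt_const.mul (sqn_cd x))
lemma vv_exp (hq : ‖q‖ = 1) (h0 : 0 < r) (h1 : r < 1) (hy : y ∈ cD) :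
    exp (vv u q r y / 2) = exp (u (mg q r y) / 2) * ‖mgd q r y‖ := by
  have hp := den_pos h0 h1 hy
  have hr : 0 < 1 - r ^ 2 := by nlinarith
  rw [mgd_norm hq h0 h1]
  have : vv u q r y / 2 = u (mg q r y) / 2 + (log (1 - r ^ 2) -
      (log ‖1 + r * y‖ + log ‖1 + r * y‖)) := by unfold vv el; ring
  rw [this, exp_add, exp_sub, exp_add, exp_log hr, exp_log hp, sq, sq]
lemma exp_half_sq (t : ℝ) : exp t = exp (t / 2) ^ 2 := by
  rw [sq, ← exp_add]; ring_nf
lemma ww_lap {δ k : ℝ} (hu : ContDiff ℝ 2 u) (hq : ‖q‖ = 1) (h0 : 0 < r) (h1 : r < 1)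
    (hy : y ∈ oD)
    (he : lap u (mg q r y) + δ = -2 * k * exp (u (mg q r y))) :
    lap (ww δ u q r) y = -2 * k * exp (vv u q r y) := by
  have hd := den_ne h0 h1 (oD_sub hy)
  obtain ⟨g', hg'⟩ := mgd_der (q := q) hd
  have hU := UU_cd hu δ (mg q r y)
  have l1 := lap_holo (f := mg q r) (g := mgd q r) ((den_open hd).mono fun z hz => mg_der hz) hg' hU
  have c1 : ContDiffAt ℝ 2 (fun y => (fun x => u x + δ / 4 * ‖x‖ ^ 2) (mg q r y)) y :=
    hU.comp y (mg_cd hd)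
  have c2 : ContDiffAt ℝ 2 (fun y => (5 * δ - 4) * el r y) y := contDiffAt_const.mul (el_cd hd)
  rw [ww_eq, lap_add c1 (c2.add contDiffAt_const), l1,
    lap_add c2 contDiffAt_const, lap_cmul _ (el_cd hd), el_lap hd, lap_const,
    lap_add hu.contDiffAt (contDiffAt_const.mul (sqn_cd _)), lap_cmul _ (sqn_cd _), sqn_lap,
    exp_half_sq, vv_exp hq h0 h1 (oD_sub hy)]
  rw [exp_half_sq] at he
  linear_combination ‖mgd q r y‖ ^ 2 * he
lemma conj_circ (h0 : 0 < r) (h1 : r < 1) (hq : ‖q‖ = 1) (θ : ℝ) :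
    mgd q r (bpt θ) * bpt θ = (‖mgd q r (bpt θ)‖ : ℂ) * mg q r (bpt θ) := by
  have hd := den_ne h0 h1 (bpt_mem θ)
  rw [mgd_norm hq h0 h1]
  have h2 : ((‖1 + (r:ℂ) * bpt θ‖ ^ 2 : ℝ) : ℂ) = (1 + r * bpt θ) * (1 + r * (starRingEnd ℂ) (bpt θ)) := by
    rw [← normSq_eq_norm_sq, ← Complex.mul_conj]; simp
  have h3 : bpt θ * (starRingEnd ℂ) (bpt θ) = 1 := by
    rw [Complex.mul_conj, normSq_eq_norm_sq, norm_bpt]; simp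
  have hd2 : 1 + r * (starRingEnd ℂ) (bpt θ) ≠ 0 := by
    intro h
    apply hd
    have := congrArg (starRingEnd ℂ) h
    simpa using this
  push_cast at h2 ⊢
  rw [h2]
  unfold mgd mg
  field_simp
  linear_combination ((1 - (r:ℂ)^2) * q * r) * h3
lemma el_nd (h0 : 0 < r) (h1 : r < 1) (hq : ‖q‖ = 1) (θ : ℝ) :
    pd (el r) (bpt θ) (bpt θ) = (1 - ‖mgd q r (bpt θ)‖) / 2 := by
  have hd := den_ne h0 h1 (bpt_mem θ)
  have hp := den_pos h0 h1 (bpt_mem θ)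
  rw [el_pd hd, mgd_norm hq h0 h1, Complex.div_re, normSq_eq_norm_sq]
  have e : ‖1 + (r:ℂ) * bpt θ‖ ^ 2 = 1 + 2 * r * (bpt θ).re + r ^ 2 := by
    rw [nsq]; simp; linear_combination r ^ 2 * bpt_sq θ
  have hp2 : 0 < ‖1 + (r:ℂ) * bpt θ‖ ^ 2 := by positivity
  rw [← add_div, eq_div_iff (by norm_num), div_mul_eq_mul_div, div_eq_iff hp2.ne', sub_mul,
    div_mul_cancel₀ _ hp2.ne', e]
  simp
  linear_combination 2 * r ^ 2 * bpt_sq θ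
lemma ww_nd {δ b : ℝ} (hu : ContDiff ℝ 2 u) (hq : ‖q‖ = 1) (h0 : 0 < r) (h1 : r < 1)
    (θ : ℝ) (he : nderiv u (mg q r (bpt θ)) = 2 * b * exp (u (mg q r (bpt θ)) / 2) - 2 + 2 * δ) :
    nderiv (ww δ u q r) (bpt θ) = 2 * b * exp (vv u q r (bpt θ) / 2) - 2 + 5 * δ / 2 := by
  have hd := den_ne h0 h1 (bpt_mem θ)
  have hU := (UU_cd hu δ (mg q r (bpt θ))).differentiableAt (by norm_num)
  have c1 : ContDiffAt ℝ 2 (fun y => (fun x => u x + δ / 4 * ‖x‖ ^ 2) (mg q r y)) (bpt θ) :=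
    (UU_cd hu δ _).comp _ (mg_cd hd)
  have c2 : ContDiffAt ℝ 2 (fun y => (5 * δ - 4) * el r y) (bpt θ) := contDiffAt_const.mul (el_cd hd)
  have d2 := c2.differentiableAt (by norm_num)
  have cs := ((contDiffAt_const (c := δ / 4)).mul (sqn_cd (mg q r (bpt θ)))).differentiableAt (by norm_num)
  have sc : ∀ (W : ℂ → ℝ) (t : ℝ) (z : ℂ), pd W (t * z) z = t * pd W z z := fun W t z => by
    rw [pd_eq, pd_eq W z]; simp; ring
  have hn := nsq (mg q r (bpt θ))
  rw [mg_circ hq h0 h1] at hn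
  rw [nderiv_eq] at he
  rw [nderiv_eq, ww_eq, pd_add (c1.differentiableAt (by norm_num)) (d2.add_const _),
    pd_holo (mg_der hd) hU, conj_circ h0 h1 hq, sc,
    pd_add d2 (differentiableAt_const _), pd_cmul _ ((el_cd hd).differentiableAt (by norm_num)),
    el_nd h0 h1 hq, pd_const, pd_add (hu.contDiffAt.differentiableAt (by norm_num)) cs,
    pd_cmul _ ((sqn_cd _).differentiableAt (by norm_num)), sqn_pd, he, vv_exp hq h0 h1 (bpt_mem θ)]
  linear_combination (-‖mgd q r (bpt θ)‖ * (δ / 2)) * hn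
end
lemma ibp (hf : S1 f) (hg : S1 g) :
    bint (fun x => f x * tderiv g x) = - bint (fun x => g x * tderiv f x) := by
  have hd : ∀ θ, HasDerivAt (fun t => f (bpt t) * g (bpt t))
      (f (bpt θ) * tderiv g (bpt θ) + g (bpt θ) * tderiv f (bpt θ)) θ := fun θ =>
    ((bpt_deriv_comp hf θ).mul (bpt_deriv_comp hg θ)).congr_deriv (by ring)
  have c1 := hf.cont
  have c2 := hg.cont
  have c3 := hf.tderiv_cont
  have c4 := hg.tderiv_cont
  have i1 : ContinuousOn (fun x => f x * tderiv g x) cD := by fun_prop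
  have i2 : ContinuousOn (fun x => g x * tderiv f x) cD := by fun_prop
  have := intervalIntegral.integral_eq_sub_of_hasDerivAt (fun θ _ => hd θ)
    ((intB i1 0 (2 * π)).add (intB i2 0 (2 * π)))
  simp only [bpt_two_pi, bpt_zero, sub_self] at this
  have e := badd i1 i2
  have e' : bint (fun x => f x * tderiv g x + g x * tderiv f x) = 0 := this
  linarith
lemma pd_circ (w : ℂ → ℝ) (F : ℂ → ℂ) (θ : ℝ) (h : al F (bpt θ) = 0) :
    pd w (F (bpt θ)) (bpt θ) = be F (bpt θ) * tderiv w (bpt θ) := by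
  have hs := bpt_sq θ
  rw [pd_eq]; unfold be tderiv; unfold al at h
  generalize (bpt θ).re = c at *
  generalize (bpt θ).im = s at *
  generalize (F (bpt θ)).re = a at *
  generalize (F (bpt θ)).im = b at *
  linear_combination (c * pd w 1 (bpt θ) + s * pd w I (bpt θ)) * h -
    (a * pd w 1 (bpt θ) + b * pd w I (bpt θ)) * hs
structure FF (F F' : ℂ → ℂ) (ψ : ℂ → ℝ) : Prop where
  vf : VF F F'
  tan : ∀ θ, al F (bpt θ) = 0
  sm : S2 ψ
  lp : ∀ x ∈ oD, lap ψ x = 0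
  re : ∀ x, (F' x).re = -2 * ψ x
  nd : ∀ θ, nderiv ψ (bpt θ) = ψ (bpt θ)
  bi : bint ψ = 0
  beS : S1 (be F)
  bet : ∀ θ, tderiv (be F) (bpt θ) = -2 * ψ (bpt θ)
theorem ident {w L κ b : ℂ → ℝ} {δ : ℝ} {F F' : ℂ → ℂ} {ψ : ℂ → ℝ} (hF : FF F F' ψ) (hw : S2 w)
    (hL : S1 L) (hκ : S1 κ) (hb : S1 b)
    (h1 : ∀ x ∈ oD, lap w x = -2 * κ x * exp (w x + L x))
    (h2 : ∀ θ, nderiv w (bpt θ) =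
      2 * b (bpt θ) * exp ((w (bpt θ) + L (bpt θ)) / 2) - 2 + 5 * δ / 2) :
    2 * (∫ x in oD, exp (w x + L x) * pd κ (F x) x) +
      4 * bint (fun x => exp ((w x + L x) / 2) * pd b (F x) x) =
    -2 * (∫ x in oD, κ x * exp (w x + L x) * pd L (F x) x) -
      2 * bint (fun x => b x * exp ((w x + L x) / 2) * pd L (F x) x) +
      5 * δ * bint (fun x => w x * ψ x) := by
  have hv : S1 (fun x => w x + L x) := hw.s1.add hL
  have he : S1 (fun x => exp (w x + L x)) := fun x hx => (hv x hx).exp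
  have he2 : S1 (fun x => exp ((w x + L x) / 2)) := fun x hx => ((hv x hx).div_const 2).exp
  have hφ : S1 (fun x => κ x * exp (w x + L x)) := hκ.mul he
  have cF := hF.vf.cont.continuousOn (s := cD)
  have cw := hw.s1.cont
  have cL := hL.cont
  have cκ := hκ.cont
  have cb := hb.cont
  have cψ := hF.sm.s1.cont
  have cβ := hF.beS.cont
  have pw := hw.s1.pdF_cont cF
  have pL := hL.pdF_cont cF
  have pκ := hκ.pdF_cont cF
  have pb := hb.pdF_cont cF
  have plw := hw.lap_cont
  have nw := hw.s1.nderiv_cont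
  have tw := hw.s1.tderiv_cont
  have tL := hL.tderiv_cont
  have tb := hb.tderiv_cont
  have nψ := hF.sm.s1.nderiv_cont
  have lψ := hF.sm.lap_cont
  have B := greenB hw hF.vf
  have Cc := greenC hφ hF.vf
  have D := greenD hF.sm hw
  have C0 : bint (fun x => (κ x * exp (w x + L x)) * al F x) = 0 := by
    rw [bcongr (g := fun _ => 0) fun θ => by rw [hF.tan θ, mul_zero], bconst, mul_zero]
  rw [C0] at Cc
  have pe : ∀ x ∈ cD, ∀ v, pd (fun x => κ x * exp (w x + L x)) v x =
      κ x * exp (w x + L x) * (pd w v x + pd L v x) + exp (w x + L x) * pd κ v x := by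
    intro x hx v
    rw [pd_mul (hκ.diff hx) (he.diff hx), pd_comp (Real.hasDerivAt_exp _) (hv.diff hx),
      pd_add (hw.s1.diff hx) (hL.diff hx)]
    ring
  set I1 := ∫ x in oD, exp (w x + L x) * pd κ (F x) x
  set I2 := ∫ x in oD, κ x * exp (w x + L x) * pd L (F x) x
  have Cc' : (∫ x in oD, κ x * exp (w x + L x) * pd w (F x) x) + I2 + I1 -
      4 * ∫ x in oD, κ x * exp (w x + L x) * ψ x = 0 := by
    rw [← Cc, ← dmul, ← dadd (by fun_prop) (by fun_prop), ← dadd (by fun_prop) (by fun_prop),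
      ← dsub (by fun_prop) (by fun_prop)]
    exact dcongr fun x hx => by rw [pe x (oD_sub hx), hF.re]; ring
  have D' : -2 * (∫ x in oD, κ x * exp (w x + L x) * ψ x) =
      bint (fun x => ψ x * nderiv w x) - bint (fun x => w x * ψ x) := by
    rw [← dmul, ← bsub (by fun_prop) (by fun_prop)]
    have e1 : ∫ x in oD, -2 * (κ x * exp (w x + L x) * ψ x) =
        ∫ x in oD, (ψ x * lap w x - w x * lap ψ x) :=
      dcongr fun x hx => by rw [h1 x hx, hF.lp x hx]; ring
    rw [e1, D]
    exact bcongr fun θ => by rw [hF.nd]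
  have N1 : bint (fun x => ψ x * nderiv w x) =
      2 * bint (fun x => ψ x * b x * exp ((w x + L x) / 2)) := by
    have e : bint (fun x => ψ x * nderiv w x) =
        bint (fun x => 2 * (ψ x * b x * exp ((w x + L x) / 2)) + (5 * δ / 2 - 2) * ψ x) :=
      bcongr fun θ => by rw [h2]; ring
    rw [e, badd (by fun_prop) (by fun_prop), bmul, bmul, hF.bi]; ring
  have B' : -2 * (∫ x in oD, κ x * exp (w x + L x) * pd w (F x) x) =
      2 * bint (fun x => be F x * b x * exp ((w x + L x) / 2) * tderiv w x) +
      (5 * δ / 2 - 2) * bint (fun x => be F x * tderiv w x) := by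
    rw [← dmul, ← bmul, ← bmul, ← badd (by fun_prop) (by fun_prop)]
    have e1 : ∫ x in oD, -2 * (κ x * exp (w x + L x) * pd w (F x) x) =
        ∫ x in oD, lap w x * pd w (F x) x := dcongr fun x hx => by rw [h1 x hx]; ring
    rw [e1, B]
    exact bcongr fun θ => by rw [hF.tan, h2]; ring
  have P1 : bint (fun x => be F x * tderiv w x) = 2 * bint (fun x => w x * ψ x) := by
    rw [ibp hF.beS hw.s1, ← bmul]
    have : bint (fun x => w x * tderiv (be F) x) = bint (fun x => -1 * (2 * (w x * ψ x))) :=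
      bcongr fun θ => by rw [hF.bet]; ring
    rw [this, bmul]; ring
  have P2 := ibp (hF.beS.mul hb) he2
  have te : ∀ θ, tderiv (fun x => exp ((w x + L x) / 2)) (bpt θ) =
      exp ((w (bpt θ) + L (bpt θ)) / 2) * (tderiv w (bpt θ) + tderiv L (bpt θ)) / 2 := fun θ => by
    have hx := bpt_mem θ
    have dd : DifferentiableAt ℝ (fun x => (w x + L x) / 2) (bpt θ) := 
      ((hv _ hx).div_const 2).differentiableAt (by norm_num)
    rw [tderiv_eq, pd_comp (Real.hasDerivAt_exp _) dd]
    have : (fun x => (w x + L x) / 2) = fun x => (1/2) * (w x + L x) := by ext; ring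
    rw [this, pd_cmul _ (hv.diff hx), pd_add (hw.s1.diff hx) (hL.diff hx), ← tderiv_eq, ← tderiv_eq]
    ring_nf
  have tm : ∀ θ, tderiv (fun x => be F x * b x) (bpt θ) =
      be F (bpt θ) * tderiv b (bpt θ) + b (bpt θ) * (-2 * ψ (bpt θ)) := fun θ => by
    have hx := bpt_mem θ
    rw [← hF.bet, tderiv_eq, pd_mul (hF.beS.diff hx) (hb.diff hx), ← tderiv_eq, ← tderiv_eq]
  have P2l : bint (fun x => be F x * b x * tderiv (fun x => exp ((w x + L x) / 2)) x) =
      1/2 * (bint (fun x => be F x * b x * exp ((w x + L x) / 2) * tderiv w x) +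
        bint (fun x => b x * exp ((w x + L x) / 2) * pd L (F x) x)) := by
    rw [← badd (by fun_prop) (by fun_prop), ← bmul]
    exact bcongr fun θ => by rw [te, pd_circ L F θ (hF.tan θ)]; ring
  have P2r : bint (fun x => exp ((w x + L x) / 2) * tderiv (fun x => be F x * b x) x) =
      bint (fun x => exp ((w x + L x) / 2) * pd b (F x) x) -
        2 * bint (fun x => ψ x * b x * exp ((w x + L x) / 2)) := by
    rw [← bmul, ← bsub (by fun_prop) (by fun_prop)]
    exact bcongr fun θ => by rw [tm, pd_circ b F θ (hF.tan θ)]; ring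
  rw [P2l, P2r] at P2
  linear_combination (-4) * D' - 4 * N1 + 2 * Cc' + B' + (5 * δ / 2 - 2) * P1 + 4 * P2
def F1 (y : ℂ) : ℂ := 1 - y ^ 2
def F2 (y : ℂ) : ℂ := I * (1 + y) ^ 2
lemma re_S2 : S2 (fun x => x.re) := fun _ _ => reCLM.contDiff.contDiffAt
lemma im_S2 : S2 (fun x => x.im) := fun _ _ => imCLM.contDiff.contDiffAt
lemma lap_re (x : ℂ) : lap (fun x => x.re) x = 0 := by
  simp only [lap_eq, pd_re, pd_const]; simp
lemma lap_im (x : ℂ) : lap (fun x => x.im) x = 0 := by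
  simp only [lap_eq, pd_im, pd_const]; simp
lemma be_S1 {F F' : ℂ → ℂ} (h : VF F F') : S1 (be F) :=
  (h.im_S.mul re_S2.s1).sub (h.re_S.mul im_S2.s1)
lemma be_pd {F F' : ℂ → ℂ} (h : VF F F') (v x : ℂ) : pd (be F) v x =
    (F x).im * v.re + x.re * (F' x * v).im - ((F x).re * v.im + x.im * (F' x * v).re) := by
  have d1 : DifferentiableAt ℝ (fun y => (F y).im) x :=
    (imCLM.contDiff.comp h.sm).differentiable (by norm_num) x
  have d2 : DifferentiableAt ℝ (fun y => (F y).re) x :=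
    (reCLM.contDiff.comp h.sm).differentiable (by norm_num) x
  have d3 : DifferentiableAt ℝ (fun y : ℂ => y.im) x := imCLM.differentiableAt
  have d4 : DifferentiableAt ℝ (fun y : ℂ => y.re) x := reCLM.differentiableAt
  have m1 : DifferentiableAt ℝ (fun y : ℂ => (F y).im * y.re) x := d1.mul d4
  have m2 : DifferentiableAt ℝ (fun y : ℂ => (F y).re * y.im) x := d2.mul d3
  have : be F = fun y => (F y).im * y.re - (F y).re * y.im := rfl
  rw [this, pd_sub m1 m2, pd_mul d1 d4, pd_mul d2 d3, h.re_pd, h.im_pd, pd_re, pd_im]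
lemma vf1 : VF F1 (fun y => -(2 * y)) := ⟨fun x => by
    have := ((hasDerivAt_id x).pow 2).const_sub 1
    exact this.congr_deriv (by simp), by
    have : ContDiff ℂ 1 F1 := contDiff_const.sub (contDiff_id.pow 2)
    exact this.restrict_scalars ℝ⟩
lemma vf2 : VF F2 (fun y => I * (2 * (1 + y))) := ⟨fun x => by
    have := (((hasDerivAt_id x).const_add 1).pow 2).const_mul I
    exact this.congr_deriv (by simp), by
    have : ContDiff ℂ 1 F2 := contDiff_const.mul ((contDiff_const.add contDiff_id).pow 2)
    exact this.restrict_scalars ℝ⟩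
lemma bint_re : bint (fun x => x.re) = 0 := by simp [bint, bpt_re]
lemma bint_im : bint (fun x => x.im) = 0 := by simp [bint, bpt_im]
lemma ff1 : FF F1 (fun y => -(2 * y)) (fun x => x.re) where
  vf := vf1
  tan θ := by
    have := bpt_sq θ
    simp [al, F1, sq]; linear_combination (-(bpt θ).re) * this
  sm := re_S2
  lp x _ := lap_re x
  re x := by simp
  nd θ := by rw [nderiv_eq, pd_re]
  bi := bint_re
  beS := be_S1 vf1
  bet θ := by
    have := bpt_sq θ
    rw [tderiv_eq, be_pd vf1]; simp [F1, sq]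
    linear_combination (-1 * (bpt θ).re) * this
lemma ff2 : FF F2 (fun y => I * (2 * (1 + y))) (fun x => x.im) where
  vf := vf2
  tan θ := by
    have := bpt_sq θ
    simp [al, F2, sq]; linear_combination (-(bpt θ).im) * this
  sm := im_S2
  lp x _ := lap_im x
  re x := by simp
  nd θ := by rw [nderiv_eq, pd_im]
  bi := bint_im
  beS := be_S1 vf2
  bet θ := by
    have := bpt_sq θ
    rw [tderiv_eq, be_pd vf2]; simp [F2, sq]
    linear_combination (-1 * (bpt θ).im) * this
lemma int_inv : IntegrableOn (fun y : ℂ => 1 / ‖1 + y‖) oD := by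
  have h := (integrable_fun_norm_addHaar (E := ℂ) volume
    (f := (Set.Ioo (0:ℝ) 3).indicator fun t => 1 / t)).2 (by
      have e : ∀ y : ℝ, y ^ (Module.finrank ℝ ℂ - 1) • (Set.Ioo (0:ℝ) 3).indicator (fun t => 1 / t) y =
          (Set.Ioo (0:ℝ) 3).indicator (fun _ => 1) y := by
        intro y
        by_cases hy : y ∈ Set.Ioo (0:ℝ) 3
        · simp [hy, Complex.finrank_real_complex, hy.1.ne']
        · simp [hy]
      simp only [e]
      have : Integrable ((Set.Ioo (0:ℝ) 3).indicator (fun _ => (1:ℝ))) volume :=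
        (integrable_indicator_iff measurableSet_Ioo).2 (integrableOn_const (by simp))
      exact this.integrableOn)
  have h2 := (h.comp_add_left 1).integrableOn (s := oD)
  refine h2.congr_fun (fun y hy => ?_) mD
  have hy := oD_norm hy
  have a : 0 < ‖1 + y‖ := by
    have h := norm_sub_norm_le (1:ℂ) (-y)
    rw [norm_neg, sub_neg_eq_add, norm_one] at h; linarith
  have b : ‖1 + y‖ < 3 := by
    have h := norm_add_le (1:ℂ) y
    rw [norm_one] at h; linarith
  simp only
  exact Set.indicator_of_mem (s := Set.Ioo (0:ℝ) 3) ⟨a, b⟩ _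
def gB (θ : ℝ) : ℝ := 1 / √|θ - π|
lemma gB_int : IntervalIntegrable gB volume 0 (2 * π) := by
  have h : ∀ a b : ℝ, IntervalIntegrable (fun x : ℝ => x ^ (-(1/2) : ℝ)) volume a b :=
    fun a b => intervalIntegral.intervalIntegrable_rpow' (by norm_num)
  have h1 : IntervalIntegrable (fun x : ℝ => (x - π) ^ (-(1/2) : ℝ)) volume 0 (2 * π) := by
    simpa using (h (0 - π) (2 * π - π)).comp_sub_right π
  have h2 : IntervalIntegrable (fun x : ℝ => (π - x) ^ (-(1/2) : ℝ)) volume 0 (2 * π) := by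
    have := (h (π - 0) (π - 2 * π)).comp_sub_left π
    simpa using this
  refine (h1.add h2).congr (fun x _ => ?_)
  have neg : ∀ t : ℝ, t < 0 → t ^ (-(1/2) : ℝ) = 0 := fun t ht => by
    rw [Real.rpow_def_of_neg ht]
    have : -(1/2) * π = -(π/2) := by ring
    rw [this, cos_neg, cos_pi_div_two, mul_zero]
  have pos : ∀ t : ℝ, 0 < t → t ^ (-(1/2) : ℝ) = 1 / √t := fun t ht => by
    rw [Real.rpow_neg ht.le, sqrt_eq_rpow, one_div, one_div]
  unfold gB
  rcases lt_trichotomy x π with hx | hx | hx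
  · rw [neg _ (by linarith), pos _ (by linarith), abs_of_neg (by linarith)]; simp
  · subst hx; simp
  · rw [neg (π - x) (by linarith), pos _ (by linarith), abs_of_pos (by linarith)]; simp
lemma gB_nonneg (θ : ℝ) : 0 ≤ gB θ := by unfold gB; positivity
lemma bdct {F : ℕ → ℂ → ℝ} {A B : ℝ} (hF : ∀ n, ContinuousOn (F n) cD)
    (hb : ∀ n, ∀ θ ∈ Set.Icc 0 (2 * π), θ ≠ π → |F n (bpt θ)| ≤ A + B * gB θ)
    (hl : ∀ θ ∈ Set.Icc 0 (2 * π), θ ≠ π →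
      Tendsto (fun n => F n (bpt θ)) atTop (nhds (f (bpt θ)))) :
    Tendsto (fun n => bint (F n)) atTop (nhds (bint f)) := by
  have hne : ∀ᵐ θ : ℝ ∂volume, θ ≠ π := by simp [ae_iff]
  refine intervalIntegral.tendsto_integral_filter_of_dominated_convergence (fun θ => A + B * gB θ)
    (Eventually.of_forall fun n => (cont_b (hF n)).aestronglyMeasurable)
    (Eventually.of_forall fun n => ?_) ((intervalIntegrable_const).add (gB_int.const_mul B)) ?_
  · filter_upwards [hne] with θ h hθ
    rw [Set.uIoc_of_le two_pi_nonneg] at hθ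
    exact hb n θ ⟨hθ.1.le, hθ.2⟩ h
  · filter_upwards [hne] with θ h hθ
    rw [Set.uIoc_of_le two_pi_nonneg] at hθ
    exact hl θ ⟨hθ.1.le, hθ.2⟩ h
lemma bbound {A B : ℝ} (hf : ContinuousOn f cD)
    (hb : ∀ θ ∈ Set.Icc 0 (2 * π), θ ≠ π → |f (bpt θ)| ≤ A + B * gB θ) :
    bint (fun x => |f x|) ≤ 2 * π * A + B * ∫ θ in 0..(2 * π), gB θ := by
  have hne : ∀ᵐ θ : ℝ ∂volume, θ ≠ π := by simp [ae_iff]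
  have i := (intervalIntegrable_const (c := A)).add (gB_int.const_mul B)
  have e : ∫ θ in 0..(2 * π), (A + B * gB θ) = 2 * π * A + B * ∫ θ in 0..(2 * π), gB θ := by
    rw [intervalIntegral.integral_add intervalIntegrable_const (gB_int.const_mul B)]; simp
  rw [← e]
  refine intervalIntegral.integral_mono_ae_restrict two_pi_nonneg (intB hf.abs _ _) i ?_
  rw [EventuallyLE, ae_restrict_iff' measurableSet_Icc]
  filter_upwards [hne] with θ h hθ using hb θ hθ h
lemma bpt_far {θ : ℝ} (h : θ ∈ Set.Icc 0 (2 * π)) : |θ - π| / 2 ≤ ‖1 + bpt θ‖ := by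
  have hp := pi_pos
  have e : ‖1 + bpt θ‖ ^ 2 = (2 * sin ((θ - π) / 2)) ^ 2 := by
    have e1 := nsq (1 + bpt θ)
    rw [e1]
    have s := bpt_sq θ
    have c : (bpt θ).re = - (1 - 2 * sin ((θ - π) / 2) ^ 2) := by
      rw [bpt_re]
      have := cos_two_mul ((θ - π) / 2)
      have h2 := sin_sq_add_cos_sq ((θ - π) / 2)
      rw [show 2 * ((θ - π) / 2) = θ - π by ring, cos_sub_pi] at this
      linarith
    simp
    linear_combination s + 2 * c
  have e2 := (sq_eq_sq_iff_abs_eq_abs _ _).1 e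
  rw [abs_of_nonneg (norm_nonneg _)] at e2
  rw [e2, abs_mul, abs_of_pos (by norm_num : (0:ℝ) < 2)]
  have key : ∀ t, 0 ≤ t → t ≤ π / 2 → t / 2 ≤ sin t := fun t h0 h1 => by
    have := Real.mul_le_sin h0 h1
    refine le_trans ?_ this
    have : (1:ℝ)/2 ≤ 2 / π := by rw [div_le_div_iff₀ (by norm_num) hp]; linarith [pi_le_four]
    nlinarith
  rcases le_total π θ with h3 | h3
  · have := key ((θ - π) / 2) (by linarith) (by linarith [h.2])
    rw [abs_of_nonneg (by linarith), abs_of_nonneg (by linarith)]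
    linarith
  · have := key (-((θ - π) / 2)) (by linarith) (by linarith [h.1])
    rw [sin_neg] at this
    rw [abs_of_nonpos (by linarith), abs_of_nonpos (by linarith)]
    linarith
lemma log_abs_le {s : ℝ} (h0 : 0 < s) (h2 : s ≤ 2) : |log s| ≤ 2 / √s := by
  have hs : 0 < √s := sqrt_pos.2 h0
  have e : log s = 2 * log (√s) := by rw [log_sqrt h0.le]; ring
  have e1 := add_one_le_exp (log (√s))
  have e2 := add_one_le_exp (-log (√s))
  rw [exp_log hs] at e1
  rw [exp_neg, exp_log hs] at e2
  have h3 : √s * (√s)⁻¹ = 1 := mul_inv_cancel₀ hs.ne'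
  have h4 : √s ^ 2 = s := sq_sqrt h0.le
  have hi : 0 < (√s)⁻¹ := inv_pos.2 hs
  have h5 : √s - 1 ≤ (√s)⁻¹ := by
    have : √s * (√s - 1) ≤ 1 := by nlinarith
    have : (√s)⁻¹ * (√s * (√s - 1)) ≤ (√s)⁻¹ * 1 := mul_le_mul_of_nonneg_left this hi.le
    rw [← mul_assoc, mul_comm (√s)⁻¹, h3] at this; linarith
  rw [e, abs_le, div_eq_mul_inv]
  constructor <;> linarith
section
variable {r : ℝ}
lemma el_disk (h0 : 0 < r) (h1 : r < 1) (hy : y ∈ oD) : |el r y| ≤ 8 * (1 / ‖1 + y‖) := by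
  have hp := den_pos h0 h1 (oD_sub hy)
  have h2 := den_hi h0 h1 (oD_sub hy)
  have h3 := den_lo2 h0 h1 (oD_sub hy)
  have a : 0 < ‖1 + y‖ := by
    have h := norm_sub_norm_le (1:ℂ) (-y)
    rw [norm_neg, sub_neg_eq_add, norm_one] at h; linarith [oD_norm hy]
  refine (log_abs_le hp h2).trans ?_
  have hs : 0 < √‖1 + r * y‖ := sqrt_pos.2 hp
  rw [mul_one_div, div_le_div_iff₀ hs a]
  have h4 : √‖1 + r * y‖ ^ 2 = ‖1 + r * y‖ := sq_sqrt hp.le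
  have h5 : √‖1 + r * y‖ ≤ 2 := by nlinarith
  nlinarith
lemma den_circ (h0 : 0 < r) (h1 : r < 1) {θ : ℝ} (h : θ ∈ Set.Icc 0 (2 * π)) :
    |θ - π| / 4 ≤ ‖1 + r * bpt θ‖ := by
  linarith [den_lo2 h0 h1 (bpt_mem θ), bpt_far h]
lemma el_circ (h0 : 0 < r) (h1 : r < 1) {θ : ℝ} (h : θ ∈ Set.Icc 0 (2 * π)) (hθ : θ ≠ π) :
    |el r (bpt θ)| ≤ 4 * gB θ := by
  have hp := den_pos h0 h1 (bpt_mem θ)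
  have hpos : 0 < |θ - π| := abs_pos.2 (sub_ne_zero.2 hθ)
  refine (log_abs_le hp (den_hi h0 h1 (bpt_mem θ))).trans ?_
  unfold gB
  rw [mul_one_div, div_le_div_iff₀ (sqrt_pos.2 hp) (sqrt_pos.2 hpos)]
  have : √|θ - π| ≤ √(2 ^ 2 * ‖1 + r * bpt θ‖) :=
    sqrt_le_sqrt (by linarith [den_circ h0 h1 h])
  rw [sqrt_mul (by norm_num), sqrt_sq (by norm_num)] at this
  linarith
lemma el_log (h0 : 0 < r) (h1 : r < 1) (hy : y ∈ cD) : |el r y| ≤ 1 + |log (1 - r)| := by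
  have hp := den_pos h0 h1 hy
  have a := log_le_log (by linarith) (den_lo h0 hy)
  have b := log_le_log hp (den_hi h0 h1 hy)
  have c := log_two_lt_d9
  unfold el
  rw [abs_le]
  constructor
  · linarith [neg_abs_le (log (1 - r))]
  · linarith [abs_nonneg (log (1 - r))]
end
def dl (ε : ℝ) : ℝ := ε / (1 + ε)
structure Dat where
  K : ℂ → ℝ
  H : ℂ → ℝ
  p : ℂ
  C : ℝ
  ε : ℕ → ℝ
  q : ℕ → ℂ
  r : ℕ → ℝ
  u : ℕ → ℂ → ℝ
namespace Dat
variable (D : Dat)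
def δ (n : ℕ) : ℝ := dl (D.ε n)
def m (n : ℕ) : ℂ → ℂ := mg (D.q n) (D.r n)
def V (n : ℕ) : ℂ → ℝ := vv (D.u n) (D.q n) (D.r n)
def L (n : ℕ) : ℂ → ℝ := LL (D.δ n) (D.q n) (D.r n)
def W (n : ℕ) : ℂ → ℝ := ww (D.δ n) (D.u n) (D.q n) (D.r n)
def Kf (n : ℕ) (y : ℂ) : ℝ := Keps D.K (D.ε n) (D.m n y)
def Hf (n : ℕ) (y : ℂ) : ℝ := D.H (D.m n y) / (1 + D.ε n)
structure OK : Prop where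
  hK : ContDiff ℝ 1 D.K
  hH : ContDiff ℝ 1 D.H
  hp : ‖D.p‖ = 1
  C0 : 0 ≤ D.C
  bK : ∀ x ∈ cD, |D.K x| ≤ D.C
  bH : ∀ x ∈ cD, |D.H x| ≤ D.C
  dK : ∀ x ∈ cD, ‖fderiv ℝ D.K x‖ ≤ D.C
  dH : ∀ x ∈ cD, ‖fderiv ℝ D.H x‖ ≤ D.C
  q1 : ∀ n, ‖D.q n‖ = 1
  r0 : ∀ n, 0 < D.r n
  r1 : ∀ n, D.r n < 1
  rl : Tendsto D.r atTop (nhds 1)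
  ql : Tendsto D.q atTop (nhds D.p)
  εl : Tendsto D.ε atTop (nhds 0)
  ε2 : ∀ n, |D.ε n| ≤ 1 / 2
  uS : ∀ n, ContDiff ℝ 2 (D.u n)
  eq1 : ∀ n, ∀ x ∈ oD, lap (D.u n) x + D.δ n = -2 * Keps D.K (D.ε n) x * exp (D.u n x)
  eq2 : ∀ n, ∀ x : ℂ, ‖x‖ = 1 → nderiv (D.u n) x =
    2 * (D.H x / (1 + D.ε n)) * exp (D.u n x / 2) - 2 + 2 * D.δ n
  vb : ∀ n, ∀ y ∈ cD, |D.V n y| ≤ D.C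
  b1 : ∀ n, ∫ y in oD, y.re * exp (D.V n y) = 0
  b2 : ∀ n, ∫ y in oD, y.im * exp (D.V n y) = 0
end Dat
open Dat
namespace Dat.OK
variable {D : Dat}
lemma epos (h : D.OK) (n : ℕ) : 1 / 2 ≤ 1 + D.ε n := by
  have := (abs_le.1 (h.ε2 n)).1; linarith
lemma d1 (h : D.OK) (n : ℕ) : |D.δ n| ≤ 1 := by
  have := h.epos n
  unfold δ dl
  rw [abs_div, abs_of_pos (by linarith : 0 < 1 + D.ε n), div_le_one (by linarith)]
  linarith [h.ε2 n]
lemma dlim (h : D.OK) : Tendsto D.δ atTop (nhds 0) := by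
  have h1 : Tendsto (fun n => 1 + D.ε n) atTop (nhds (1 + 0)) := h.εl.const_add 1
  have := h.εl.div h1 (by norm_num)
  simp only [zero_div] at this
  exact this
lemma divb (h : D.OK) (n : ℕ) (t A : ℝ) (ht : |t| ≤ A) : |t / (1 + D.ε n)| ≤ 2 * A := by
  have := h.epos n
  rw [abs_div, abs_of_pos (by linarith : 0 < 1 + D.ε n), div_le_iff₀ (by linarith)]
  nlinarith [abs_nonneg t]
lemma mC (h : D.OK) (n : ℕ) (hy : y ∈ cD) : D.m n y ∈ cD :=
  mg_cD (h.q1 n) (h.r0 n) (h.r1 n) hy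
lemma Kfb (h : D.OK) (n : ℕ) (hy : y ∈ cD) : |D.Kf n y| ≤ 2 * (D.C + 1) := by
  refine h.divb n _ _ ?_
  have := abs_sub (D.K (D.m n y)) (D.ε n / 2)
  have h2 := h.ε2 n
  have h3 := h.bK _ (h.mC n hy)
  rw [abs_div, abs_of_pos (by norm_num : (0:ℝ) < 2)] at this
  linarith
lemma Hfb (h : D.OK) (n : ℕ) (hy : y ∈ cD) : |D.Hf n y| ≤ 2 * D.C :=
  h.divb n _ _ (h.bH _ (h.mC n hy))
lemma WS (h : D.OK) (n : ℕ) : S2 (D.W n) := ww_S2 (h.uS n) (h.r0 n) (h.r1 n)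
lemma VS (h : D.OK) (n : ℕ) : S2 (D.V n) := vv_S2 (h.uS n) (h.r0 n) (h.r1 n)
lemma LS (h : D.OK) (n : ℕ) : S2 (D.L n) := LL_S2 _ (h.r0 n) (h.r1 n)
lemma HfS (h : D.OK) (n : ℕ) : S1 (D.Hf n) := fun y hy =>
  ((comp_S1 (q := D.q n) (h.r0 n) (h.r1 n) h.hH y hy).div_const _)
lemma KfS (h : D.OK) (n : ℕ) : S1 (D.Kf n) := fun y hy =>
  (((comp_S1 (q := D.q n) (h.r0 n) (h.r1 n) h.hK y hy).sub contDiffAt_const).div_const _)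
lemma VWL (n : ℕ) (y : ℂ) : D.V n y = D.W n y + D.L n y := by
  unfold V W L ww; ring
lemma Wlap (h : D.OK) (n : ℕ) (hy : y ∈ oD) :
    lap (D.W n) y = -2 * D.Kf n y * exp (D.V n y) :=
  ww_lap (h.uS n) (h.q1 n) (h.r0 n) (h.r1 n) hy
    (h.eq1 n _ (mg_oD (h.q1 n) (h.r0 n) (h.r1 n) hy))
lemma Wnd (h : D.OK) (n : ℕ) (θ : ℝ) : nderiv (D.W n) (bpt θ) =
    2 * D.Hf n (bpt θ) * exp (D.V n (bpt θ) / 2) - 2 + 5 * D.δ n / 2 :=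
  ww_nd (h.uS n) (h.q1 n) (h.r0 n) (h.r1 n) θ
    (h.eq2 n _ (mg_circ (h.q1 n) (h.r0 n) (h.r1 n) θ))
lemma Ve (h : D.OK) (n : ℕ) (hy : y ∈ cD) : exp (D.V n y) ≤ exp D.C :=
  exp_le_exp.2 (abs_le.1 (h.vb n y hy)).2
lemma Ve2 (h : D.OK) (n : ℕ) (hy : y ∈ cD) : exp (D.V n y / 2) ≤ exp D.C :=
  exp_le_exp.2 (by linarith [(abs_le.1 (h.vb n y hy)).2, h.C0])
lemma Lb (h : D.OK) (n : ℕ) (hy : y ∈ cD) : |D.L n y| ≤ |D.δ n| * (1 + 5 * |el (D.r n) y|) := by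
  have hm := cD_norm (h.mC n hy)
  have h0 := norm_nonneg (D.m n y)
  have e : D.L n y = D.δ n * (-(1/4) * (‖D.m n y‖ ^ 2 - 1) - 5 * el (D.r n) y) := by
    unfold L LL m; ring
  rw [e, abs_mul]
  refine mul_le_mul_of_nonneg_left ?_ (abs_nonneg _)
  refine (abs_sub _ _).trans ?_
  rw [abs_mul 5, abs_of_pos (by norm_num : (0:ℝ) < 5)]
  have : |-(1/4) * (‖D.m n y‖ ^ 2 - 1)| ≤ 1 := by rw [abs_le]; constructor <;> nlinarith
  linarith
lemma L1 (h : D.OK) (n : ℕ) (hy : y ∈ cD) : |D.L n y| ≤ 1 + 5 * |el (D.r n) y| :=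
  (h.Lb n hy).trans (by nlinarith [h.d1 n, abs_nonneg (el (D.r n) y)])
lemma BFx (h : D.OK) : ∃ C1, 1 ≤ C1 ∧ ∀ n, BF C1 (D.W n) ∧ ∀ y ∈ cD, |D.L n y| ≤ C1 := by
  set E := exp D.C
  have hE : 0 < E := exp_pos _
  set I1 := ∫ y in oD, ((D.C + 1) + 40 * (1 / ‖1 + y‖))
  set I2 := 2 * π * (D.C + 1) + 20 * ∫ θ in 0..(2 * π), gB θ
  set A := 4 * (D.C + 1) * E + 5 + |I1| + |I2|
  have C0 := h.C0
  have l1 : ∀ n, ∀ y ∈ oD, |lap (D.W n) y| ≤ A := fun n y hy => by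
    rw [h.Wlap n hy, abs_mul, abs_mul, abs_exp]
    have a := h.Kfb n (oD_sub hy)
    have b := h.Ve n (oD_sub hy)
    have : |(-2:ℝ)| * |D.Kf n y| * exp (D.V n y) ≤ 2 * (2 * (D.C + 1)) * E := by
      rw [abs_neg, abs_of_pos (by norm_num : (0:ℝ) < 2)]
      gcongr
    linarith [abs_nonneg I1, abs_nonneg I2]
  have l2 : ∀ n θ, |nderiv (D.W n) (bpt θ)| ≤ A := fun n θ => by
    have a := h.Hfb n (bpt_mem θ)
    have b := h.Ve2 n (bpt_mem θ)
    have d := abs_le.1 (h.d1 n)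
    have : |D.Hf n (bpt θ) * exp (D.V n (bpt θ) / 2)| ≤ (2 * D.C) * E := by
      rw [abs_mul, abs_exp]; gcongr
    have := abs_le.1 this
    have := abs_nonneg I1
    have := abs_nonneg I2
    rw [h.Wnd, abs_le]
    constructor <;> nlinarith
  have wb : ∀ n, ∀ y ∈ cD, |D.W n y| ≤ D.C + 1 + 5 * |el (D.r n) y| := fun n y hy => by
    have e : D.W n y = D.V n y - D.L n y := by rw [VWL n]; ring
    rw [e]
    exact (abs_sub _ _).trans (by linarith [h.vb n y hy, h.L1 n hy])
  have l3 : ∀ n, ∫ y in oD, |D.W n y| ≤ A := fun n => by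
    have : ∫ y in oD, |D.W n y| ≤ I1 := by
      refine setIntegral_mono_on (intD (h.WS n).s1.cont.abs)
        ((intD continuousOn_const).add (int_inv.const_mul 40)) mD fun y hy => ?_
      have a := wb n y (oD_sub hy)
      have b := el_disk (h.r0 n) (h.r1 n) hy
      linarith
    have := le_abs_self I1
    have := abs_nonneg I2
    have : 0 ≤ 4 * (D.C + 1) * E := by positivity
    linarith
  have l4 : ∀ n, bint (fun y => |D.W n y|) ≤ A := fun n => by
    have : bint (fun y => |D.W n y|) ≤ I2 := bbound (h.WS n).s1.cont fun θ hθ hne => by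
      have a := wb n _ (bpt_mem θ)
      have b := el_circ (h.r0 n) (h.r1 n) hθ hne
      linarith
    have := le_abs_self I2
    have := abs_nonneg I1
    have : 0 ≤ 4 * (D.C + 1) * E := by positivity
    linarith
  set B := 2 * π * A ^ 2 + 2 * A * (vD + 2 * A ^ 2)
  set T := A + (1 + B) / 2 * √(2 * π)
  have l5 : ∀ n θ, |D.W n (bpt θ)| ≤ T := fun n θ =>
    sup_trace (h.WS n) (trace_energy (h.WS n) (l1 n) (l2 n)
      (energy (h.WS n) (l1 n) (l2 n) (l3 n) (l4 n))) (l4 n) θ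
  have l6 : ∀ n, 5 * |D.δ n * log (1 - D.r n)| ≤ D.C + T := fun n => by
    have e : D.L n (bpt π) = -5 * (D.δ n * log (1 - D.r n)) := by
      unfold L LL
      rw [mg_circ (h.q1 n) (h.r0 n) (h.r1 n), el]
      have : bpt π = -1 := by rw [bpt, Complex.exp_pi_mul_I]
      have e2 : 1 + (D.r n : ℂ) * bpt π = ((1 - D.r n : ℝ) : ℂ) := by rw [this]; push_cast; ring
      rw [e2, norm_real, Real.norm_of_nonneg (by linarith [h.r1 n])]; ring
    have a := h.vb n _ (bpt_mem π)
    have b := l5 n π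
    have e3 : -5 * (D.δ n * log (1 - D.r n)) = D.V n (bpt π) - D.W n (bpt π) := by
      rw [← e, VWL n]; ring
    have e4 := congrArg abs e3
    rw [abs_mul, abs_neg, abs_of_pos (by norm_num : (0:ℝ) < 5)] at e4
    rw [e4]; exact (abs_sub _ _).trans (by linarith)
  have T0 : 0 ≤ T := (abs_nonneg _).trans (l5 0 0)
  have A0 : 0 ≤ A := (abs_nonneg _).trans (l2 0 0)
  set C1 := 6 + D.C + T + D.C + A
  have l7 : ∀ n, ∀ y ∈ cD, |D.L n y| ≤ 6 + D.C + T := fun n y hy => by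
    have a := h.Lb n hy
    have b := el_log (h.r0 n) (h.r1 n) hy
    have c := l6 n
    rw [abs_mul] at c
    have d := h.d1 n
    have := abs_nonneg (D.δ n)
    nlinarith [mul_le_mul_of_nonneg_left b this]
  refine ⟨C1, by linarith, fun n => ⟨⟨h.WS n, fun y hy => ?_, fun y hy => (l1 n y hy).trans (by linarith),
    fun θ => (l2 n θ).trans (by linarith)⟩, fun y hy => (l7 n y hy).trans (by linarith)⟩⟩
  have e : D.W n y = D.V n y - D.L n y := by rw [VWL n]; ring
  rw [e]
  exact (abs_sub _ _).trans (by linarith [h.vb n y hy, l7 n y hy])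
lemma ml (h : D.OK) (hy : 1 + y ≠ 0) : Tendsto (fun n => D.m n y) atTop (nhds D.p) := by
  have hr : Tendsto (fun n => (D.r n : ℂ)) atTop (nhds 1) := by
    have := (Complex.continuous_ofReal.tendsto 1).comp h.rl
    simpa [Function.comp_def] using this
  have h1 : Tendsto (fun n => 1 + (D.r n : ℂ) * y) atTop (nhds (1 + 1 * y)) :=
    (hr.mul_const y).const_add 1
  have := h.ql.mul ((hr.add_const y).div h1 (by rwa [one_mul]))
  rw [one_mul, div_self hy, mul_one] at this
  exact this
lemma dvl (h : D.OK) {f : ℕ → ℝ} {l : ℝ} (hf : Tendsto f atTop (nhds l)) :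
    Tendsto (fun n => f n / (1 + D.ε n)) atTop (nhds l) := by
  have h1 : Tendsto (fun n => 1 + D.ε n) atTop (nhds (1 + 0)) := h.εl.const_add 1
  have := hf.div h1 (by norm_num)
  simp only [add_zero, div_one] at this
  exact this
lemma Kfl (h : D.OK) (hy : 1 + y ≠ 0) : Tendsto (fun n => D.Kf n y) atTop (nhds (D.K D.p)) := by
  refine h.dvl ?_
  have := ((h.hK.continuous.tendsto _).comp (h.ml hy)).sub (h.εl.div_const 2)
  simpa using this
lemma Hfl (h : D.OK) (hy : 1 + y ≠ 0) : Tendsto (fun n => D.Hf n y) atTop (nhds (D.H D.p)) :=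
  h.dvl ((h.hH.continuous.tendsto _).comp (h.ml hy))
lemma one_add_disk (hy : y ∈ oD) : 1 + y ≠ 0 := fun e => by
  have : y = -1 := by linear_combination e
  have h := oD_norm hy
  rw [this] at h; simp at h
lemma one_add_circ {θ : ℝ} (h : θ ∈ Set.Icc 0 (2 * π)) (hn : θ ≠ π) : 1 + bpt θ ≠ 0 := fun e => by
  have := bpt_far h
  rw [e, norm_zero] at this
  have := abs_pos.2 (sub_ne_zero.2 hn)
  linarith
lemma Ll_disk (h : D.OK) (hy : y ∈ oD) : Tendsto (fun n => D.L n y) atTop (nhds 0) := by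
  refine squeeze_zero_norm (fun n => ?_) (a := fun n => |D.δ n| * (1 + 40 * (1 / ‖1 + y‖))) ?_
  · refine (h.Lb n (oD_sub hy)).trans (mul_le_mul_of_nonneg_left ?_ (abs_nonneg _))
    linarith [el_disk (h.r0 n) (h.r1 n) hy]
  · simpa using (h.dlim.abs).mul_const (1 + 40 * (1 / ‖1 + y‖))
lemma Ll_circ (h : D.OK) {θ : ℝ} (hθ : θ ∈ Set.Icc 0 (2 * π)) (hn : θ ≠ π) :
    Tendsto (fun n => D.L n (bpt θ)) atTop (nhds 0) := by
  refine squeeze_zero_norm (fun n => ?_) (a := fun n => |D.δ n| * (1 + 20 * gB θ)) ?_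
  · refine (h.Lb n (bpt_mem θ)).trans (mul_le_mul_of_nonneg_left ?_ (abs_nonneg _))
    linarith [el_circ (h.r0 n) (h.r1 n) hθ hn]
  · simpa using (h.dlim.abs).mul_const (1 + 20 * gB θ)
lemma expWl {C1 : ℝ} (h : D.OK) (hC : D.C ≤ C1) (n : ℕ) (hy : y ∈ cD) (hw : |D.W n y| ≤ C1) :
    |exp (D.V n y) - exp (D.W n y)| ≤ exp C1 * |D.L n y| := by
  have := exp_lip (a := D.V n y) (b := D.W n y) (C := C1)
    ((abs_le.1 (h.vb n y hy)).2.trans hC) (abs_le.1 hw).2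
  rwa [show D.V n y - D.W n y = D.L n y by rw [VWL n]; ring] at this
lemma expWl2 {C1 : ℝ} (h : D.OK) (hC : D.C ≤ C1) (n : ℕ) (hy : y ∈ cD) (hw : |D.W n y| ≤ C1) :
    |exp (D.V n y / 2) - exp (D.W n y / 2)| ≤ exp C1 * |D.L n y| := by
  have h0 := h.C0
  have a := (abs_le.1 (h.vb n y hy)).2
  have b := (abs_le.1 hw).2
  have := exp_lip (a := D.V n y / 2) (b := D.W n y / 2) (C := C1) (by linarith) (by linarith)
  rw [show D.V n y / 2 - D.W n y / 2 = D.L n y / 2 by rw [VWL n]; ring, abs_div,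
    abs_of_pos (by norm_num : (0:ℝ) < 2)] at this
  nlinarith [exp_pos C1, abs_nonneg (D.L n y), mul_nonneg (exp_pos C1).le (abs_nonneg (D.L n y))]
theorem AS1 (h : D.OK) : ∃ C1, D.C ≤ C1 ∧ (∀ n, ∀ y ∈ cD, |D.L n y| ≤ C1) ∧
    AS (D.K D.p) (D.H D.p) C1 D.W ∧
    Tendsto (fun n => ∫ x in oD, x.re * exp (D.W n x)) atTop (nhds 0) ∧
    Tendsto (fun n => ∫ x in oD, x.im * exp (D.W n x)) atTop (nhds 0) := by
  obtain ⟨C0, hC0, hb0⟩ := h.BFx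
  have hDC := h.C0
  set C1 := C0 + D.C
  have hC : D.C ≤ C1 := by linarith
  have hb : ∀ n, BF C1 (D.W n) := fun n => (hb0 n).1.mono (by linarith)
  have hL : ∀ n, ∀ y ∈ cD, |D.L n y| ≤ C1 := fun n y hy => ((hb0 n).2 y hy).trans (by linarith)
  set E := exp C1
  have E0 : 0 < E := exp_pos _
  have pp : D.p ∈ cD := by simp [h.hp]
  set k := D.K D.p
  set hh := D.H D.p
  have kb : |k| ≤ D.C := h.bK _ pp
  have hhb : |hh| ≤ D.C := h.bH _ pp
  have cW := fun n => (h.WS n).s1.cont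
  have cV := fun n => (h.VS n).s1.cont
  have cre : ContinuousOn (fun x : ℂ => x.re) cD := continuous_re.continuousOn
  have cim : ContinuousOn (fun x : ℂ => x.im) cD := continuous_im.continuousOn
  have eV : ∀ n, ∀ y ∈ cD, exp (D.V n y) ≤ E := fun n y hy =>
    (h.Ve n hy).trans (exp_le_exp.2 hC)
  have eV2 : ∀ n, ∀ y ∈ cD, exp (D.V n y / 2) ≤ E := fun n y hy =>
    (h.Ve2 n hy).trans (exp_le_exp.2 hC)
  have bary : ∀ c : ℂ → ℝ, ContinuousOn c cD → (∀ x ∈ cD, |c x| ≤ 1) →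
      (∀ n, ∫ x in oD, c x * exp (D.V n x) = 0) →
      Tendsto (fun n => ∫ x in oD, c x * exp (D.W n x)) atTop (nhds 0) := by
    intro c hc hc1 h0
    have e : ∀ n, ∫ x in oD, c x * exp (D.W n x) =
        ∫ x in oD, (c x * exp (D.W n x) - c x * exp (D.V n x)) := fun n => by
      have := cW n
      have := cV n
      rw [dsub (by fun_prop) (by fun_prop), h0]; ring
    simp only [e]
    have z : (0:ℝ) = ∫ x in oD, (0:ℝ) := by simp
    rw [z]
    have bd : ∀ n, ∀ x ∈ oD, |c x * exp (D.W n x) - c x * exp (D.V n x)| ≤ E * |D.L n x| :=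
      fun n x hx => by
        have a := h.expWl hC n (oD_sub hx) ((hb n).bd x (oD_sub hx))
        rw [abs_sub_comm] at a
        rw [← mul_sub, abs_mul]
        have := hc1 x (oD_sub hx)
        have := abs_nonneg (exp (D.W n x) - exp (D.V n x))
        nlinarith
    refine ddct (g := fun _ => E * C1) (fun n => ?_) (intD continuousOn_const) (fun n x hx => ?_) ?_
    · have := cW n
      have := cV n
      have : ContinuousOn (fun x => c x * exp (D.W n x) - c x * exp (D.V n x)) cD := by
        fun_prop
      exact this.mono oD_sub
    · exact (bd n x hx).trans (mul_le_mul_of_nonneg_left (hL n x (oD_sub hx)) E0.le)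
    · filter_upwards [ae_restrict_mem mD] with x hx
      refine squeeze_zero_norm (fun n => bd n x hx) ?_
      simpa using ((h.Ll_disk hx).abs).const_mul E
  refine ⟨C1, hC, hL, ⟨hb, ?_, ?_⟩, bary _ cre (fun x hx => (abs_re_le_norm x).trans (cD_norm hx)) h.b1,
    bary _ cim (fun x hx => (abs_im_le_norm x).trans (cD_norm hx)) h.b2⟩
  · have z : (0:ℝ) = ∫ x in oD, (0:ℝ) := by simp
    have bd : ∀ n, ∀ x ∈ oD, |dE k (D.W n) x| ≤
        2 * E * |D.Kf n x - k| + 2 * D.C * E * |D.L n x| := fun n x hx => by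
      have a := h.expWl hC n (oD_sub hx) ((hb n).bd x (oD_sub hx))
      have e : dE k (D.W n) x = (-2) * ((D.Kf n x - k) * exp (D.V n x)) +
          (-2) * (k * (exp (D.V n x) - exp (D.W n x))) := by
        unfold dE; rw [h.Wlap n hx]; ring
      rw [e]
      refine (abs_add_le _ _).trans ?_
      rw [abs_mul, abs_mul, abs_mul (-2), abs_mul k, abs_exp]
      norm_num
      have := eV n x (oD_sub hx)
      have := abs_nonneg (D.Kf n x - k)
      have := mul_le_mul kb a (abs_nonneg _) hDC
      nlinarith
    rw [z]
    refine ddct (g := fun _ => 2 * E * (2 * (D.C + 1) + D.C) + 2 * D.C * E * C1) (fun n => ?_)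
      (intD continuousOn_const) (fun n x hx => ?_) ?_
    · exact ((h.WS n).dE_cont k).abs.mono oD_sub
    · rw [abs_abs]
      refine (bd n x hx).trans ?_
      have := (abs_sub (D.Kf n x) k).trans (add_le_add (h.Kfb n (oD_sub hx)) kb)
      have := hL n x (oD_sub hx)
      gcongr
    · filter_upwards [ae_restrict_mem mD] with x hx
      refine squeeze_zero_norm (fun n => (abs_abs _).le.trans (bd n x hx)) ?_
      have a := ((h.Kfl (one_add_disk hx)).sub_const k).abs.const_mul (2 * E)
      have b := ((h.Ll_disk hx).abs).const_mul (2 * D.C * E)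
      simpa [k] using a.add b
  · have z : (0:ℝ) = bint (fun _ => (0:ℝ)) := by simp [bint]
    have bd : ∀ n θ, |dN hh (D.W n) (bpt θ)| ≤
        2 * E * |D.Hf n (bpt θ) - hh| + 2 * D.C * E * |D.L n (bpt θ)| + 3 * |D.δ n| := fun n θ => by
      have hx := bpt_mem θ
      have a := h.expWl2 hC n hx ((hb n).bd _ hx)
      have e : dN hh (D.W n) (bpt θ) = 2 * ((D.Hf n (bpt θ) - hh) * exp (D.V n (bpt θ) / 2)) +
          2 * (hh * (exp (D.V n (bpt θ) / 2) - exp (D.W n (bpt θ) / 2))) +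
          5 / 2 * D.δ n := by
        unfold dN; rw [h.Wnd n]; ring
      rw [e]
      refine (abs_add_three _ _ _).trans ?_
      rw [abs_mul, abs_mul, abs_mul 2, abs_mul hh, abs_mul (5/2), abs_exp]
      norm_num
      have := eV2 n _ hx
      have := abs_nonneg (D.Hf n (bpt θ) - hh)
      have := mul_le_mul hhb a (abs_nonneg _) hDC
      have := abs_nonneg (D.δ n)
      nlinarith
    rw [z]
    refine bdct (A := 2 * E * (2 * D.C + D.C) + 2 * D.C * E * C1 + 3) (B := 0) (fun n => ?_)
      (fun n θ hθ hn => ?_) ?_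
    · exact ((h.WS n).dN_cont hh).abs
    · rw [abs_abs]
      refine (bd n θ).trans ?_
      have hx := bpt_mem θ
      have := (abs_sub (D.Hf n (bpt θ)) hh).trans (add_le_add (h.Hfb n hx) hhb)
      have := hL n _ hx
      have := h.d1 n
      have : 2 * E * |D.Hf n (bpt θ) - hh| + 2 * D.C * E * |D.L n (bpt θ)| + 3 * |D.δ n| ≤
        2 * E * (2 * D.C + D.C) + 2 * D.C * E * C1 + 3 * 1 := by gcongr
      linarith
    · intro θ hθ hn
      refine squeeze_zero_norm (fun n => (abs_abs _).le.trans (bd n θ)) ?_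
      have a := ((h.Hfl (one_add_circ hθ hn)).sub_const hh).abs.const_mul (2 * E)
      have b := ((h.Ll_circ hθ hn).abs).const_mul (2 * D.C * E)
      have c := (h.dlim.abs).const_mul 3
      simpa [hh] using (a.add b).add c
end Dat.OK
def gH (H : ℂ → ℝ) (z : ℂ) : ℂ := (fderiv ℝ H z 1 : ℂ) - I * (fderiv ℝ H z I : ℂ)
lemma gH_holo {H : ℂ → ℝ} (h1 : ContDiffOn ℝ 2 H oD) (h2 : ∀ x ∈ oD, lap H x = 0) {x : ℂ}
    (hx : x ∈ oD) : DifferentiableAt ℂ (gH H) x := by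
  have ho : ∀ y ∈ oD, ContDiffAt ℝ 2 H y := fun y hy => h1.contDiffAt (Metric.isOpen_ball.mem_nhds hy)
  have : InnerProductSpace.HarmonicAt H x := by
    refine ⟨ho x hx, ?_⟩
    filter_upwards [Metric.isOpen_ball.mem_nhds hx] with y hy
    rw [InnerProductSpace.laplacian_eq_iteratedFDeriv_complexPlane]
    have hd : DifferentiableAt ℝ (fderiv ℝ H) y :=
      ((ho y hy).fderiv_right (m := 1) (by norm_num)).differentiableAt (by norm_num)
    have e := h2 y hy
    unfold lap pd at e
    rw [fderiv_clm_apply hd (differentiableAt_const _), fderiv_clm_apply hd (differentiableAt_const _)] at e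
    simp only [iteratedFDeriv_two_apply]
    simpa using e
  exact HarmonicAt.differentiableAt_complex_partial this
lemma gH_re (H : ℂ → ℝ) (z v : ℂ) : fderiv ℝ H z v = (gH H z * v).re := by
  have := pd_eq H v z
  unfold pd at this
  rw [this]; simp [gH]; ring
lemma mv {G : ℂ → ℂ} (hc : ContinuousOn G cD) (hd : ∀ z ∈ oD, DifferentiableAt ℂ G z)
    (Λ : ℂ →L[ℝ] ℝ) : bint (fun x => Λ (G x)) = 2 * π * Λ (G 0) := by
  have h := circleAverage_of_differentiable_on_off_countable (f := G) (c := 0) (R := 1)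
    (s := ∅) Set.countable_empty (by simpa using hc) (fun z hz => hd z (by simpa using hz))
  rw [circleAverage_def] at h
  have e : ∀ θ, circleMap 0 1 θ = bpt θ := fun θ => by simp [circleMap, bpt]
  simp only [e] at h
  have hp : (2 * π) ≠ 0 := by positivity
  have h2 : ∫ θ in 0..(2 * π), G (bpt θ) = (2 * π : ℝ) • G 0 := by
    rw [← h, smul_smul, mul_inv_cancel₀ hp, one_smul]
  have hi : IntervalIntegrable (fun θ => G (bpt θ)) volume 0 (2 * π) :=
    (hc.comp_continuous bpt_cont bpt_mem).intervalIntegrable _ _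
  have h3 := Λ.intervalIntegral_comp_comm hi
  unfold bint
  rw [h3, h2, map_smul, smul_eq_mul]
structure GF (F F' : ℂ → ℂ) (ψ : ℂ → ℝ) (E : ℂ → ℂ) : Prop where
  ff : FF F F' ψ
  hE : ∀ y, F y = (1 + y) * E y
  cE : Continuous E
  bE : ∀ y ∈ cD, ‖E y‖ ≤ 2
lemma gf1 : GF F1 (fun y => -(2 * y)) (fun x => x.re) (fun y => 1 - y) where
  ff := ff1
  hE y := by unfold F1; ring
  cE := by fun_prop
  bE y hy := by
    have := norm_sub_le (1:ℂ) y
    rw [norm_one] at this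
    linarith [cD_norm hy]
lemma gf2 : GF F2 (fun y => I * (2 * (1 + y))) (fun x => x.im) (fun y => I * (1 + y)) where
  ff := ff2
  hE y := by unfold F2; ring
  cE := by fun_prop
  bE y hy := by
    have := norm_add_le (1:ℂ) y
    rw [norm_one] at this
    rw [norm_mul, Complex.norm_I, one_mul]
    linarith [cD_norm hy]
def kf (F : ℂ → ℂ) (r : ℝ) (y : ℂ) : ℂ := F y / (1 + r * y) ^ 2
section
variable {F F' : ℂ → ℂ} {ψ : ℂ → ℝ} {E : ℂ → ℂ} {r : ℝ}
lemma GF.Fb (hF : GF F F' ψ E) (h0 : 0 < r) (h1 : r < 1) (hy : y ∈ cD) :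
    ‖F y‖ ≤ 4 * ‖1 + r * y‖ := by
  rw [hF.hE, norm_mul]
  have := hF.bE y hy
  have := den_lo2 h0 h1 hy
  nlinarith [norm_nonneg (1 + y), norm_nonneg (E y)]
lemma GF.kb (hF : GF F F' ψ E) (h0 : 0 < r) (h1 : r < 1) (hy : y ∈ cD) :
    ‖kf F r y‖ ≤ 4 / ‖1 + r * y‖ := by
  have hp := den_pos h0 h1 hy
  unfold kf
  rw [norm_div, norm_pow, div_le_div_iff₀ (by positivity) hp]
  nlinarith [hF.Fb h0 h1 hy]
lemma GF.kan (hF : GF F F' ψ E) (h0 : 0 < r) (h1 : r < 1) (hy : y ∈ cD) :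
    AnalyticAt ℂ (kf F r) y := by
  have hf : Differentiable ℂ F := fun x => (hF.ff.vf.der x).differentiableAt
  have hd : Differentiable ℂ (fun y : ℂ => (1 + r * y) ^ 2) := by fun_prop
  exact (hf.analyticAt y).div (hd.analyticAt y) (pow_ne_zero 2 (den_ne h0 h1 hy))
lemma lin_lap (Λ : ℂ →L[ℝ] ℝ) (x : ℂ) : lap (fun z => Λ z) x = 0 := by
  have : ∀ v z, pd (fun z => Λ z) v z = Λ v := fun v z => by unfold pd; rw [Λ.fderiv]
  simp only [lap_eq, this, pd_const]; simp
lemma GF.kS (hF : GF F F' ψ E) (h0 : 0 < r) (h1 : r < 1) (Λ : ℂ →L[ℝ] ℝ) :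
    S2 (fun y => Λ (kf F r y)) := fun y hy =>
  Λ.contDiff.contDiffAt.comp y ((hF.kan h0 h1 hy).contDiffAt.restrict_scalars ℝ)
lemma GF.klap (hF : GF F F' ψ E) (h0 : 0 < r) (h1 : r < 1) (Λ : ℂ →L[ℝ] ℝ) (hy : y ∈ cD) :
    lap (fun y => Λ (kf F r y)) y = 0 := by
  have ha := hF.kan h0 h1 hy
  have := lap_holo (U := fun z => Λ z) (f := kf F r) (g := deriv (kf F r))
    (ha.eventually_analyticAt.mono fun z hz => hz.differentiableAt.hasDerivAt)
    ha.deriv.differentiableAt.hasDerivAt Λ.contDiff.contDiffAt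
  rw [this, lin_lap, mul_zero]
lemma GF.kmv (hF : GF F F' ψ E) (h0 : 0 < r) (h1 : r < 1) (Λ : ℂ →L[ℝ] ℝ) :
    bint (fun y => Λ (kf F r y)) = 2 * π * Λ (F 0) := by
  rw [mv (fun y hy => (hF.kan h0 h1 hy).continuousAt.continuousWithinAt)
    (fun y hy => (hF.kan h0 h1 (oD_sub hy)).differentiableAt)]
  simp [kf]
lemma GF.kdisk (hF : GF F F' ψ E) (h0 : 0 < r) (h1 : r < 1) (Λ : ℂ →L[ℝ] ℝ) {h k s : ℝ} (hk : k < 0)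
    (hs : 0 < s) (hsk : s ^ 2 = h ^ 2 + k) (hh : 0 < h) (hg : ∀ x ∈ cD, 0 < gg s 0 0 h x) :
    ∫ x in oD, exp (VV s 0 0 h x) * Λ (kf F r x) = 2 * π / (s * (h + s)) * Λ (F 0) := by
  have hP := hF.kS h0 h1 Λ
  have sV := VV_S2 hg
  have gd := greenD hP sV
  have gs : ∀ θ, gg s 0 0 h (bpt θ) = s := fun θ => by rw [gg_bpt]; ring
  have e1 : ∫ x in oD, ((fun y => Λ (kf F r y)) x * lap (VV s 0 0 h) x -
      VV s 0 0 h x * lap (fun y => Λ (kf F r y)) x) =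
      (-2 * k) * ∫ x in oD, exp (VV s 0 0 h x) * Λ (kf F r x) := by
    rw [← dmul]
    refine dcongr fun x hx => ?_
    have a := VV_dE hg (k := k) (by linarith) (oD_sub hx)
    unfold dE at a
    rw [hF.klap h0 h1 Λ (oD_sub hx)]
    linear_combination Λ (kf F r x) * a
  have e2 : bint (fun x => (fun y => Λ (kf F r y)) x * nderiv (VV s 0 0 h) x -
      VV s 0 0 h x * nderiv (fun y => Λ (kf F r y)) x) =
      (2 * h * s⁻¹ - 2) * (2 * π * Λ (F 0)) := by
    have : bint (fun x => (fun y => Λ (kf F r y)) x * nderiv (VV s 0 0 h) x -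
      VV s 0 0 h x * nderiv (fun y => Λ (kf F r y)) x) =
      bint (fun x => (2 * h * s⁻¹ - 2) * Λ (kf F r x) -
        (-2 * log s) * nderiv (fun y => Λ (kf F r y)) x) := bcongr fun θ => by
        have a := VV_dN hg θ
        unfold dN at a
        rw [VV_exp2 (hg _ (bpt_mem θ)), gs] at a
        have b : VV s 0 0 h (bpt θ) = -2 * log s := by unfold VV; rw [gs]
        rw [b]
        linear_combination Λ (kf F r (bpt θ)) * a
    have c1 := hP.s1.cont
    have c2 := hP.s1.nderiv_cont
    rw [this, bsub (f := fun x => (2 * h * s⁻¹ - 2) * Λ (kf F r x))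
      (g := fun x => (-2 * log s) * nderiv (fun y => Λ (kf F r y)) x)
      (continuousOn_const.mul c1) (continuousOn_const.mul c2), bmul, bmul, hF.kmv h0 h1]
    have z : bint (nderiv (fun y => Λ (kf F r y))) = 0 := by
      rw [← int_lap hP, dcongr (g := fun _ => 0) fun x hx => hF.klap h0 h1 Λ (oD_sub hx)]
      simp
    have z' : bint (fun x => nderiv (fun y => Λ (kf F r y)) x) = 0 := z
    rw [z']; ring
  rw [e1, e2] at gd
  have hk2 : k = (s - h) * (s + h) := by linarith
  have hsh : 0 < h + s := by linarith
  refine mul_left_cancel₀ (show (-2 * k) ≠ 0 by linarith) ?_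
  rw [gd, hk2]; field_simp; ring
end
open Dat
namespace Dat
def tt (D : Dat) (n : ℕ) : ℝ := 1 - D.r n ^ 2
def kv (D : Dat) (F : ℂ → ℂ) (n : ℕ) (y : ℂ) : ℂ := D.q n * kf F (D.r n) y
def XX (D : Dat) (F : ℂ → ℂ) (J : ℂ → ℝ) (n : ℕ) (y : ℂ) : ℝ :=
  fderiv ℝ J (D.m n y) (D.kv F n y) / (1 + D.ε n)
def GG (D : Dat) (F : ℂ → ℂ) (n : ℕ) (y : ℂ) : ℝ :=
  -(1 / 2) * D.tt n * ((D.m n y).re * (D.kv F n y).re + (D.m n y).im * (D.kv F n y).im) -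
    5 * (D.r n * (F y / (1 + D.r n * y))).re
end Dat
namespace Dat.OK
variable {D : Dat} {F F' E : ℂ → ℂ} {ψ : ℂ → ℝ}
lemma tpos (h : D.OK) (n : ℕ) : 0 < D.tt n := by
  unfold tt; nlinarith [h.r0 n, h.r1 n]
lemma tlim (h : D.OK) : Tendsto D.tt atTop (nhds 0) := by
  have := (h.rl.pow 2).const_sub 1
  simp only [one_pow, sub_self] at this
  exact this
lemma mgdF (n : ℕ) (y : ℂ) : mgd (D.q n) (D.r n) y * F y = (D.tt n : ℝ) • D.kv F n y := by
  unfold mgd tt kv kf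
  rw [Complex.real_smul]; push_cast; ring
lemma pdJ (h : D.OK) (hJ : ContDiff ℝ 1 J) (n : ℕ) (hy : y ∈ cD) :
    pd (fun y => J (D.m n y)) (F y) y = D.tt n * fderiv ℝ J (D.m n y) (D.kv F n y) := by
  have := pd_holo (mg_der (q := D.q n) (den_ne (h.r0 n) (h.r1 n) hy))
    (hJ.differentiable (by norm_num)).differentiableAt (F y) (U := J)
  rw [mgdF] at this
  exact this.trans (by unfold pd; rw [map_smul]; rfl)
lemma Jd (h : D.OK) (hJ : ContDiff ℝ 1 J) (n : ℕ) (hy : y ∈ cD) :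
    DifferentiableAt ℝ (fun y => J (D.m n y)) y :=
  (comp_S1 (q := D.q n) (h.r0 n) (h.r1 n) hJ).diff hy
lemma pdH (h : D.OK) (n : ℕ) (hy : y ∈ cD) :
    pd (D.Hf n) (F y) y = D.tt n * D.XX F D.H n y := by
  have e : D.Hf n = fun y => (1 + D.ε n)⁻¹ * D.H (D.m n y) := by ext y; unfold Hf; ring
  rw [e, pd_cmul _ (h.Jd h.hH n hy), h.pdJ h.hH n hy]; unfold XX; ring
lemma pdK (h : D.OK) (n : ℕ) (hy : y ∈ cD) :
    pd (D.Kf n) (F y) y = D.tt n * D.XX F D.K n y := by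
  have e : D.Kf n = fun y => (1 + D.ε n)⁻¹ * (D.K (D.m n y) - D.ε n / 2) := by
    ext y; unfold Kf Keps; ring
  have hd := h.Jd h.hK n hy
  have hs : DifferentiableAt ℝ (fun y => D.K (D.m n y) - D.ε n / 2) y := hd.sub_const _
  rw [e, pd_cmul _ hs, pd_sub hd (differentiableAt_const _), pd_const, h.pdJ h.hK n hy]
  unfold XX; ring
lemma mcd (h : D.OK) (n : ℕ) (hy : y ∈ cD) : DifferentiableAt ℝ (D.m n) y :=
  (mg_cd (q := D.q n) (den_ne (h.r0 n) (h.r1 n) hy)).differentiableAt (by norm_num)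
lemma pdL (h : D.OK) (n : ℕ) (hy : y ∈ cD) :
    pd (D.L n) (F y) y = D.δ n * D.GG F n y := by
  have hne := den_ne (h.r0 n) (h.r1 n) hy
  have e : D.L n = fun y => -(D.δ n / 4) * (‖D.m n y‖ ^ 2 - 1) - (5 * D.δ n) * el (D.r n) y := by
    ext y; unfold L LL m; ring
  have d0 : DifferentiableAt ℝ (fun z : ℂ => ‖z‖ ^ 2) (D.m n y) :=
    (sqn_cd _).differentiableAt (by norm_num)
  have d1 : DifferentiableAt ℝ (fun y => ‖D.m n y‖ ^ 2) y := d0.comp y (h.mcd n hy)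
  have d2 : DifferentiableAt ℝ (fun y => ‖D.m n y‖ ^ 2 - 1) y := d1.sub_const _
  have d3 : DifferentiableAt ℝ (fun y => -(D.δ n / 4) * (‖D.m n y‖ ^ 2 - 1)) y := d2.const_mul _
  have d4 : DifferentiableAt ℝ (el (D.r n)) y := (el_cd hne).differentiableAt (by norm_num)
  have d5 : DifferentiableAt ℝ (fun y => (5 * D.δ n) * el (D.r n) y) y := d4.const_mul _
  have e1 : pd (fun y => ‖D.m n y‖ ^ 2) (F y) y =
      2 * ((D.m n y).re * (mgd (D.q n) (D.r n) y * F y).re + (D.m n y).im * (mgd (D.q n) (D.r n) y * F y).im) := by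
    rw [← sqn_pd]
    exact pd_holo (mg_der (q := D.q n) hne) d0 (F y)
  rw [e, pd_sub d3 d5, pd_cmul _ d2, pd_sub d1 (differentiableAt_const _), pd_const, pd_cmul _ d4,
    el_pd hne, e1, mgdF, Complex.smul_re, Complex.smul_im, smul_eq_mul, smul_eq_mul, mul_div_assoc]
  unfold GG; ring
lemma kvc (h : D.OK) (hF : GF F F' ψ E) (n : ℕ) : ContinuousOn (D.kv F n) cD := fun y hy =>
  (continuousAt_const.mul (hF.kan (h.r0 n) (h.r1 n) hy).continuousAt).continuousWithinAt
lemma mc (h : D.OK) (n : ℕ) : ContinuousOn (D.m n) cD := fun y hy =>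
  (h.mcd n hy).continuousAt.continuousWithinAt
lemma XXc (h : D.OK) (hF : GF F F' ψ E) (hJ : ContDiff ℝ 1 J) (n : ℕ) :
    ContinuousOn (D.XX F J n) cD := by
  have h1 : ContinuousOn (fun y => fderiv ℝ J (D.m n y)) cD :=
    (hJ.continuous_fderiv (by norm_num)).comp_continuousOn (h.mc n)
  exact (h1.clm_apply (h.kvc hF n)).div_const _
lemma GGc (h : D.OK) (hF : GF F F' ψ E) (n : ℕ) : ContinuousOn (D.GG F n) cD := by
  have h1 := h.kvc hF n
  have h2 := h.mc n
  have h3 : ContinuousOn (fun y => F y / (1 + D.r n * y)) cD :=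
    hF.ff.vf.cont.continuousOn.div (by fun_prop) fun y hy => den_ne (h.r0 n) (h.r1 n) hy
  have a1 := continuous_re.comp_continuousOn h1
  have a2 := continuous_im.comp_continuousOn h1
  have a3 := continuous_re.comp_continuousOn h2
  have a4 := continuous_im.comp_continuousOn h2
  have a5 := continuous_re.comp_continuousOn (h3.const_smul (D.r n : ℂ))
  exact (continuousOn_const.mul ((a3.mul a1).add (a4.mul a2))).sub (continuousOn_const.mul a5)
lemma kvb (h : D.OK) (hF : GF F F' ψ E) (n : ℕ) (hy : y ∈ cD) :
    ‖D.kv F n y‖ ≤ 4 / ‖1 + D.r n * y‖ := by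
  unfold kv; rw [norm_mul, h.q1, one_mul]; exact hF.kb (h.r0 n) (h.r1 n) hy
lemma XXb (h : D.OK) (hF : GF F F' ψ E) (hJ : ∀ x ∈ cD, ‖fderiv ℝ J x‖ ≤ D.C) (n : ℕ)
    (hy : y ∈ cD) : |D.XX F J n y| ≤ 8 * D.C / ‖1 + D.r n * y‖ := by
  have := h.divb n (fderiv ℝ J (D.m n y) (D.kv F n y)) (D.C * (4 / ‖1 + D.r n * y‖))
    ((ContinuousLinearMap.le_opNorm _ _).trans
      (mul_le_mul (hJ _ (h.mC n hy)) (h.kvb hF n hy) (norm_nonneg _) h.C0))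
  exact this.trans (le_of_eq (by ring))
lemma tb (h : D.OK) (n : ℕ) (hy : y ∈ cD) : D.tt n / ‖1 + D.r n * y‖ ≤ 2 := by
  have := den_lo (h.r0 n) hy
  have h0 := h.r0 n
  have h1 := h.r1 n
  rw [div_le_iff₀ (den_pos h0 h1 hy)]
  unfold tt; nlinarith
lemma GGb (h : D.OK) (hF : GF F F' ψ E) (n : ℕ) (hy : y ∈ cD) : |D.GG F n y| ≤ 24 := by
  have h0 := h.r0 n
  have h1 := h.r1 n
  have hp := den_pos h0 h1 hy
  have a : |D.tt n * ((D.m n y).re * (D.kv F n y).re + (D.m n y).im * (D.kv F n y).im)| ≤ 8 := by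
    rw [abs_mul, abs_of_pos (h.tpos n)]
    have b : |(D.m n y).re * (D.kv F n y).re + (D.m n y).im * (D.kv F n y).im| ≤ 4 / ‖1 + D.r n * y‖ := by
      refine le_trans ?_ (h.kvb hF n hy)
      refine abs_le_of_sq_le_sq ?_ (norm_nonneg _)
      have c := cD_norm (h.mC n hy)
      have c2 : ‖D.m n y‖ ^ 2 ≤ 1 := by nlinarith [norm_nonneg (D.m n y)]
      rw [nsq] at c2 ⊢
      nlinarith [sq_nonneg ((D.m n y).re * (D.kv F n y).im - (D.m n y).im * (D.kv F n y).re),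
        mul_nonneg (sub_nonneg.2 c2) (add_nonneg (sq_nonneg (D.kv F n y).re) (sq_nonneg (D.kv F n y).im))]
    have := mul_le_mul_of_nonneg_left b (h.tpos n).le
    have t := h.tb n hy
    have e : D.tt n * (4 / ‖1 + D.r n * y‖) = 4 * (D.tt n / ‖1 + D.r n * y‖) := by ring
    linarith
  have b : |(D.r n * (F y / (1 + D.r n * y))).re| ≤ 4 := by
    refine (abs_re_le_norm _).trans ?_
    rw [norm_mul, norm_real, Real.norm_of_nonneg h0.le, norm_div]
    have : ‖F y‖ / ‖1 + D.r n * y‖ ≤ 4 := by rw [div_le_iff₀ hp]; exact hF.Fb h0 h1 hy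
    have : 0 ≤ ‖F y‖ / ‖1 + D.r n * y‖ := by positivity
    nlinarith
  unfold GG
  have a := abs_le.1 a
  have b := abs_le.1 b
  rw [abs_le]; constructor <;> linarith
lemma rlC (h : D.OK) : Tendsto (fun n => (D.r n : ℂ)) atTop (nhds 1) := by
  have := (Complex.continuous_ofReal.tendsto 1).comp h.rl
  simpa [Function.comp_def] using this
lemma denl (h : D.OK) (y : ℂ) : Tendsto (fun n => 1 + (D.r n : ℂ) * y) atTop (nhds (1 + y)) := by
  simpa using (h.rlC.mul_const y).const_add 1
lemma kfl (h : D.OK) (hy : 1 + y ≠ 0) :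
    Tendsto (fun n => kf F (D.r n) y) atTop (nhds (F y / (1 + y) ^ 2)) :=
  tendsto_const_nhds.div ((h.denl y).pow 2) (pow_ne_zero 2 hy)
lemma kvl (h : D.OK) (hy : 1 + y ≠ 0) :
    Tendsto (fun n => D.kv F n y) atTop (nhds (D.p * (F y / (1 + y) ^ 2))) :=
  h.ql.mul (h.kfl hy)
lemma XXl (h : D.OK) (hJ : ContDiff ℝ 1 J) (hy : 1 + y ≠ 0) :
    Tendsto (fun n => D.XX F J n y) atTop (nhds (fderiv ℝ J D.p (D.p * (F y / (1 + y) ^ 2)))) := by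
  have h1 := ((hJ.continuous_fderiv (by norm_num)).tendsto D.p).comp (h.ml hy)
  exact h.dvl ((isBoundedBilinearMap_apply.continuous.tendsto (_, _)).comp (h1.prodMk_nhds (h.kvl hy)))
lemma GGl (h : D.OK) (hF : GF F F' ψ E) (hy : 1 + y ≠ 0) :
    Tendsto (fun n => D.GG F n y) atTop (nhds (-5 * (E y).re)) := by
  have rc : ∀ {f : ℕ → ℂ} {l : ℂ}, Tendsto f atTop (nhds l) → Tendsto (fun n => (f n).re) atTop (nhds l.re) :=
    fun hf => (continuous_re.tendsto _).comp hf
  have ic : ∀ {f : ℕ → ℂ} {l : ℂ}, Tendsto f atTop (nhds l) → Tendsto (fun n => (f n).im) atTop (nhds l.im) :=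
    fun hf => (continuous_im.tendsto _).comp hf
  have a := ((rc (h.ml hy)).mul (rc (h.kvl (F := F) hy))).add ((ic (h.ml hy)).mul (ic (h.kvl (F := F) hy)))
  have b := (h.tlim.const_mul (-(1/2))).mul a
  have c := (rc (h.rlC.mul ((tendsto_const_nhds (x := F y)).div (h.denl y) hy))).const_mul 5
  have d := b.sub c
  have e : F y / (1 + y) = E y := by rw [hF.hE]; field_simp
  rw [e] at d
  simp only [one_mul, mul_zero, zero_mul, zero_sub] at d
  rw [neg_mul]
  exact d
end Dat.OK
open Dat
structure Dat.LM (D : Dat) (C1 s : ℝ) : Prop where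
  ok : D.OK
  kn : D.K D.p < 0
  s0 : 0 < s
  hsk : s ^ 2 = D.H D.p ^ 2 + D.K D.p
  hh : 0 < D.H D.p
  hC : D.C ≤ C1
  Lb : ∀ n, ∀ y ∈ cD, |D.L n y| ≤ C1
  bf : ∀ n, BF C1 (D.W n)
  hg : ∀ x ∈ cD, 0 < gg s 0 0 (D.H D.p) x
  ut : ∀ ε > 0, ∃ N, ∀ n ≥ N, ∀ θ, |D.W n (bpt θ) + 2 * log s| ≤ ε
  ae : ∀ᵐ x ∂(volume.restrict oD), Tendsto (fun n => D.W n x) atTop (nhds (VV s 0 0 (D.H D.p) x))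
  ms : ∫ x in oD, exp (VV s 0 0 (D.H D.p) x) = 2 * π / (s * (D.H D.p + s))
  h1 : ContDiffOn ℝ 2 D.H oD
  h2 : ∀ x ∈ oD, lap D.H x = 0
  dn : ∀ n, D.δ n ≠ 0
namespace Dat.LM
variable {D : Dat} {C1 s : ℝ} {F F' E : ℂ → ℂ} {ψ : ℂ → ℝ}
lemma Wb (h : D.LM C1 s) (θ : ℝ) : Tendsto (fun n => D.W n (bpt θ)) atTop (nhds (-2 * log s)) := by
  rw [Metric.tendsto_atTop]
  intro e he
  obtain ⟨N, hN⟩ := h.ut (e / 2) (by linarith)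
  refine ⟨N, fun n hn => ?_⟩
  have := hN n hn θ
  rw [Real.dist_eq]
  rw [show D.W n (bpt θ) - -2 * log s = D.W n (bpt θ) + 2 * log s by ring]
  linarith
lemma expl (h : D.LM C1 s) {f : ℕ → ℝ} (hf : Tendsto f atTop (nhds (-2 * log s))) :
    Tendsto (fun n => exp (f n / 2)) atTop (nhds s⁻¹) := by
  have := (Real.continuous_exp.tendsto _).comp (hf.div_const 2)
  rw [show -2 * log s / 2 = -log s by ring, exp_neg, exp_log h.s0] at this
  exact this
lemma Vb (h : D.LM C1 s) {θ : ℝ} (hθ : θ ∈ Set.Icc 0 (2 * π)) (hn : θ ≠ π) :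
    Tendsto (fun n => exp (D.V n (bpt θ) / 2)) atTop (nhds s⁻¹) := by
  refine h.expl ?_
  have := (h.Wb θ).add (h.ok.Ll_circ hθ hn)
  rw [add_zero] at this
  exact this.congr fun n => (Dat.OK.VWL n _).symm
lemma Vd (h : D.LM C1 s) : ∀ᵐ x ∂(volume.restrict oD),
    Tendsto (fun n => exp (D.V n x)) atTop (nhds (exp (VV s 0 0 (D.H D.p) x))) := by
  filter_upwards [h.ae, ae_restrict_mem mD] with x hx hm
  have := hx.add (h.ok.Ll_disk hm)
  rw [add_zero] at this
  exact (Real.continuous_exp.tendsto _).comp (this.congr fun n => (Dat.OK.VWL n _).symm)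
lemma R1 (h : D.LM C1 s) (hF : GF F F' ψ E) :
    Tendsto (fun n => ∫ x in oD, D.Kf n x * exp (D.V n x) * D.GG F n x) atTop
      (nhds (∫ x in oD, D.K D.p * exp (VV s 0 0 (D.H D.p) x) * (-5 * (E x).re))) := by
  have ok := h.ok
  refine ddct (g := fun _ => 2 * (D.C + 1) * exp D.C * 24) (fun n => ?_) (intD continuousOn_const)
    (fun n x hx => ?_) ?_
  · exact (((ok.KfS n).cont.mul (ok.VS n).s1.cont.rexp).mul (ok.GGc hF n)).mono oD_sub
  · rw [abs_mul, abs_mul, abs_exp]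
    have a := ok.Kfb n (oD_sub hx)
    have b := ok.Ve n (oD_sub hx)
    have c := ok.GGb hF n (oD_sub hx)
    have := ok.C0
    gcongr
  · filter_upwards [h.Vd, ae_restrict_mem mD] with x hx hm
    have := Dat.OK.one_add_disk hm
    exact ((ok.Kfl this).mul hx).mul (ok.GGl hF this)
lemma R2 (h : D.LM C1 s) (hF : GF F F' ψ E) :
    Tendsto (fun n => bint (fun x => D.Hf n x * exp (D.V n x / 2) * D.GG F n x)) atTop
      (nhds (bint (fun x => D.H D.p * s⁻¹ * (-5 * (E x).re)))) := by
  have ok := h.ok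
  refine bdct (A := 2 * D.C * exp D.C * 24) (B := 0) (fun n => ?_) (fun n θ hθ hn => ?_) ?_
  · exact ((ok.HfS n).cont.mul ((ok.VS n).s1.cont.div_const 2).rexp).mul (ok.GGc hF n)
  · rw [abs_mul, abs_mul, abs_exp, zero_mul, add_zero]
    have a := ok.Hfb n (bpt_mem θ)
    have b := ok.Ve2 n (bpt_mem θ)
    have c := ok.GGb hF n (bpt_mem θ)
    have := ok.C0
    gcongr
  · intro θ hθ hn
    have := Dat.OK.one_add_circ hθ hn
    exact ((ok.Hfl this).mul (h.Vb hθ hn)).mul (ok.GGl hF this)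
lemma R3 (h : D.LM C1 s) (hF : GF F F' ψ E) :
    Tendsto (fun n => bint (fun x => D.W n x * ψ x)) atTop (nhds 0) := by
  have e : (0:ℝ) = bint (fun x => -2 * log s * ψ x) := by rw [bmul, hF.ff.bi, mul_zero]
  obtain ⟨B, hB⟩ := (isCompact_closedBall (0:ℂ) 1).exists_bound_of_continuousOn hF.ff.sm.s1.cont
  rw [e]
  refine bdct (A := C1 * B) (B := 0) (fun n => (h.ok.WS n).s1.cont.mul hF.ff.sm.s1.cont)
    (fun n θ hθ hn => ?_) fun θ _ _ => (h.Wb θ).mul_const _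
  rw [abs_mul, zero_mul, add_zero]
  exact mul_le_mul ((h.bf n).bd _ (bpt_mem θ)) (hB _ (bpt_mem θ)) (abs_nonneg _) (h.bf n).nonneg
def lam (J : ℂ → ℝ) (p : ℂ) : ℂ →L[ℝ] ℝ := (fderiv ℝ J p).comp (ContinuousLinearMap.mul ℝ ℂ p)
lemma lam_apply (J : ℂ → ℝ) (p v : ℂ) : lam J p v = fderiv ℝ J p (p * v) := rfl
lemma inv2 {r : ℝ} (h0 : 0 < r) (h1 : r < 1) (hy : y ∈ oD) : 1 / ‖1 + r * y‖ ≤ 2 * (1 / ‖1 + y‖) := by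
  have a := den_lo2 h0 h1 (oD_sub hy)
  have b := den_pos h0 h1 (oD_sub hy)
  have c := norm_pos_iff.2 (Dat.OK.one_add_disk hy)
  rw [mul_one_div, div_le_div_iff₀ b c]; linarith
lemma A1 (h : D.LM C1 s) (hF : GF F F' ψ E) :
    Tendsto (fun n => ∫ x in oD, exp (D.V n x) * D.XX F D.K n x) atTop
      (nhds (2 * π / (s * (D.H D.p + s)) * fderiv ℝ D.K D.p (D.p * F 0))) := by
  have ok := h.ok
  set Λ := lam D.K D.p
  have sV := (VV_S2 h.hg).s1.cont
  obtain ⟨B, hB⟩ := (isCompact_closedBall (0:ℂ) 1).exists_bound_of_continuousOn sV.rexp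
  have z : (0:ℝ) = ∫ x in oD, (0:ℝ) := by simp
  have B0 : 0 ≤ B := (norm_nonneg _).trans (hB 0 (by simp))
  have c1 := fun n => (ok.VS n).s1.cont.rexp.mul (ok.XXc hF ok.hK n)
  have c2 := fun n => sV.rexp.mul (hF.kS (ok.r0 n) (ok.r1 n) Λ).s1.cont
  have key : Tendsto (fun n => ∫ x in oD, (exp (D.V n x) * D.XX F D.K n x -
      exp (VV s 0 0 (D.H D.p) x) * Λ (kf F (D.r n) x))) atTop (nhds (∫ x in oD, (0:ℝ))) := by
    refine ddct (g := fun x => (exp D.C * (16 * D.C) + B * (‖Λ‖ * 8)) * (1 / ‖1 + x‖)) (fun n => ?_)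
      (int_inv.const_mul _) (fun n x hx => ?_) ?_
    · exact ((c1 n).sub (c2 n)).mono oD_sub
    · have hi := inv2 (ok.r0 n) (ok.r1 n) hx
      have hC0 := ok.C0
      refine (abs_sub _ _).trans ?_
      rw [add_mul, abs_mul, abs_mul, abs_exp]
      refine add_le_add ?_ ?_
      · rw [mul_assoc]
        refine mul_le_mul (ok.Ve n (oD_sub hx)) ?_ (abs_nonneg _) (exp_pos _).le
        refine (ok.XXb hF ok.dK n (oD_sub hx)).trans ?_
        have := mul_le_mul_of_nonneg_left hi hC0
        calc 8 * D.C / ‖1 + D.r n * x‖ = 8 * (D.C * (1 / ‖1 + D.r n * x‖)) := by ring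
          _ ≤ _ := by linarith
      · rw [mul_assoc]
        refine mul_le_mul (hB x (oD_sub hx)) ?_ (abs_nonneg _) B0
        refine (Λ.le_opNorm _).trans ?_
        rw [mul_assoc]
        refine mul_le_mul_of_nonneg_left ((hF.kb (ok.r0 n) (ok.r1 n) (oD_sub hx)).trans ?_) (norm_nonneg _)
        rw [div_eq_mul_one_div]; linarith
    · filter_upwards [h.Vd, ae_restrict_mem mD] with x hx hm
      have hne := Dat.OK.one_add_disk hm
      have a := hx.mul (ok.XXl (F := F) ok.hK hne)
      have b := ((Λ.continuous.tendsto _).comp (ok.kfl (F := F) hne)).const_mul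
        (exp (VV s 0 0 (D.H D.p) x))
      have := a.sub b
      rw [lam_apply, sub_self] at this
      exact this
  have := key.add_const (2 * π / (s * (D.H D.p + s)) * Λ (F 0))
  rw [← z, zero_add] at this
  refine this.congr fun n => ?_
  have e := dsub (c1 n) (c2 n)
  have e2 := hF.kdisk (ok.r0 n) (ok.r1 n) Λ h.kn h.s0 h.hsk h.hh h.hg
  simp only [Pi.mul_apply] at e
  rw [e, e2]; ring
lemma A2 (h : D.LM C1 s) (hF : GF F F' ψ E) :
    Tendsto (fun n => bint (D.XX F D.H n)) atTop (nhds (2 * π * fderiv ℝ D.H D.p (D.p * F 0))) := by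
  have ok := h.ok
  have e : ∀ n, bint (D.XX F D.H n) =
      2 * π * fderiv ℝ D.H (D.q n * D.r n) (D.q n * F 0) / (1 + D.ε n) := fun n => by
    have hc : ContinuousOn (fun y => gH D.H (D.m n y) * D.kv F n y) cD := by
      have c1 : Continuous (gH D.H) := by
        have := ok.hH.continuous_fderiv (by norm_num)
        unfold gH; fun_prop
      exact (c1.comp_continuousOn (ok.mc n)).mul (ok.kvc hF n)
    have hd : ∀ y ∈ oD, DifferentiableAt ℂ (fun y => gH D.H (D.m n y) * D.kv F n y) y := fun y hy => by
      have a := gH_holo h.h1 h.h2 (mg_oD (ok.q1 n) (ok.r0 n) (ok.r1 n) hy)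
      have b := (mg_der (q := D.q n) (den_ne (ok.r0 n) (ok.r1 n) (oD_sub hy))).differentiableAt
      have c := (hF.kan (ok.r0 n) (ok.r1 n) (oD_sub hy)).differentiableAt
      have d : DifferentiableAt ℂ (fun y => gH D.H (D.m n y)) y := a.comp y b
      exact d.mul (c.const_mul (D.q n))
    have := mv hc hd reCLM
    have e1 : bint (D.XX F D.H n) = bint (fun x => (1 + D.ε n)⁻¹ *
        reCLM (gH D.H (D.m n x) * D.kv F n x)) := by
      refine bcongr fun θ => ?_
      unfold XX; rw [gH_re]; simp only [Complex.reCLM_apply]; ring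
    rw [e1, bmul, this]
    have e2 : D.m n 0 = D.q n * D.r n := by simp [m, mg]
    have e3 : D.kv F n 0 = D.q n * F 0 := by simp [kv, kf]
    rw [e2, e3, Complex.reCLM_apply, ← gH_re]; ring
  simp only [e]
  refine ok.dvl (Tendsto.const_mul _ ?_)
  have l1 : Tendsto (fun n => D.q n * D.r n) atTop (nhds D.p) := by simpa using ok.ql.mul ok.rlC
  have l2 : Tendsto (fun n => D.q n * F 0) atTop (nhds (D.p * F 0)) := ok.ql.mul_const _
  have l3 := ((ok.hH.continuous_fderiv (by norm_num)).tendsto D.p).comp l1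
  exact (isBoundedBilinearMap_apply.continuous.tendsto (_, _)).comp (l3.prodMk_nhds l2)
lemma XXcirc (h : D.LM C1 s) (hF : GF F F' ψ E) (n : ℕ) {θ : ℝ} (hθ : θ ∈ Set.Icc 0 (2 * π)) (hn : θ ≠ π) :
    |D.XX F D.H n (bpt θ)| ≤ 32 * D.C / |θ - π| := by
  have ok := h.ok
  refine (ok.XXb hF ok.dH n (bpt_mem θ)).trans ?_
  have a := den_circ (ok.r0 n) (ok.r1 n) hθ
  have b := den_pos (ok.r0 n) (ok.r1 n) (bpt_mem θ)
  have c := abs_pos.2 (sub_ne_zero.2 hn)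
  have := ok.C0
  rw [div_le_div_iff₀ b c]
  nlinarith
lemma A3 (h : D.LM C1 s) (hF : GF F F' ψ E) :
    Tendsto (fun n => bint (fun x => (exp (D.W n x / 2) - exp (D.W n (bpt π) / 2)) *
      D.XX F D.H n x)) atTop (nhds 0) := by
  have ok := h.ok
  have z : (0:ℝ) = bint (fun _ => (0:ℝ)) := by simp [bint]
  have hC1 := (h.bf 0).nonneg
  have bd : ∀ n θ, |exp (D.W n (bpt θ) / 2) - exp (D.W n (bpt π) / 2)| ≤
      exp C1 * |D.W n (bpt θ) - D.W n (bpt π)| := fun n θ => by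
    have a := (abs_le.1 ((h.bf n).bd _ (bpt_mem θ))).2
    have b := (abs_le.1 ((h.bf n).bd _ (bpt_mem π))).2
    have := exp_lip (a := D.W n (bpt θ) / 2) (b := D.W n (bpt π) / 2) (C := C1) (by linarith) (by linarith)
    rw [← sub_div, abs_div, abs_of_pos (by norm_num : (0:ℝ) < 2)] at this
    nlinarith [mul_nonneg (exp_pos C1).le (abs_nonneg (D.W n (bpt θ) - D.W n (bpt π)))]
  have ho : ∀ n, ∀ θ ∈ Set.Icc 0 (2 * π), |D.W n (bpt θ) - D.W n (bpt π)| ≤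
      (1 + BB C1) / 2 * √|θ - π| := fun n θ hθ => by
    rcases le_total θ π with hl | hl
    · have := holder_trace (ok.WS n) (h.bf n).te hl (by linarith [hθ.1, pi_pos])
      rwa [abs_sub_comm, abs_sub_comm θ, abs_of_nonneg (sub_nonneg.2 hl)]
    · have := holder_trace (ok.WS n) (h.bf n).te hl (by linarith [hθ.2, pi_pos])
      rwa [abs_of_nonneg (sub_nonneg.2 hl)]
  rw [z]
  refine bdct (A := 0) (B := exp C1 * ((1 + BB C1) / 2) * (32 * D.C)) (fun n => ?_)
    (fun n θ hθ hn => ?_) fun θ hθ hn => ?_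
  · exact (((ok.WS n).s1.cont.div_const 2).rexp.sub continuousOn_const).mul (ok.XXc hF ok.hH n)
  · rw [abs_mul, zero_add]
    have c := abs_pos.2 (sub_ne_zero.2 hn)
    have c2 := sqrt_pos.2 c
    have a := (bd n θ).trans (mul_le_mul_of_nonneg_left (ho n θ hθ) (exp_pos C1).le)
    have b := mul_le_mul a (h.XXcirc hF n hθ hn) (abs_nonneg _) ((abs_nonneg _).trans a)
    refine b.trans (le_of_eq ?_)
    unfold gB
    have e : √|θ - π| / |θ - π| = 1 / √|θ - π| := by
      rw [div_eq_div_iff c.ne' c2.ne']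
      rw [Real.mul_self_sqrt c.le, one_mul]
    calc _ = exp C1 * ((1 + BB C1) / 2) * (32 * D.C) * (√|θ - π| / |θ - π|) := by ring
      _ = _ := by rw [e]
  · refine squeeze_zero_norm (a := fun n => exp C1 * |D.W n (bpt θ) - D.W n (bpt π)| *
      (32 * D.C / |θ - π|)) (fun n => ?_) ?_
    · rw [norm_eq_abs, abs_mul]
      exact mul_le_mul (bd n θ) (h.XXcirc hF n hθ hn) (abs_nonneg _) ((abs_nonneg _).trans (bd n θ))
    · simpa using (((h.Wb θ).sub (h.Wb π)).abs.const_mul (exp C1)).mul_const (32 * D.C / |θ - π|)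
def QQ (D : Dat) (F : ℂ → ℂ) (n : ℕ) (x : ℂ) : ℝ :=
  D.tt n / D.δ n * ((exp (D.V n x / 2) - exp (D.W n x / 2)) * D.XX F D.H n x)
lemma Q0 (h : D.LM C1 s) (hF : GF F F' ψ E) : Tendsto (fun n => bint (QQ D F n)) atTop (nhds 0) := by
  have ok := h.ok
  have z : (0:ℝ) = bint (fun _ => (0:ℝ)) := by simp [bint]
  have bd : ∀ n, ∀ θ ∈ Set.Icc 0 (2 * π), θ ≠ π →
      |QQ D F n (bpt θ)| ≤ (exp C1 * 20 * gB θ) * (D.tt n * |D.XX F D.H n (bpt θ)|) := fun n θ hθ hn => by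
    have a := ok.expWl2 h.hC n (bpt_mem θ) ((h.bf n).bd _ (bpt_mem θ))
    have dp := abs_pos.2 (h.dn n)
    have eL : |D.L n (bpt θ)| ≤ |D.δ n| * (20 * gB θ) := by
      have : D.L n (bpt θ) = D.δ n * (-5 * el (D.r n) (bpt θ)) := by
        unfold L LL; rw [mg_circ (ok.q1 n) (ok.r0 n) (ok.r1 n)]; ring
      rw [this, abs_mul, abs_mul, abs_neg, abs_of_pos (by norm_num : (0:ℝ) < 5)]
      exact mul_le_mul_of_nonneg_left (by linarith [el_circ (ok.r0 n) (ok.r1 n) hθ hn]) dp.le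
    have b : |exp (D.V n (bpt θ) / 2) - exp (D.W n (bpt θ) / 2)| / |D.δ n| ≤
        exp C1 * 20 * gB θ := by
      rw [div_le_iff₀ dp]
      refine a.trans ((mul_le_mul_of_nonneg_left eL (exp_pos C1).le).trans (le_of_eq (by ring)))
    unfold QQ
    rw [abs_mul, abs_div, abs_mul, abs_of_pos (ok.tpos n)]
    have := mul_le_mul_of_nonneg_right b
      (mul_nonneg (ok.tpos n).le (abs_nonneg (D.XX F D.H n (bpt θ))))
    refine le_trans (le_of_eq (by ring)) this
  rw [z]
  have hC0 := ok.C0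
  refine bdct (A := 0) (B := exp C1 * 20 * (16 * D.C)) (fun n => ?_)
    (fun n θ hθ hn => ?_) fun θ hθ hn => ?_
  · exact continuousOn_const.mul ((((ok.VS n).s1.cont.div_const 2).rexp.sub
      ((ok.WS n).s1.cont.div_const 2).rexp).mul (ok.XXc hF ok.hH n))
  · refine (bd n θ hθ hn).trans ?_
    have a := mul_le_mul_of_nonneg_left (ok.XXb hF ok.dH n (bpt_mem θ)) (ok.tpos n).le
    have b := mul_le_mul_of_nonneg_left (ok.tb n (bpt_mem θ)) (show 0 ≤ 8 * D.C by linarith)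
    have e : D.tt n * (8 * D.C / ‖1 + D.r n * bpt θ‖) = 8 * D.C * (D.tt n / ‖1 + D.r n * bpt θ‖) := by ring
    have c : D.tt n * |D.XX F D.H n (bpt θ)| ≤ 16 * D.C := by linarith
    have := mul_le_mul_of_nonneg_left c (show 0 ≤ exp C1 * 20 * gB θ by
      have := gB_nonneg θ; positivity)
    linarith
  · refine squeeze_zero_norm (a := fun n => (exp C1 * 20 * gB θ) * (D.tt n * (32 * D.C / |θ - π|)))
      (fun n => (bd n θ hθ hn).trans ?_) ?_
    · have := gB_nonneg θ
      have := (ok.tpos n).le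
      have := h.XXcirc hF n hθ hn
      gcongr
    · simpa using (ok.tlim.mul_const (32 * D.C / |θ - π|)).const_mul (exp C1 * 20 * gB θ)
theorem bal (h : D.LM C1 s) (hF : GF F F' ψ E) : ∃ A R : ℕ → ℝ, (∀ n, D.tt n * A n = D.δ n * R n) ∧
    Tendsto A atTop (nhds (2 * (2 * π / (s * (D.H D.p + s)) * fderiv ℝ D.K D.p (D.p * F 0)) +
      4 * (0 + s⁻¹ * (2 * π * fderiv ℝ D.H D.p (D.p * F 0))))) ∧
    Tendsto R atTop (nhds (-2 * (∫ x in oD, D.K D.p * exp (VV s 0 0 (D.H D.p) x) * (-5 * (E x).re)) -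
      2 * bint (fun x => D.H D.p * s⁻¹ * (-5 * (E x).re)) + 5 * 0 - 4 * 0)) := by
  have ok := h.ok
  refine ⟨_, _, fun n => ?_, ((h.A1 hF).const_mul 2).add (((h.A3 hF).add
    ((h.expl (h.Wb π)).mul (h.A2 hF))).const_mul 4), ((((h.R1 hF).const_mul (-2)).sub
    ((h.R2 hF).const_mul 2)).add ((h.R3 hF).const_mul 5)).sub ((h.Q0 hF).const_mul 4)⟩
  have id := ident (δ := D.δ n) hF.ff (ok.WS n) (ok.LS n).s1 (ok.KfS n) (ok.HfS n)
    (fun x hx => by rw [ok.Wlap n hx, Dat.OK.VWL n]) (fun θ => by rw [ok.Wnd n, Dat.OK.VWL n])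
  simp only [← Dat.OK.VWL] at id
  have e1 : ∫ x in oD, exp (D.V n x) * pd (D.Kf n) (F x) x =
      D.tt n * ∫ x in oD, exp (D.V n x) * D.XX F D.K n x := by
    rw [← dmul]; exact dcongr fun x hx => by rw [ok.pdK n (oD_sub hx)]; ring
  have e2 : ∫ x in oD, D.Kf n x * exp (D.V n x) * pd (D.L n) (F x) x =
      D.δ n * ∫ x in oD, D.Kf n x * exp (D.V n x) * D.GG F n x := by
    rw [← dmul]; exact dcongr fun x hx => by rw [ok.pdL n (oD_sub hx)]; ring
  have e3 : bint (fun x => D.Hf n x * exp (D.V n x / 2) * pd (D.L n) (F x) x) =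
      D.δ n * bint (fun x => D.Hf n x * exp (D.V n x / 2) * D.GG F n x) := by
    rw [← bmul]; exact bcongr fun θ => by beta_reduce; rw [ok.pdL n (bpt_mem θ)]; ring
  have e4 : bint (fun x => exp (D.V n x / 2) * pd (D.Hf n) (F x) x) =
      D.δ n * bint (QQ D F n) + D.tt n * (bint (fun x => (exp (D.W n x / 2) -
        exp (D.W n (bpt π) / 2)) * D.XX F D.H n x) + exp (D.W n (bpt π) / 2) * bint (D.XX F D.H n)) := by
    have cX := ok.XXc hF ok.hH n
    have cV := ((ok.VS n).s1.cont.div_const 2).rexp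
    have cW := ((ok.WS n).s1.cont.div_const 2).rexp
    have c1 : ContinuousOn (fun x => D.δ n * QQ D F n x) cD :=
      continuousOn_const.mul (continuousOn_const.mul ((cV.sub cW).mul cX))
    have c2 : ContinuousOn (fun x => (exp (D.W n x / 2) -
        exp (D.W n (bpt π) / 2)) * D.XX F D.H n x) cD := (cW.sub continuousOn_const).mul cX
    have c3 : ContinuousOn (fun x => exp (D.W n (bpt π) / 2) * D.XX F D.H n x) cD :=
      continuousOn_const.mul cX
    have c4 : ContinuousOn (fun x => D.tt n * ((exp (D.W n x / 2) -
        exp (D.W n (bpt π) / 2)) * D.XX F D.H n x + exp (D.W n (bpt π) / 2) * D.XX F D.H n x)) cD :=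
      continuousOn_const.mul (c2.add c3)
    rw [← bmul, ← bmul (exp (D.W n (bpt π) / 2)), ← badd c2 c3, ← bmul (D.tt n), ← badd c1 c4]
    refine bcongr fun θ => ?_
    have := h.dn n
    beta_reduce
    rw [ok.pdH n (bpt_mem θ)]
    unfold QQ; field_simp; ring
  rw [e1, e2, e3, e4] at id
  linear_combination id
end Dat.LM
open Dat
lemma VV_even (s h : ℝ) (x : ℂ) : VV s 0 0 h (-x) = VV s 0 0 h x := by
  unfold VV gg; simp
lemma int_odd (hf : ∀ x, f (-x) = -f x) : ∫ x in oD, f x = 0 := by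
  have := int_neg f
  simp only [hf, integral_neg] at this
  linarith
namespace Dat.LM
variable {D : Dat} {C1 s : ℝ}
def LL (D : Dat) (s : ℝ) (v : ℂ) : ℝ :=
  2 * (2 * π / (s * (D.H D.p + s)) * fderiv ℝ D.K D.p v) + 4 * (s⁻¹ * (2 * π * fderiv ℝ D.H D.p v))
lemma bal1 (h : D.LM C1 s) : ∃ A R : ℕ → ℝ, (∀ n, D.tt n * A n = D.δ n * R n) ∧
    Tendsto A atTop (nhds (LL D s D.p)) ∧ Tendsto R atTop (nhds (20 * π)) := by
  obtain ⟨A, R, h1, h2, h3⟩ := h.bal gf1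
  refine ⟨A, R, h1, ?_, ?_⟩
  · have e : D.p * F1 0 = D.p := by simp [F1]
    rw [e, zero_add] at h2
    exact h2
  · have sV := (VV_S2 h.hg).s1.cont.rexp
    have c1 : ContinuousOn (fun x => (-5 * D.K D.p) * exp (VV s 0 0 (D.H D.p) x)) cD :=
      continuousOn_const.mul sV
    have c2 : ContinuousOn (fun x : ℂ => (5 * D.K D.p) * (exp (VV s 0 0 (D.H D.p) x) * x.re)) cD :=
      continuousOn_const.mul (sV.mul continuous_re.continuousOn)
    have e1 : ∫ x in oD, D.K D.p * exp (VV s 0 0 (D.H D.p) x) * (-5 * (1 - x).re) =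
        -5 * D.K D.p * (2 * π / (s * (D.H D.p + s))) := by
      have o : ∫ x in oD, exp (VV s 0 0 (D.H D.p) x) * x.re = 0 :=
        int_odd fun x => by rw [VV_even]; simp
      rw [← h.ms, dcongr (g := fun x => (-5 * D.K D.p) * exp (VV s 0 0 (D.H D.p) x) +
        (5 * D.K D.p) * (exp (VV s 0 0 (D.H D.p) x) * x.re)) (fun x _ => by
          rw [sub_re, one_re]; ring), dadd c1 c2, dmul, dmul, o]; ring
    have e2 : bint (fun x => D.H D.p * s⁻¹ * (-5 * (1 - x).re)) = D.H D.p * s⁻¹ * (-5) * (2 * π) := by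
      rw [bcongr (g := fun x => (-5 * (D.H D.p * s⁻¹)) + (5 * (D.H D.p * s⁻¹)) * x.re) (fun θ => by
        beta_reduce; rw [sub_re, one_re]; ring), badd (f := fun _ => -5 * (D.H D.p * s⁻¹)) (g := fun x : ℂ => (5 * (D.H D.p * s⁻¹)) * x.re)
        continuousOn_const (continuousOn_const.mul continuous_re.continuousOn), bconst, bmul, bint_re]; ring
    beta_reduce at h3
    rw [e1, e2] at h3
    convert h3 using 2
    have hk : D.K D.p = (s - D.H D.p) * (s + D.H D.p) := by linarith [h.hsk]
    have := h.s0
    have := h.hh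
    have : D.H D.p + s ≠ 0 := by linarith
    rw [hk]; field_simp; ring
lemma bal2 (h : D.LM C1 s) : ∃ A R : ℕ → ℝ, (∀ n, D.tt n * A n = D.δ n * R n) ∧
    Tendsto A atTop (nhds (LL D s (I * D.p))) ∧ Tendsto R atTop (nhds 0) := by
  obtain ⟨A, R, h1, h2, h3⟩ := h.bal gf2
  refine ⟨A, R, h1, ?_, ?_⟩
  · have e : D.p * F2 0 = I * D.p := by simp [F2, mul_comm]
    rw [e, zero_add] at h2
    exact h2
  · have e1 : ∫ x in oD, D.K D.p * exp (VV s 0 0 (D.H D.p) x) * (-5 * (I * (1 + x)).re) = 0 :=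
      int_odd fun x => by rw [VV_even]; simp
    have e2 : bint (fun x => D.H D.p * s⁻¹ * (-5 * (I * (1 + x)).re)) = 0 := by
      rw [bcongr (g := fun x => (5 * (D.H D.p * s⁻¹)) * x.im) (fun θ => by simp; ring), bmul, bint_im, mul_zero]
    beta_reduce at h3
    rw [e1, e2] at h3
    simpa using h3
lemma loc (h : D.LM C1 s) : LL D s (I * D.p) = 0 ∧ ((∀ n, 0 < D.δ n) → 0 ≤ LL D s D.p) ∧
    ((∀ n, D.δ n < 0) → LL D s D.p ≤ 0) := by
  obtain ⟨A, R, a1, a2, a3⟩ := h.bal1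
  obtain ⟨B, S, b1, b2, b3⟩ := h.bal2
  have ev : ∀ᶠ n in atTop, 0 < R n := a3.eventually (lt_mem_nhds (by positivity))
  refine ⟨?_, fun hd => ?_, fun hd => ?_⟩
  · have e : ∀ n, B n * R n = A n * S n := fun n => by
      have := (h.ok.tpos n).ne'
      refine mul_left_cancel₀ this ?_
      linear_combination (R n) * b1 n - S n * a1 n
    have l1 := b2.mul a3
    have l2 := a2.mul b3
    simp only [e] at l1
    have := tendsto_nhds_unique l1 l2
    rw [mul_zero] at this
    exact (mul_eq_zero.1 this).resolve_right (by positivity)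
  · refine ge_of_tendsto a2 ?_
    filter_upwards [ev] with n hn
    have := mul_pos (hd n) hn
    rw [← a1] at this
    exact (pos_of_mul_pos_right this (h.ok.tpos n).le).le
  · refine le_of_tendsto a2 ?_
    filter_upwards [ev] with n hn
    have := mul_neg_of_neg_of_pos (hd n) hn
    rw [← a1] at this
    by_contra hc
    push Not at hc
    have := mul_pos (h.ok.tpos n) hc
    linarith
lemma phi (h : D.LM C1 s) (v : ℂ) : pd (Phi D.K D.H) v D.p = (D.H D.p + s) / (8 * π) * LL D s v := by
  have es : √(D.H D.p ^ 2 + D.K D.p) = s := by rw [← h.hsk]; exact sqrt_sq h.s0.le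
  have dH : HasFDerivAt D.H _ D.p := (h.ok.hH.differentiable (by norm_num) D.p).hasFDerivAt
  have dK : HasFDerivAt D.K _ D.p := (h.ok.hK.differentiable (by norm_num) D.p).hasFDerivAt
  have hne : D.H D.p ^ 2 + D.K D.p ≠ 0 := by rw [← h.hsk]; exact pow_ne_zero 2 h.s0.ne'
  have := dH.add (((dH.pow 2).add dK).sqrt hne)
  unfold pd
  have e : fderiv ℝ (Phi D.K D.H) D.p = _ := this.fderiv
  have s0 := h.s0
  have hs : D.H D.p + s ≠ 0 := by linarith [h.hh]
  rw [e]
  simp [es, LL]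
  field_simp
  ring
end Dat.LM
namespace Dat
def sub (D : Dat) (φ : ℕ → ℕ) : Dat :=
  { D with ε := fun n => D.ε (φ n), q := fun n => D.q (φ n), r := fun n => D.r (φ n), u := fun n => D.u (φ n) }
lemma OK.sub {D : Dat} (h : D.OK) {φ : ℕ → ℕ} (hφ : StrictMono φ) : (D.sub φ).OK where
  hK := h.hK
  hH := h.hH
  hp := h.hp
  C0 := h.C0
  bK := h.bK
  bH := h.bH
  dK := h.dK
  dH := h.dH
  q1 n := h.q1 _
  r0 n := h.r0 _
  r1 n := h.r1 _
  rl := h.rl.comp hφ.tendsto_atTop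
  ql := h.ql.comp hφ.tendsto_atTop
  εl := h.εl.comp hφ.tendsto_atTop
  ε2 n := h.ε2 _
  uS n := h.uS _
  eq1 n := h.eq1 _
  eq2 n := h.eq2 _
  vb n := h.vb _
  b1 n := h.b1 _
  b2 n := h.b2 _
theorem OK.final {D : Dat} (h : D.OK) (kn : D.K D.p < 0) (hs : 0 < D.H D.p ^ 2 + D.K D.p)
    (h1 : ContDiffOn ℝ 2 D.H oD) (h2 : ∀ x ∈ oD, lap D.H x = 0) (e0 : ∀ n, D.ε n ≠ 0) :
    tderiv (Phi D.K D.H) D.p = 0 ∧ ((∀ n, 0 < D.ε n) → 0 ≤ nderiv (Phi D.K D.H) D.p) ∧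
    ((∀ n, D.ε n < 0) → nderiv (Phi D.K D.H) D.p ≤ 0) := by
  obtain ⟨C1, hC, hL, hAS, hb1, hb2⟩ := h.AS1
  obtain ⟨hh, φ, hφ, hg, hu, hae, hm⟩ := hAS.core kn hs hb1 hb2
  have ep := fun n => h.epos n
  have lm : (D.sub φ).LM C1 √(D.H D.p ^ 2 + D.K D.p) :=
    { ok := h.sub hφ
      kn := kn
      s0 := sqrt_pos.2 hs
      hsk := sq_sqrt hs.le
      hh := hh
      hC := hC
      Lb := fun n => hL _
      bf := fun n => hAS.bf _
      hg := hg
      ut := hu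
      ae := hae
      ms := hm
      h1 := h1
      h2 := h2
      dn := fun n => div_ne_zero (e0 _) (by have : 1 / 2 ≤ 1 + (D.sub φ).ε n := ep (φ n); linarith) }
  obtain ⟨a, b, c⟩ := lm.loc
  have ht := lm.phi (I * D.p)
  have hn := lm.phi D.p
  rw [show I * D.p = I * (D.sub φ).p from rfl, a, mul_zero] at ht
  have pos : 0 < ((D.sub φ).H (D.sub φ).p + √(D.H D.p ^ 2 + D.K D.p)) / (8 * π) :=
    div_pos (add_pos lm.hh lm.s0) (by positivity)
  rw [tderiv_eq, nderiv_eq]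
  refine ⟨ht, fun hp => ?_, fun hp => ?_⟩
  · have := b fun n => div_pos (hp _) (by have : 1 / 2 ≤ 1 + (D.sub φ).ε n := ep (φ n); linarith)
    exact (mul_nonneg pos.le this).trans_eq hn.symm
  · have := c fun n => div_neg_of_neg_of_pos (hp _) (by have : 1 / 2 ≤ 1 + (D.sub φ).ε n := ep (φ n); linarith)
    exact hn.trans_le (mul_nonpos_of_nonneg_of_nonpos pos.le this)
end Dat
lemma vv_recen {a : ℂ} (u : ℂ → ℝ) (h0 : a ≠ 0) (h1 : ‖a‖ < 1) (hy : y ∈ cD) :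
    vv u (a / (‖a‖ : ℂ)) ‖a‖ y = recen a u (a / (‖a‖ : ℂ) * y) := by
  have n0 : 0 < ‖a‖ := norm_pos_iff.2 h0
  have n1 : (‖a‖ : ℂ) ≠ 0 := by exact_mod_cast n0.ne'
  have e : (starRingEnd ℂ) a * (a / (‖a‖ : ℂ) * y) = ‖a‖ * y := by
    have : (starRingEnd ℂ) a * a = (‖a‖ : ℂ) ^ 2 := Complex.conj_mul' a
    field_simp
    rw [← this]
  have hd := den_ne n0 h1 hy
  have c : 0 < ‖1 + (‖a‖ : ℂ) * y‖ := norm_pos_iff.2 hd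
  unfold vv recen moeb mg el
  rw [e, log_div (by nlinarith) (by positivity), log_pow]
  have : a / (‖a‖ : ℂ) * ((‖a‖ + y) / (1 + ‖a‖ * y)) = (a + a / (‖a‖ : ℂ) * y) / (1 + ‖a‖ * y) := by
    field_simp
  rw [this]; push_cast; ring
lemma rot_int {q : ℂ} (hq : ‖q‖ = 1) (f : ℂ → ℝ) : ∫ x in oD, f (q * x) = ∫ x in oD, f x := by
  let c : Circle := ⟨q, by simpa [Submonoid.unitSphere] using hq⟩
  have h := (rotation c).measurePreserving
  have e : (rotation c) ⁻¹' oD = oD := by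
    ext x; simp [c]
  have := h.setIntegral_preimage_emb (rotation c).toHomeomorph.measurableEmbedding f oD
  rw [e] at this
  exact this
/-- Theorem 4.2: localization of the blow-up point. If the solutions blow up with
the bubble decomposition and ε_n has a fixed sign, then ∂_τΦ(p) = 0 and
ε_n·∂_νΦ(p) ≥ 0. -/
theorem blowup_point_localization
    (K h H : ℂ → ℝ)
    (hK : ContDiff ℝ 2 K)
    (hKneg : ∀ x ∈ closedUnitDisk, K x < 0)
    (hh : ContDiff ℝ 2 (fun θ => h (bpt θ)))
    (hH : IsHarmExt h H)
    (εs : ℕ → ℝ) (hεs0 : Tendsto εs atTop (nhds 0)) (hεs1 : ∀ n, -1 < εs n)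
    (us : ℕ → ℂ → ℝ) (hus : ∀ n, IsPerturbedSolution K h (εs n) (us n))
    (aa : ℕ → ℂ) (haa : ∀ n, aa n ∈ unitDisk) (haa0 : ∀ n, aa n ≠ 0)
    (p : ℂ) (hp : p ∈ unitCircle) (hap : Tendsto aa atTop (nhds p))
    (hpK : 0 < h p ^ 2 + K p)
    (hden : ∀ n, ∀ x ∈ closedUnitDisk, 0 < bubDen K h (εs n) (aa n) x)
    (hψ : ∃ C : ℝ, ∀ n, ∀ x ∈ closedUnitDisk, |us n x - bub K h (εs n) (aa n) x| ≤ C)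
    (hv : ∃ C : ℝ, ∀ n, ∀ x ∈ closedUnitDisk, |recen (aa n) (us n) x| ≤ C)
    (hb1 : ∀ n, ∫ x in unitDisk, x.re * Real.exp (recen (aa n) (us n) x) = 0)
    (hb2 : ∀ n, ∫ x in unitDisk, x.im * Real.exp (recen (aa n) (us n) x) = 0)
    (hsign : (∀ n, 0 < εs n) ∨ (∀ n, εs n < 0)) :
    tderiv (Phi K H) p = 0 ∧
    ((∀ n, 0 < εs n) → 0 ≤ nderiv (Phi K H) p) ∧
    ((∀ n, εs n < 0) → nderiv (Phi K H) p ≤ 0) := by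
  obtain ⟨hH1, hH2, hH3, hH4⟩ := hH
  obtain ⟨Cv, hCv⟩ := hv
  have cb : ∀ {E : Type} [NormedAddCommGroup E] (f : ℂ → E), Continuous f → ∃ C, ∀ x ∈ cD, ‖f x‖ ≤ C :=
    fun f hf => (isCompact_closedBall (0:ℂ) 1).exists_bound_of_continuousOn hf.continuousOn
  have hK1 : ContDiff ℝ 1 K := hK.of_le (by norm_num)
  obtain ⟨c1, h1⟩ := cb K hK1.continuous
  obtain ⟨c2, h2⟩ := cb H hH1.continuous
  obtain ⟨c3, h3⟩ := cb _ (hK1.continuous_fderiv (by norm_num))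
  obtain ⟨c4, h4⟩ := cb _ (hH1.continuous_fderiv (by norm_num))
  obtain ⟨C, hC0, hC1, hC2, hC3, hC4, hC5⟩ : ∃ C : ℝ, 0 ≤ C ∧ c1 ≤ C ∧ c2 ≤ C ∧ c3 ≤ C ∧ c4 ≤ C ∧ Cv ≤ C := by
    refine ⟨|c1| + |c2| + |c3| + |c4| + |Cv|, by positivity, ?_, ?_, ?_, ?_, ?_⟩ <;>
      linarith [le_abs_self c1, le_abs_self c2, le_abs_self c3, le_abs_self c4, le_abs_self Cv,
        abs_nonneg c1, abs_nonneg c2, abs_nonneg c3, abs_nonneg c4, abs_nonneg Cv]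
  obtain ⟨N, hN⟩ := Metric.tendsto_atTop.1 hεs0 (1 / 2) (by norm_num)
  have pn : ‖p‖ = 1 := by simpa [unitCircle] using hp
  have an : ∀ n, ‖aa n‖ < 1 := fun n => by simpa [unitDisk] using haa n
  have a0 : ∀ n, 0 < ‖aa n‖ := fun n => norm_pos_iff.2 (haa0 n)
  have qn : ∀ n, ‖aa n / (‖aa n‖ : ℂ)‖ = 1 := fun n => by
    rw [norm_div, norm_real, norm_norm, div_self (a0 n).ne']
  have rl : Tendsto (fun n => ‖aa n‖) atTop (nhds 1) := pn ▸ hap.norm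
  have ql : Tendsto (fun n => aa n / (‖aa n‖ : ℂ)) atTop (nhds p) := by
    have := hap.div ((Complex.continuous_ofReal.tendsto _).comp rl) (by simp)
    simp only [Complex.ofReal_one, div_one] at this
    exact this
  have sh : Tendsto (fun n => n + N) atTop atTop := tendsto_add_atTop_nat N
  let D : Dat := ⟨K, H, p, C, fun n => εs (n + N), fun n => aa (n + N) / (‖aa (n + N)‖ : ℂ),
    fun n => ‖aa (n + N)‖, fun n => us (n + N)⟩
  have hV : ∀ n, ∀ y ∈ cD, D.V n y = recen (aa (n + N)) (us (n + N)) (D.q n * y) := fun n y hy =>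
    vv_recen _ (haa0 _) (an _) hy
  have qc : ∀ n, ∀ y ∈ cD, D.q n * y ∈ closedUnitDisk := fun n y hy => by
    have a : ‖D.q n‖ = 1 := qn _
    simpa [closedUnitDisk, a] using hy
  have bal : ∀ n, (∫ y in oD, y.re * exp (D.V n y) = 0) ∧ ∫ y in oD, y.im * exp (D.V n y) = 0 := by
    intro n
    have a : ‖D.q n‖ = 1 := qn _
    have cV : ContinuousOn (fun y => exp (D.V n y)) cD :=
      (vv_S2 (hus (n + N)).1 (a0 _) (an _)).s1.cont.rexp
    have c1 : ContinuousOn (fun y : ℂ => y.re * exp (D.V n y)) cD :=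
      continuous_re.continuousOn.mul cV
    have c2 : ContinuousOn (fun y : ℂ => y.im * exp (D.V n y)) cD :=
      continuous_im.continuousOn.mul cV
    have cc : ∀ a b : ℝ, ∫ y in oD, (a * (y.re * exp (D.V n y)) + b * (y.im * exp (D.V n y))) =
        a * (∫ y in oD, y.re * exp (D.V n y)) + b * ∫ y in oD, y.im * exp (D.V n y) := fun a b => by
      rw [← dmul, ← dmul]
      exact dadd (continuousOn_const.mul c1) (continuousOn_const.mul c2)
    have r1 := hb1 (n + N)
    have r2 := hb2 (n + N)
    unfold unitDisk at r1 r2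
    rw [← rot_int a, dcongr (g := fun y => (D.q n).re * (y.re * exp (D.V n y)) +
      (-(D.q n).im) * (y.im * exp (D.V n y))) (fun y hy => by
        rw [hV n y (oD_sub hy), mul_re]; ring),
      cc] at r1
    rw [← rot_int a, dcongr (g := fun y => (D.q n).im * (y.re * exp (D.V n y)) +
      (D.q n).re * (y.im * exp (D.V n y))) (fun y hy => by
        rw [hV n y (oD_sub hy), mul_im]; ring),
      cc] at r2
    have q2 : (D.q n).re ^ 2 + (D.q n).im ^ 2 = 1 := by
      have := Complex.sq_norm (D.q n)
      rw [a, normSq_apply] at this; linarith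
    generalize (∫ y in oD, y.re * exp (D.V n y)) = X at *
    generalize (∫ y in oD, y.im * exp (D.V n y)) = Y at *
    constructor
    · linear_combination (D.q n).re * r1 + (D.q n).im * r2 - X * q2
    · linear_combination (D.q n).re * r2 - (D.q n).im * r1 - Y * q2
  have e1 : ∀ n, 1 + εs n ≠ 0 := fun n => by linarith [hεs1 n]
  have ok : D.OK :=
    { hK := hK1
      hH := hH1
      hp := pn
      C0 := hC0
      bK := fun x hx => (h1 x hx).trans hC1
      bH := fun x hx => (h2 x hx).trans hC2
      dK := fun x hx => (h3 x hx).trans hC3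
      dH := fun x hx => (h4 x hx).trans hC4
      q1 := fun n => qn _
      r0 := fun n => a0 _
      r1 := fun n => an _
      rl := rl.comp sh
      ql := ql.comp sh
      εl := hεs0.comp sh
      ε2 := fun n => by
        have := hN (n + N) (by omega)
        rw [Real.dist_eq, sub_zero] at this
        exact this.le
      uS := fun n => (hus _).1
      eq1 := fun n x hx => by
        have := (hus (n + N)).2.1 x hx
        have h := e1 (n + N)
        have k : 2 * Ktil (εs (n + N)) = -D.δ n := by
          change 2 * (-εs (n + N) / (2 * (1 + εs (n + N)))) = -(εs (n + N) / (1 + εs (n + N)))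
          field_simp
        change lap (us (n + N)) x + D.δ n = -2 * Keps K (εs (n + N)) x * exp (us (n + N) x)
        linarith
      eq2 := fun n x hx => by
        have hx1 : x ∈ unitCircle := by simpa [unitCircle] using hx
        have := (hus (n + N)).2.2 x hx1
        have h := e1 (n + N)
        have k : 2 * htil (εs (n + N)) = 2 - 2 * D.δ n := by
          change 2 * (1 / (1 + εs (n + N))) = 2 - 2 * (εs (n + N) / (1 + εs (n + N)))
          field_simp; ring
        unfold heps at this
        rw [← hH4 x hx1] at this
        change nderiv (us (n + N)) x = 2 * (H x / (1 + εs (n + N))) * exp (us (n + N) x / 2) - 2 + 2 * D.δ n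
        linarith
      vb := fun n y hy => by
        rw [hV n y hy]; exact (hCv _ _ (qc n y hy)).trans hC5
      b1 := fun n => (bal n).1
      b2 := fun n => (bal n).2 }
  have kn : K p < 0 := hKneg p (by simp [closedUnitDisk, pn])
  have hs : 0 < H p ^ 2 + K p := by rw [hH4 p hp]; exact hpK
  obtain ⟨A, B, E⟩ := ok.final kn hs hH2 hH3 (fun n => hsign.elim (fun h => (h _).ne') (fun h => (h _).ne))
  exact ⟨A, fun h => B fun n => h _, fun h => E fun n => h _⟩

end
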